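/- Let T be a recursively enumerable extension of PA_□. (1) If T contains PA(K), T ⊬ □⊥, and T has ΣB-DP, then T is weakly ΣB-sound. (2) If T is weakly ΣB-sound, then T has ΣB-EP. -/

import Mathlib

namespace ModalArith

/-- Terms of the language of arithmetic L_A = {0, S, +, ×, ≤, =}. -/
inductive Term : Type
  | var : ℕ → Term
  | zero : Term
  | succ : Term → Term
  | add : Term → Term → Term
  | mul : Term → Term → Term
  deriving DecidableEq

namespace Term

/-- Free variables of a term. -/
def fv : Term → Finset ℕ
  | var x => {x}
  | zero => ∅
  | succ t => fv t
  | add t u => fv t ∪ fv u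
  | mul t u => fv t ∪ fv u

/-- Simultaneous substitution of terms for variables. -/
def substAll : Term → (ℕ → Term) → Term
  | var x, v => v x
  | zero, _ => zero
  | succ t, v => succ (substAll t v)
  | add t u, v => add (substAll t v) (substAll u v)
  | mul t u, v => mul (substAll t v) (substAll u v)

/-- Substitution of the term `s` for the variable `x`. -/
def subst (x : ℕ) (s : Term) (t : Term) : Term :=
  substAll t (Function.update Term.var x s)

/-- The numeral `n̄`. -/
def numeral : ℕ → Term
  | 0 => zero
  | n + 1 => succ (numeral n)

/-- Value of a term in the standard model under a valuation. -/
def val : Term → (ℕ → ℕ) → ℕ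
  | var x, v => v x
  | zero, _ => 0
  | succ t, v => val t v + 1
  | add t u, v => val t v + val u v
  | mul t u, v => val t v * val u v

/-- A Gödel numbering of terms. -/
def code : Term → ℕ
  | var x => Nat.pair 0 x
  | zero => Nat.pair 1 0
  | succ t => Nat.pair 2 (code t)
  | add t u => Nat.pair 3 (Nat.pair (code t) (code u))
  | mul t u => Nat.pair 4 (Nat.pair (code t) (code u))

end Term

/-- Formulas of the language L_□ of modal arithmetic. -/
inductive Formula : Type
  | falsum : Formula
  | eq : Term → Term → Formula
  | le : Term → Term → Formula
  | and : Formula → Formula → Formula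
  | or : Formula → Formula → Formula
  | imp : Formula → Formula → Formula
  | neg : Formula → Formula
  | all : ℕ → Formula → Formula
  | ex : ℕ → Formula → Formula
  | box : Formula → Formula
  deriving DecidableEq

namespace Formula

/-- Free variables of a formula. -/
def fv : Formula → Finset ℕ
  | falsum => ∅
  | eq t u => t.fv ∪ u.fv
  | le t u => t.fv ∪ u.fv
  | and φ ψ => fv φ ∪ fv ψ
  | or φ ψ => fv φ ∪ fv ψ
  | imp φ ψ => fv φ ∪ fv ψ
  | neg φ => fv φ
  | all x φ => (fv φ).erase x
  | ex x φ => (fv φ).erase x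
  | box φ => fv φ

/-- Simultaneous substitution of terms for the free variables of a formula. -/
def substAll : Formula → (ℕ → Term) → Formula
  | falsum, _ => falsum
  | eq t u, v => eq (t.substAll v) (u.substAll v)
  | le t u, v => le (t.substAll v) (u.substAll v)
  | and φ ψ, v => and (substAll φ v) (substAll ψ v)
  | or φ ψ, v => or (substAll φ v) (substAll ψ v)
  | imp φ ψ, v => imp (substAll φ v) (substAll ψ v)
  | neg φ, v => neg (substAll φ v)
  | all x φ, v => all x (substAll φ (Function.update v x (Term.var x)))
  | ex x φ, v => ex x (substAll φ (Function.update v x (Term.var x)))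
  | box φ, v => box (substAll φ v)

/-- Substitution of the term `s` for the free occurrences of the variable `x`. -/
def subst (x : ℕ) (s : Term) (φ : Formula) : Formula :=
  substAll φ (Function.update Term.var x s)

/-- The term `s` is substitutable (free) for the variable `x` in the formula. -/
def freeFor (s : Term) (x : ℕ) : Formula → Prop
  | falsum => True
  | eq _ _ => True
  | le _ _ => True
  | and φ ψ => freeFor s x φ ∧ freeFor s x ψ
  | or φ ψ => freeFor s x φ ∧ freeFor s x ψ
  | imp φ ψ => freeFor s x φ ∧ freeFor s x ψ
  | neg φ => freeFor s x φ
  | all y φ => x = y ∨ x ∉ fv φ ∨ (y ∉ s.fv ∧ freeFor s x φ)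
  | ex y φ => x = y ∨ x ∉ fv φ ∨ (y ∉ s.fv ∧ freeFor s x φ)
  | box φ => freeFor s x φ

/-- The formula is an L_A-formula (contains no □). -/
def noBox : Formula → Prop
  | falsum => True
  | eq _ _ => True
  | le _ _ => True
  | and φ ψ => noBox φ ∧ noBox ψ
  | or φ ψ => noBox φ ∧ noBox ψ
  | imp φ ψ => noBox φ ∧ noBox ψ
  | neg φ => noBox φ
  | all _ φ => noBox φ
  | ex _ φ => noBox φ
  | box _ => False

/-- Truth in the standard model ℕ under a valuation (meaningful for L_A-formulas;
boxed formulas are given the dummy value `False`). -/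
def val : Formula → (ℕ → ℕ) → Prop
  | falsum, _ => False
  | eq t u, v => t.val v = u.val v
  | le t u, v => t.val v ≤ u.val v
  | and φ ψ, v => val φ v ∧ val ψ v
  | or φ ψ, v => val φ v ∨ val ψ v
  | imp φ ψ, v => val φ v → val ψ v
  | neg φ, v => ¬ val φ v
  | all x φ, v => ∀ n : ℕ, val φ (Function.update v x n)
  | ex x φ, v => ∃ n : ℕ, val φ (Function.update v x n)
  | box _, _ => False

/-- Biconditional, as an abbreviation. -/
def iff (φ ψ : Formula) : Formula := (φ.imp ψ).and (ψ.imp φ)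

/-- `t < u` abbreviates `S t ≤ u`. -/
def lt (t u : Term) : Formula := le (Term.succ t) u

/-- Bounded universal quantification `∀ x < t, φ`. -/
def ball (x : ℕ) (t : Term) (φ : Formula) : Formula :=
  all x ((lt (Term.var x) t).imp φ)

/-- Bounded existential quantification `∃ x < t, φ`. -/
def bex (x : ℕ) (t : Term) (φ : Formula) : Formula :=
  ex x ((lt (Term.var x) t).and φ)

/-- A Gödel numbering of formulas. -/
def code : Formula → ℕ
  | falsum => Nat.pair 0 0
  | eq t u => Nat.pair 1 (Nat.pair t.code u.code)
  | le t u => Nat.pair 2 (Nat.pair t.code u.code)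
  | and φ ψ => Nat.pair 3 (Nat.pair (code φ) (code ψ))
  | or φ ψ => Nat.pair 4 (Nat.pair (code φ) (code ψ))
  | imp φ ψ => Nat.pair 5 (Nat.pair (code φ) (code ψ))
  | neg φ => Nat.pair 6 (code φ)
  | all x φ => Nat.pair 7 (Nat.pair x (code φ))
  | ex x φ => Nat.pair 8 (Nat.pair x (code φ))
  | box φ => Nat.pair 9 (code φ)

end Formula

/-- A sentence is a formula with no free variables. -/
def Sentence (φ : Formula) : Prop := φ.fv = ∅

/-- Truth in the standard model ℕ (for sentences; any fixed valuation will do). -/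
def StdTrue (φ : Formula) : Prop := φ.val fun _ => 0

/-- The logical axioms of classical first-order logic with equality for L_□,
with the identity axioms only for atomic formulas. -/
inductive LogicalAxiom : Formula → Prop
  | imp1 (φ ψ : Formula) : LogicalAxiom (φ.imp (ψ.imp φ))
  | imp2 (φ ψ χ : Formula) :
      LogicalAxiom ((φ.imp (ψ.imp χ)).imp ((φ.imp ψ).imp (φ.imp χ)))
  | dne (φ : Formula) : LogicalAxiom (φ.neg.neg.imp φ)
  | negI (φ ψ : Formula) : LogicalAxiom ((φ.imp ψ).imp ((φ.imp ψ.neg).imp φ.neg))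
  | negE (φ ψ : Formula) : LogicalAxiom (φ.neg.imp (φ.imp ψ))
  | falsumE (φ : Formula) : LogicalAxiom (Formula.falsum.imp φ)
  | negIntro (φ : Formula) : LogicalAxiom ((φ.imp Formula.falsum).imp φ.neg)
  | negElimFalsum (φ : Formula) : LogicalAxiom (φ.neg.imp (φ.imp Formula.falsum))
  | andI (φ ψ : Formula) : LogicalAxiom (φ.imp (ψ.imp (φ.and ψ)))
  | andE1 (φ ψ : Formula) : LogicalAxiom ((φ.and ψ).imp φ)
  | andE2 (φ ψ : Formula) : LogicalAxiom ((φ.and ψ).imp ψ)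
  | orI1 (φ ψ : Formula) : LogicalAxiom (φ.imp (φ.or ψ))
  | orI2 (φ ψ : Formula) : LogicalAxiom (ψ.imp (φ.or ψ))
  | orE (φ ψ χ : Formula) :
      LogicalAxiom ((φ.imp χ).imp ((ψ.imp χ).imp ((φ.or ψ).imp χ)))
  | allE (x : ℕ) (t : Term) (φ : Formula) :
      φ.freeFor t x → LogicalAxiom ((Formula.all x φ).imp (φ.subst x t))
  | allImp (x : ℕ) (φ ψ : Formula) :
      x ∉ φ.fv → LogicalAxiom ((Formula.all x (φ.imp ψ)).imp (φ.imp (Formula.all x ψ)))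
  | exI (x : ℕ) (t : Term) (φ : Formula) :
      φ.freeFor t x → LogicalAxiom ((φ.subst x t).imp (Formula.ex x φ))
  | exE (x : ℕ) (φ ψ : Formula) :
      x ∉ ψ.fv → LogicalAxiom ((Formula.all x (φ.imp ψ)).imp ((Formula.ex x φ).imp ψ))
  | eqRefl (t : Term) : LogicalAxiom (Formula.eq t t)
  | eqSymm (t u : Term) : LogicalAxiom ((Formula.eq t u).imp (Formula.eq u t))
  | eqTrans (t u w : Term) :
      LogicalAxiom ((Formula.eq t u).imp ((Formula.eq u w).imp (Formula.eq t w)))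
  | eqSucc (t u : Term) :
      LogicalAxiom ((Formula.eq t u).imp (Formula.eq t.succ u.succ))
  | eqAdd (t₁ t₂ u₁ u₂ : Term) :
      LogicalAxiom ((Formula.eq t₁ t₂).imp ((Formula.eq u₁ u₂).imp
        (Formula.eq (t₁.add u₁) (t₂.add u₂))))
  | eqMul (t₁ t₂ u₁ u₂ : Term) :
      LogicalAxiom ((Formula.eq t₁ t₂).imp ((Formula.eq u₁ u₂).imp
        (Formula.eq (t₁.mul u₁) (t₂.mul u₂))))
  | eqLe (t₁ t₂ u₁ u₂ : Term) :
      LogicalAxiom ((Formula.eq t₁ t₂).imp ((Formula.eq u₁ u₂).imp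
        ((Formula.le t₁ u₁).imp (Formula.le t₂ u₂))))

/-- Provability in an L_□-theory: logical axioms, the axioms of the theory, and the
rules modus ponens, generalization, and necessitation. -/
inductive Provable (T : Set Formula) : Formula → Prop
  | ax {φ : Formula} : φ ∈ T → Provable T φ
  | logic {φ : Formula} : LogicalAxiom φ → Provable T φ
  | mp {φ ψ : Formula} : Provable T (φ.imp ψ) → Provable T φ → Provable T ψ
  | gen {φ : Formula} (x : ℕ) : Provable T φ → Provable T (Formula.all x φ)
  | nec {φ : Formula} : Provable T φ → Provable T (Formula.box φ)

/-- First-order provability (no necessitation rule); used for the non-modal theory PA. -/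
inductive FOProvable (T : Set Formula) : Formula → Prop
  | ax {φ : Formula} : φ ∈ T → FOProvable T φ
  | logic {φ : Formula} : LogicalAxiom φ → FOProvable T φ
  | mp {φ ψ : Formula} : FOProvable T (φ.imp ψ) → FOProvable T φ → FOProvable T ψ
  | gen {φ : Formula} (x : ℕ) : FOProvable T φ → FOProvable T (Formula.all x φ)

/-- Basic (Robinson-style) axioms of arithmetic. -/
def succNeZero : Formula := (Formula.eq (Term.succ (Term.var 0)) Term.zero).neg
def succInj : Formula :=
  (Formula.eq (Term.succ (Term.var 0)) (Term.succ (Term.var 1))).imp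
    (Formula.eq (Term.var 0) (Term.var 1))
def addZero : Formula := Formula.eq (Term.add (Term.var 0) Term.zero) (Term.var 0)
def addSucc : Formula :=
  Formula.eq (Term.add (Term.var 0) (Term.succ (Term.var 1)))
    (Term.succ (Term.add (Term.var 0) (Term.var 1)))
def mulZero : Formula := Formula.eq (Term.mul (Term.var 0) Term.zero) Term.zero
def mulSucc : Formula :=
  Formula.eq (Term.mul (Term.var 0) (Term.succ (Term.var 1)))
    (Term.add (Term.mul (Term.var 0) (Term.var 1)) (Term.var 0))
def leDef : Formula :=
  (Formula.le (Term.var 0) (Term.var 1)).iff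
    (Formula.ex 2 (Formula.eq (Term.add (Term.var 0) (Term.var 2)) (Term.var 1)))

def baseAxioms : Set Formula :=
  {succNeZero, succInj, addZero, addSucc, mulZero, mulSucc, leDef}

/-- The induction axiom for the formula `φ` and the variable `x`. -/
def inductionAx (x : ℕ) (φ : Formula) : Formula :=
  ((φ.subst x Term.zero).and
    (Formula.all x (φ.imp (φ.subst x (Term.succ (Term.var x)))))).imp
      (Formula.all x φ)

/-- Peano arithmetic PA: basic axioms plus induction for L_A-formulas. -/
def PA : Set Formula :=
  baseAxioms ∪ {χ | ∃ (x : ℕ) (φ : Formula), φ.noBox ∧ χ = inductionAx x φ}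

/-- PA_□ : basic axioms plus induction for all L_□-formulas. -/
def PABox : Set Formula :=
  baseAxioms ∪ {χ | ∃ (x : ℕ) (φ : Formula), χ = inductionAx x φ}

/-- The distribution axiom K. -/
def axK (φ ψ : Formula) : Formula :=
  (Formula.box (φ.imp ψ)).imp ((Formula.box φ).imp (Formula.box ψ))

/-- PA(K). -/
def PAK : Set Formula := PABox ∪ {χ | ∃ φ ψ : Formula, χ = axK φ ψ}

/-- The axiom 4. -/
def ax4 (φ : Formula) : Formula := (Formula.box φ).imp (Formula.box (Formula.box φ))

/-- PA(K4). -/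
def PAK4 : Set Formula := PAK ∪ {χ | ∃ φ : Formula, χ = ax4 φ}

/-- The axiom of Triv. -/
def axTriv (φ : Formula) : Formula := (Formula.box φ).iff φ

/-- PA(Triv). -/
def PATriv : Set Formula := PAK ∪ {χ | ∃ φ : Formula, χ = axTriv φ}

/-- PA(Ver). -/
def PAVer : Set Formula := PAK ∪ {Formula.box Formula.falsum}

/-- `T` extends `U`: every axiom of `U` is provable in `T`. -/
def Extends (T U : Set Formula) : Prop := ∀ φ ∈ U, Provable T φ

/-- Consistency. -/
def Consistent (T : Set Formula) : Prop := ¬ Provable T Formula.falsum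

/-- The class Δ₀ of bounded L_A-formulas. -/
inductive IsDelta0 : Formula → Prop
  | falsum : IsDelta0 Formula.falsum
  | eq (t u : Term) : IsDelta0 (Formula.eq t u)
  | le (t u : Term) : IsDelta0 (Formula.le t u)
  | and {φ ψ : Formula} : IsDelta0 φ → IsDelta0 ψ → IsDelta0 (φ.and ψ)
  | or {φ ψ : Formula} : IsDelta0 φ → IsDelta0 ψ → IsDelta0 (φ.or ψ)
  | imp {φ ψ : Formula} : IsDelta0 φ → IsDelta0 ψ → IsDelta0 (φ.imp ψ)
  | neg {φ : Formula} : IsDelta0 φ → IsDelta0 φ.neg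
  | ball {x : ℕ} {t : Term} {φ : Formula} :
      x ∉ t.fv → IsDelta0 φ → IsDelta0 (Formula.ball x t φ)
  | bex {x : ℕ} {t : Term} {φ : Formula} :
      x ∉ t.fv → IsDelta0 φ → IsDelta0 (Formula.bex x t φ)

/-- The class Σ₁ of L_A-formulas. -/
inductive IsSigma1 : Formula → Prop
  | delta0 {φ : Formula} : IsDelta0 φ → IsSigma1 φ
  | and {φ ψ : Formula} : IsSigma1 φ → IsSigma1 ψ → IsSigma1 (φ.and ψ)
  | or {φ ψ : Formula} : IsSigma1 φ → IsSigma1 ψ → IsSigma1 (φ.or ψ)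
  | ex {x : ℕ} {φ : Formula} : IsSigma1 φ → IsSigma1 (Formula.ex x φ)
  | ball {x : ℕ} {t : Term} {φ : Formula} :
      x ∉ t.fv → IsSigma1 φ → IsSigma1 (Formula.ball x t φ)

/-- The class B of boxed formulas. -/
def IsB (φ : Formula) : Prop := ∃ ψ : Formula, φ = Formula.box ψ

/-- The class ΔB. -/
inductive IsDeltaB : Formula → Prop
  | delta0 {φ : Formula} : IsDelta0 φ → IsDeltaB φ
  | b (ψ : Formula) : IsDeltaB (Formula.box ψ)
  | and {φ ψ : Formula} : IsDeltaB φ → IsDeltaB ψ → IsDeltaB (φ.and ψ)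
  | or {φ ψ : Formula} : IsDeltaB φ → IsDeltaB ψ → IsDeltaB (φ.or ψ)
  | ball {x : ℕ} {t : Term} {φ : Formula} :
      x ∉ t.fv → IsDeltaB φ → IsDeltaB (Formula.ball x t φ)
  | bex {x : ℕ} {t : Term} {φ : Formula} :
      x ∉ t.fv → IsDeltaB φ → IsDeltaB (Formula.bex x t φ)

/-- The class ΣB. -/
inductive IsSigmaB : Formula → Prop
  | sigma1 {φ : Formula} : IsSigma1 φ → IsSigmaB φ
  | b (ψ : Formula) : IsSigmaB (Formula.box ψ)
  | and {φ ψ : Formula} : IsSigmaB φ → IsSigmaB ψ → IsSigmaB (φ.and ψ)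
  | or {φ ψ : Formula} : IsSigmaB φ → IsSigmaB ψ → IsSigmaB (φ.or ψ)
  | ex {x : ℕ} {φ : Formula} : IsSigmaB φ → IsSigmaB (Formula.ex x φ)
  | ball {x : ℕ} {t : Term} {φ : Formula} :
      x ∉ t.fv → IsSigmaB φ → IsSigmaB (Formula.ball x t φ)

/-- Iterated disjunction (the empty disjunction is ⊥). -/
def disj : List Formula → Formula
  | [] => Formula.falsum
  | [φ] => φ
  | φ :: ψ :: l => φ.or (disj (ψ :: l))

/-- Iterated conjunction (the empty conjunction is ⊤). -/
def conj : List Formula → Formula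
  | [] => Formula.falsum.neg
  | [φ] => φ
  | φ :: ψ :: l => φ.and (conj (ψ :: l))

/-- Γ-disjunction property. -/
def HasDP (T : Set Formula) (Γ : Formula → Prop) : Prop :=
  ∀ φ ψ : Formula, Γ φ → Γ ψ → Sentence φ → Sentence ψ →
    Provable T (φ.or ψ) → Provable T φ ∨ Provable T ψ

/-- (Γ, Θ)-disjunction property. -/
def HasDP2 (T : Set Formula) (Γ Θ : Formula → Prop) : Prop :=
  ∀ φ ψ : Formula, Γ φ → Θ ψ → Sentence φ → Sentence ψ →
    Provable T (φ.or ψ) → Provable T φ ∨ Provable T ψ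

/-- Γ-existence property. -/
def HasEP (T : Set Formula) (Γ : Formula → Prop) : Prop :=
  ∀ (x : ℕ) (φ : Formula), Γ φ → φ.fv ⊆ {x} →
    Provable T (Formula.ex x φ) → ∃ n : ℕ, Provable T (φ.subst x (Term.numeral n))

/-- Modal disjunction property. -/
def HasMDP (T : Set Formula) : Prop :=
  ∀ φ ψ : Formula, Sentence φ → Sentence ψ →
    Provable T ((Formula.box φ).or (Formula.box ψ)) → Provable T φ ∨ Provable T ψ

/-- Modal existence property. -/
def HasMEP (T : Set Formula) : Prop :=
  ∀ (x : ℕ) (φ : Formula), φ.fv ⊆ {x} →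
    Provable T (Formula.ex x (Formula.box φ)) →
      ∃ n : ℕ, Provable T (φ.subst x (Term.numeral n))

/-- n-fold B-disjunction property. -/
def HasBnDP (T : Set Formula) (n : ℕ) : Prop :=
  ∀ φ : Fin n → Formula, (∀ i, Sentence (φ i)) →
    Provable T (disj (List.ofFn fun i => Formula.box (φ i))) →
    ∃ i, Provable T (Formula.box (φ i))

/-- Σ₁-soundness. -/
def Sigma1Sound (T : Set Formula) : Prop :=
  ∀ φ : Formula, IsSigma1 φ → Sentence φ → Provable T φ → StdTrue φ

/-- L_A-soundness. -/
def LASound (T : Set Formula) : Prop :=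
  ∀ φ : Formula, φ.noBox → Sentence φ → Provable T φ → StdTrue φ

/-- `T` is recursively enumerable (via the Gödel numbering of formulas). -/
def RE (T : Set Formula) : Prop :=
  Nat.Partrec fun n => Part.assert (∃ φ ∈ T, Formula.code φ = n) fun _ => Part.some 0

/-- A fixed natural Σ₁ provability predicate `Pr_T(x)` for the theory `T`:
a Σ₁ L_A-formula with only the free variable `0` which numerates provability in `T`
in the standard model and satisfies the standard derivability conditions
(provably in PA). -/
structure ProvPred (T : Set Formula) where
  pr : Formula
  noBox : pr.noBox
  sigma1 : IsSigma1 pr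
  fvSub : pr.fv ⊆ {0}
  numerates : ∀ φ : Formula,
    StdTrue (pr.subst 0 (Term.numeral φ.code)) ↔ Provable T φ
  d1 : ∀ φ : Formula, Provable T φ → FOProvable PA (pr.subst 0 (Term.numeral φ.code))
  d2 : ∀ φ ψ : Formula,
    FOProvable PA ((pr.subst 0 (Term.numeral (φ.imp ψ).code)).imp
      ((pr.subst 0 (Term.numeral φ.code)).imp (pr.subst 0 (Term.numeral ψ.code))))
  necClosed : ∀ φ : Formula,
    FOProvable PA ((pr.subst 0 (Term.numeral φ.code)).imp
      (pr.subst 0 (Term.numeral (Formula.box φ).code)))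

/-- `Pr_T(⌜φ⌝)`. -/
def ProvPred.app {T : Set Formula} (P : ProvPred T) (φ : Formula) : Formula :=
  P.pr.subst 0 (Term.numeral φ.code)

/-- Γ-disjunctive correctness (Γ-DC). -/
def DC (T : Set Formula) (P : ProvPred T) (Γ : Formula → Prop) : Prop :=
  ∀ φ : Formula, Γ φ → Sentence φ → Provable T (φ.or (P.app φ)) → Provable T φ

/-- The substitution replacing each variable by the numeral of its value. -/
def numeralSubst (v : ℕ → ℕ) : ℕ → Term := fun x => Term.numeral (v x)

/-- Standard-model satisfaction of the ρ_T-translation: `ρ_T` is the identity on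
L_A-formulas, commutes with connectives and quantifiers, and sends `□φ(x⃗)` to
`Pr_T(⌜□φ(ẋ⃗)⌝)`, whose truth in ℕ (for a natural provability predicate) amounts to
provability in `T` of `□φ(n̄⃗)`. -/
def RhoSat (T : Set Formula) : Formula → (ℕ → ℕ) → Prop
  | .falsum, _ => False
  | .eq t u, v => t.val v = u.val v
  | .le t u, v => t.val v ≤ u.val v
  | .and φ ψ, v => RhoSat T φ v ∧ RhoSat T ψ v
  | .or φ ψ, v => RhoSat T φ v ∨ RhoSat T ψ v
  | .imp φ ψ, v => RhoSat T φ v → RhoSat T ψ v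
  | .neg φ, v => ¬ RhoSat T φ v
  | .all x φ, v => ∀ n : ℕ, RhoSat T φ (Function.update v x n)
  | .ex x φ, v => ∃ n : ℕ, RhoSat T φ (Function.update v x n)
  | .box φ, v => Provable T (Formula.box (φ.substAll (numeralSubst v)))

/-- Standard-model satisfaction of the π_T-translation: `π_T` is the identity on
L_A-formulas, commutes with connectives and quantifiers, and sends `□φ(x⃗)` to
`Pr_T(⌜φ(ẋ⃗)⌝)`, whose truth in ℕ (for a natural provability predicate) amounts to
provability in `T` of `φ(n̄⃗)`. -/
def PiSat (T : Set Formula) : Formula → (ℕ → ℕ) → Prop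
  | .falsum, _ => False
  | .eq t u, v => t.val v = u.val v
  | .le t u, v => t.val v ≤ u.val v
  | .and φ ψ, v => PiSat T φ v ∧ PiSat T ψ v
  | .or φ ψ, v => PiSat T φ v ∨ PiSat T ψ v
  | .imp φ ψ, v => PiSat T φ v → PiSat T ψ v
  | .neg φ, v => ¬ PiSat T φ v
  | .all x φ, v => ∀ n : ℕ, PiSat T φ (Function.update v x n)
  | .ex x φ, v => ∃ n : ℕ, PiSat T φ (Function.update v x n)
  | .box φ, v => Provable T (φ.substAll (numeralSubst v))

/-- Weak ΣB-soundness: every provable ΣB sentence is true in ℕ under ρ_T. -/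
def WeaklySigmaBSound (T : Set Formula) : Prop :=
  ∀ φ : Formula, IsSigmaB φ → Sentence φ → Provable T φ → RhoSat T φ fun _ => 0

/-- ΣB-soundness: every provable ΣB sentence is true in ℕ under π_T. -/
def SigmaBSound (T : Set Formula) : Prop :=
  ∀ φ : Formula, IsSigmaB φ → Sentence φ → Provable T φ → PiSat T φ fun _ => 0

end ModalArith

namespace ModalArith

/-! ### Substitution lemmas -/

theorem Term.substAll_congr {t : Term} {v w : ℕ → Term} (h : ∀ y ∈ t.fv, v y = w y) :
    t.substAll v = t.substAll w := by
  induction t with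
  | var x => simpa [Term.substAll, Term.fv] using h
  | zero => rfl
  | succ t ih => simp [Term.substAll, ih h]
  | add t u iht ihu =>
    simp only [Term.fv, Finset.mem_union] at h
    simp [Term.substAll, iht fun y hy => h y (Or.inl hy), ihu fun y hy => h y (Or.inr hy)]
  | mul t u iht ihu =>
    simp only [Term.fv, Finset.mem_union] at h
    simp [Term.substAll, iht fun y hy => h y (Or.inl hy), ihu fun y hy => h y (Or.inr hy)]

theorem Term.substAll_var (t : Term) : t.substAll Term.var = t := by
  induction t with
  | var x => rfl
  | zero => rfl
  | succ t ih => simp [Term.substAll, ih]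
  | add t u iht ihu => simp [Term.substAll, iht, ihu]
  | mul t u iht ihu => simp [Term.substAll, iht, ihu]

theorem Term.substAll_substAll (t : Term) (v w : ℕ → Term) :
    (t.substAll v).substAll w = t.substAll fun y => (v y).substAll w := by
  induction t with
  | var x => rfl
  | zero => rfl
  | succ t ih => simp [Term.substAll, ih]
  | add t u iht ihu => simp [Term.substAll, iht, ihu]
  | mul t u iht ihu => simp [Term.substAll, iht, ihu]

theorem Term.mem_fv_substAll {t : Term} {v : ℕ → Term} {x : ℕ} :
    x ∈ (t.substAll v).fv ↔ ∃ y ∈ t.fv, x ∈ (v y).fv := by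
  induction t with
  | var x => simp [Term.substAll, Term.fv]
  | zero => simp [Term.substAll, Term.fv]
  | succ t ih => simpa [Term.substAll, Term.fv] using ih
  | add t u iht ihu =>
    simp only [Term.substAll, Term.fv, Finset.mem_union, iht, ihu]; grind
  | mul t u iht ihu =>
    simp only [Term.substAll, Term.fv, Finset.mem_union, iht, ihu]; grind

/-- Substitutions that can never cause capture. -/
def Good (v : ℕ → Term) : Prop := ∀ y, (v y).fv ⊆ {y}

theorem Good.update {v : ℕ → Term} (h : Good v) {x : ℕ} {t : Term} (ht : t.fv ⊆ {x}) :
    Good (Function.update v x t) := by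
  intro y
  by_cases e : y = x
  · subst e; simpa using ht
  · simpa [Function.update_of_ne e] using h y

theorem Good.var : Good Term.var := fun y => by simp [Term.fv]

theorem Good.updateVar {v : ℕ → Term} (h : Good v) {x : ℕ} :
    Good (Function.update v x (Term.var x)) := h.update (by simp [Term.fv])

theorem numeral_fv (n : ℕ) : (Term.numeral n).fv = ∅ := by
  induction n with
  | zero => rfl
  | succ n ih => simpa [Term.numeral, Term.fv] using ih

theorem Term.substAll_closed {t : Term} (h : t.fv = ∅) (v : ℕ → Term) : t.substAll v = t := by
  rw [Term.substAll_congr (w := Term.var) (by simp [h]), Term.substAll_var]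

@[simp] theorem numeral_substAll (n : ℕ) (v : ℕ → Term) :
    (Term.numeral n).substAll v = Term.numeral n := Term.substAll_closed (numeral_fv n) v

theorem good_numeralSubst (v : ℕ → ℕ) : Good (numeralSubst v) := fun y => by
  simp [numeralSubst, numeral_fv]

namespace Formula

theorem substAll_congr {φ : Formula} {v w : ℕ → Term} (h : ∀ y ∈ φ.fv, v y = w y) :
    φ.substAll v = φ.substAll w := by
  induction φ generalizing v w with
  | falsum => rfl
  | eq t u =>
    simp only [fv, Finset.mem_union] at h
    simp [substAll, Term.substAll_congr fun y hy => h y (Or.inl hy),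
      Term.substAll_congr fun y hy => h y (Or.inr hy)]
  | le t u =>
    simp only [fv, Finset.mem_union] at h
    simp [substAll, Term.substAll_congr fun y hy => h y (Or.inl hy),
      Term.substAll_congr fun y hy => h y (Or.inr hy)]
  | and φ ψ ih1 ih2 =>
    simp only [fv, Finset.mem_union] at h
    simp [substAll, ih1 fun y hy => h y (Or.inl hy), ih2 fun y hy => h y (Or.inr hy)]
  | or φ ψ ih1 ih2 =>
    simp only [fv, Finset.mem_union] at h
    simp [substAll, ih1 fun y hy => h y (Or.inl hy), ih2 fun y hy => h y (Or.inr hy)]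
  | imp φ ψ ih1 ih2 =>
    simp only [fv, Finset.mem_union] at h
    simp [substAll, ih1 fun y hy => h y (Or.inl hy), ih2 fun y hy => h y (Or.inr hy)]
  | neg φ ih => simp [substAll, ih h]
  | all x φ ih =>
    simp only [substAll, all.injEq, true_and]
    apply ih
    intro y hy
    by_cases e : y = x
    · subst e; simp
    · simp only [Function.update_of_ne e]; exact h y (by simp [fv, e, hy])
  | ex x φ ih =>
    simp only [substAll, ex.injEq, true_and]
    apply ih
    intro y hy
    by_cases e : y = x
    · subst e; simp
    · simp only [Function.update_of_ne e]; exact h y (by simp [fv, e, hy])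
  | box φ ih => simp [substAll, ih h]

theorem substAll_var (φ : Formula) : φ.substAll Term.var = φ := by
  induction φ with
  | all x φ ih => simp [substAll, ih]
  | ex x φ ih => simp [substAll, ih]
  | _ => simp_all [substAll, Term.substAll_var]

theorem substAll_id {φ : Formula} {v : ℕ → Term} (h : ∀ y ∈ φ.fv, v y = Term.var y) :
    φ.substAll v = φ := by rw [substAll_congr h, substAll_var]

theorem substAll_sentence {φ : Formula} (h : φ.fv = ∅) (v : ℕ → Term) : φ.substAll v = φ :=
  substAll_id (by simp [h])

theorem subst_not_mem {φ : Formula} {x : ℕ} {t : Term} (h : x ∉ φ.fv) : φ.subst x t = φ :=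
  substAll_id fun y hy => by
    rw [Function.update_of_ne]; rintro rfl; exact h hy

theorem subst_self (φ : Formula) (x : ℕ) : φ.subst x (Term.var x) = φ := by
  simp [subst, substAll_var]

theorem update_comp {v w : ℕ → Term} (hv : Good v) (x : ℕ) :
    (fun y => (Function.update v x (Term.var x) y).substAll (Function.update w x (Term.var x)))
      = Function.update (fun y => (v y).substAll w) x (Term.var x) := by
  funext y
  by_cases e : y = x
  · subst e; simp [Term.substAll]
  · simp only [Function.update_of_ne e]
    apply Term.substAll_congr
    intro z hz
    have := hv y hz
    rw [Finset.mem_singleton] at this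
    subst this
    simp [Function.update_of_ne e]

theorem substAll_substAll (φ : Formula) {v : ℕ → Term} (hv : Good v) (w : ℕ → Term) :
    (φ.substAll v).substAll w = φ.substAll fun y => (v y).substAll w := by
  induction φ generalizing v w with
  | all x φ ih => simp only [substAll]; rw [ih hv.updateVar, update_comp hv]
  | ex x φ ih => simp only [substAll]; rw [ih hv.updateVar, update_comp hv]
  | _ => simp_all [substAll, Term.substAll_substAll]

theorem fv_substAll_term {t : Term} {v : ℕ → Term} (hv : Good v) {x : ℕ} :
    x ∈ (t.substAll v).fv ↔ x ∈ t.fv ∧ x ∈ (v x).fv := by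
  rw [Term.mem_fv_substAll]
  constructor
  · rintro ⟨y, hy, hx⟩
    have := hv y hx
    rw [Finset.mem_singleton] at this
    subst this; exact ⟨hy, hx⟩
  · rintro ⟨a, b⟩; exact ⟨x, a, b⟩

theorem fv_substAll {φ : Formula} {v : ℕ → Term} (hv : Good v) {x : ℕ} :
    x ∈ (φ.substAll v).fv ↔ x ∈ φ.fv ∧ x ∈ (v x).fv := by
  induction φ generalizing v with
  | falsum => simp [substAll, fv]
  | eq t u => simp only [substAll, fv, Finset.mem_union, fv_substAll_term hv]; tauto
  | le t u => simp only [substAll, fv, Finset.mem_union, fv_substAll_term hv]; tauto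
  | and φ ψ ih1 ih2 => simp only [substAll, fv, Finset.mem_union, ih1 hv, ih2 hv]; tauto
  | or φ ψ ih1 ih2 => simp only [substAll, fv, Finset.mem_union, ih1 hv, ih2 hv]; tauto
  | imp φ ψ ih1 ih2 => simp only [substAll, fv, Finset.mem_union, ih1 hv, ih2 hv]; tauto
  | neg φ ih => exact ih hv
  | box φ ih => exact ih hv
  | all y φ ih =>
    simp only [substAll, fv, Finset.mem_erase, ih hv.updateVar]
    by_cases e : x = y <;> simp [e]
  | ex y φ ih =>
    simp only [substAll, fv, Finset.mem_erase, ih hv.updateVar]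
    by_cases e : x = y <;> simp [e]

theorem freeFor_not_mem {φ : Formula} {x : ℕ} {t : Term} (h : x ∉ φ.fv) : φ.freeFor t x := by
  induction φ with
  | all y φ ih => by_cases e : x = y <;> simp_all [freeFor, fv]
  | ex y φ ih => by_cases e : x = y <;> simp_all [freeFor, fv]
  | _ => simp_all [freeFor, fv]

theorem freeFor_good {φ : Formula} {x : ℕ} {t : Term} (h : t.fv ⊆ {x}) : φ.freeFor t x := by
  induction φ with
  | all y φ ih =>
    by_cases e : x = y
    · simp [freeFor, e]
    · refine Or.inr (Or.inr ⟨fun hy => e ?_, ih⟩)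
      simpa using (Finset.mem_singleton.1 (h hy)).symm
  | ex y φ ih =>
    by_cases e : x = y
    · simp [freeFor, e]
    · refine Or.inr (Or.inr ⟨fun hy => e ?_, ih⟩)
      simpa using (Finset.mem_singleton.1 (h hy)).symm
  | _ => simp_all [freeFor]

/-- Substituting a numeral after a numeral substitution below a binder. -/
theorem subst_update_numeral (φ : Formula) (v : ℕ → ℕ) (x n : ℕ) :
    (φ.substAll (Function.update (numeralSubst v) x (Term.var x))).subst x (Term.numeral n)
      = φ.substAll (numeralSubst (Function.update v x n)) := by
  rw [subst, substAll_substAll _ (good_numeralSubst v).updateVar]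
  congr 1
  funext y
  by_cases e : y = x
  · subst e; simp [Term.substAll, numeralSubst]
  · simp [Function.update_of_ne e, numeralSubst]

end Formula

/-! ### Propositional completeness relative to a theory -/

/-- A propositional model of the theorems of `T`. -/
structure PModel (T : Set Formula) (V : Formula → Prop) : Prop where
  thm : ∀ φ, Provable T φ → V φ
  fls : ¬ V Formula.falsum
  imp : ∀ φ ψ, V (φ.imp ψ) ↔ (V φ → V ψ)
  and : ∀ φ ψ, V (φ.and ψ) ↔ (V φ ∧ V ψ)
  or : ∀ φ ψ, V (φ.or ψ) ↔ (V φ ∨ V ψ)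
  neg : ∀ φ, V φ.neg ↔ ¬ V φ

theorem provable_of_models {T : Set Formula} {φ : Formula}
    (h : ∀ V, PModel T V → V φ) : Provable T φ := by
  by_contra hφ
  let S : Set (Set Formula) := {M | (∀ χ, Provable T χ → χ ∈ M) ∧
    (∀ χ ψ, χ.imp ψ ∈ M → χ ∈ M → ψ ∈ M) ∧ φ ∉ M}
  have h0 : {χ | Provable T χ} ∈ S := ⟨fun _ h => h, fun _ _ a b => Provable.mp a b, hφ⟩
  obtain ⟨M, -, hM⟩ := zorn_subset_nonempty S (by
    intro c hc hchain hne
    refine ⟨⋃₀ c, ⟨?_, ?_, ?_⟩, fun s hs => Set.subset_sUnion_of_mem hs⟩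
    · obtain ⟨s, hs⟩ := hne
      exact fun χ hχ => ⟨s, hs, (hc hs).1 χ hχ⟩
    · rintro χ ψ ⟨s, hs, h1⟩ ⟨s', hs', h2⟩
      rcases hchain.total hs hs' with h | h
      · exact ⟨s', hs', (hc hs').2.1 _ _ (h h1) h2⟩
      · exact ⟨s, hs, (hc hs).2.1 _ _ h1 (h h2)⟩
    · rintro ⟨s, hs, h⟩; exact (hc hs).2.2 h) _ h0
  obtain ⟨⟨mthm, mmp, mφ⟩, mmax⟩ := hM
  have ml : ∀ χ, LogicalAxiom χ → χ ∈ M := fun χ h => mthm χ (Provable.logic h)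
  have mext : ∀ ψ, ψ ∉ M → ψ.imp φ ∈ M := by
    intro ψ hψ
    by_contra hc
    have hS : {χ | ψ.imp χ ∈ M} ∈ S := by
      refine ⟨fun χ hχ => ?_, fun χ χ' h1 h2 => ?_, hc⟩
      · exact mmp _ _ (ml _ (LogicalAxiom.imp1 _ _)) (mthm _ hχ)
      · exact mmp _ _ (mmp _ _ (ml _ (LogicalAxiom.imp2 _ _ _)) h1) h2
    have hsub : M ⊆ {χ | ψ.imp χ ∈ M} := fun χ hχ =>
      mmp _ _ (ml _ (LogicalAxiom.imp1 _ _)) hχ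
    have := mmax hS hsub
    apply hψ
    apply this
    exact mmp _ _ (mmp _ _ (ml _ (LogicalAxiom.imp2 ψ (ψ.imp ψ) ψ))
      (ml _ (LogicalAxiom.imp1 _ _))) (ml _ (LogicalAxiom.imp1 _ _))
  have mneg : ∀ ψ, ψ.neg ∈ M ↔ ψ ∉ M := by
    intro ψ
    constructor
    · intro h1 h2
      exact mφ (mmp _ _ (mmp _ _ (ml _ (LogicalAxiom.negE _ _)) h1) h2)
    · intro h1
      by_contra h2
      have a := mext _ h1
      have b := mext _ h2
      have c : ψ.neg.neg ∈ M → False := fun h =>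
        h1 (mmp _ _ (ml _ (LogicalAxiom.dne _)) h)
      have d := mext _ c
      -- from `ψ → φ` and `¬ψ → φ` infer `φ`
      have nφ : φ.neg ∈ M → False := by
        intro hn
        apply h2
        exact mmp _ _ (mmp _ _ (ml _ (LogicalAxiom.negI ψ φ)) a)
          (mmp _ _ (ml _ (LogicalAxiom.imp1 _ _)) hn)
      have e := mext _ nφ
      have f : φ.neg.neg ∈ M := by
        refine mmp _ _ (mmp _ _ (ml _ (LogicalAxiom.negI φ.neg φ)) e) ?_
        exact mmp _ _ (mmp _ _ (ml _ (LogicalAxiom.imp2 φ.neg (φ.neg.imp φ.neg) φ.neg))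
          (ml _ (LogicalAxiom.imp1 _ _))) (ml _ (LogicalAxiom.imp1 _ _))
      exact mφ (mmp _ _ (ml _ (LogicalAxiom.dne _)) f)
  refine mφ (h (fun χ => χ ∈ M) ⟨mthm, ?_, ?_, ?_, ?_, mneg⟩)
  · intro hf; exact mφ (mmp _ _ (ml _ (LogicalAxiom.falsumE _)) hf)
  · intro χ ψ
    refine ⟨fun a b => mmp _ _ a b, fun a => ?_⟩
    by_cases hχ : χ ∈ M
    · exact mmp _ _ (ml _ (LogicalAxiom.imp1 _ _)) (a hχ)
    · exact mmp _ _ (ml _ (LogicalAxiom.negE _ _)) ((mneg χ).2 hχ)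
  · intro χ ψ
    exact ⟨fun a => ⟨mmp _ _ (ml _ (LogicalAxiom.andE1 _ _)) a,
      mmp _ _ (ml _ (LogicalAxiom.andE2 _ _)) a⟩,
      fun a => mmp _ _ (mmp _ _ (ml _ (LogicalAxiom.andI _ _)) a.1) a.2⟩
  · intro χ ψ
    constructor
    · intro a
      by_contra hc
      push Not at hc
      exact mφ (mmp _ _ (mmp _ _ (mmp _ _ (ml _ (LogicalAxiom.orE χ ψ φ)) (mext _ hc.1))
        (mext _ hc.2)) a)
    · rintro (a | a)
      · exact mmp _ _ (ml _ (LogicalAxiom.orI1 _ _)) a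
      · exact mmp _ _ (ml _ (LogicalAxiom.orI2 _ _)) a

namespace PModel

variable {T : Set Formula} {V : Formula → Prop}

theorem allE (h : PModel T V) {x : ℕ} {φ : Formula} (t : Term) (hf : φ.freeFor t x)
    (ha : V (Formula.all x φ)) : V (φ.subst x t) :=
  (h.imp _ _).1 (h.thm _ (Provable.logic (LogicalAxiom.allE x t φ hf))) ha

theorem exI (h : PModel T V) {x : ℕ} {φ : Formula} (t : Term) (hf : φ.freeFor t x)
    (ha : V (φ.subst x t)) : V (Formula.ex x φ) :=
  (h.imp _ _).1 (h.thm _ (Provable.logic (LogicalAxiom.exI x t φ hf))) ha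

theorem ax (h : PModel T V) {φ : Formula} (ha : LogicalAxiom φ) : V φ :=
  h.thm _ (Provable.logic ha)

theorem iff (h : PModel T V) (φ ψ : Formula) : V (φ.iff ψ) ↔ (V φ ↔ V ψ) := by
  simp only [Formula.iff, h.and, h.imp]; tauto

theorem eqRefl (h : PModel T V) (t : Term) : V (Formula.eq t t) := h.ax (LogicalAxiom.eqRefl t)

theorem eqSymm (h : PModel T V) {t u : Term} (a : V (Formula.eq t u)) : V (Formula.eq u t) :=
  (h.imp _ _).1 (h.ax (LogicalAxiom.eqSymm t u)) a

theorem eqTrans (h : PModel T V) {t u w : Term} (a : V (Formula.eq t u)) (b : V (Formula.eq u w)) :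
    V (Formula.eq t w) :=
  (h.imp _ _).1 ((h.imp _ _).1 (h.ax (LogicalAxiom.eqTrans t u w)) a) b

theorem eqSucc (h : PModel T V) {t u : Term} (a : V (Formula.eq t u)) :
    V (Formula.eq t.succ u.succ) :=
  (h.imp _ _).1 (h.ax (LogicalAxiom.eqSucc t u)) a

theorem eqAdd (h : PModel T V) {t u t' u' : Term} (a : V (Formula.eq t t'))
    (b : V (Formula.eq u u')) : V (Formula.eq (t.add u) (t'.add u')) :=
  (h.imp _ _).1 ((h.imp _ _).1 (h.ax (LogicalAxiom.eqAdd t t' u u')) a) b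

theorem eqMul (h : PModel T V) {t u t' u' : Term} (a : V (Formula.eq t t'))
    (b : V (Formula.eq u u')) : V (Formula.eq (t.mul u) (t'.mul u')) :=
  (h.imp _ _).1 ((h.imp _ _).1 (h.ax (LogicalAxiom.eqMul t t' u u')) a) b

theorem eqLe (h : PModel T V) {t u t' u' : Term} (a : V (Formula.eq t t'))
    (b : V (Formula.eq u u')) (c : V (Formula.le t u)) : V (Formula.le t' u') :=
  (h.imp _ _).1 ((h.imp _ _).1 ((h.imp _ _).1 (h.ax (LogicalAxiom.eqLe t t' u u')) a) b) c

end PModel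

section Rules
variable {T : Set Formula}

theorem Provable.substOf {φ : Formula} (x : ℕ) (t : Term) (h : Provable T φ)
    (hf : φ.freeFor t x) : Provable T (φ.subst x t) :=
  Provable.mp (Provable.logic (LogicalAxiom.allE x t φ hf)) (Provable.gen x h)

theorem Provable.substGood {φ : Formula} (x : ℕ) (t : Term) (h : Provable T φ)
    (hf : t.fv ⊆ {x}) : Provable T (φ.subst x t) := h.substOf x t (Formula.freeFor_good hf)

theorem Provable.impAll {χ φ : Formula} {x : ℕ} (hx : x ∉ χ.fv) (h : Provable T (χ.imp φ)) :
    Provable T (χ.imp (Formula.all x φ)) :=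
  Provable.mp (Provable.logic (LogicalAxiom.allImp x χ φ hx)) (Provable.gen x h)

theorem Provable.exImp {χ φ : Formula} {x : ℕ} (hx : x ∉ χ.fv) (h : Provable T (φ.imp χ)) :
    Provable T ((Formula.ex x φ).imp χ) :=
  Provable.mp (Provable.logic (LogicalAxiom.exE x φ χ hx)) (Provable.gen x h)

end Rules
end ModalArith

namespace ModalArith

/-! ### Basic arithmetic in extensions of PA_□ -/

/-- Quantifier-free formulas. -/
def QF : Formula → Prop
  | .and φ ψ => QF φ ∧ QF ψ
  | .or φ ψ => QF φ ∧ QF ψ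
  | .imp φ ψ => QF φ ∧ QF ψ
  | .neg φ => QF φ
  | .box φ => QF φ
  | .all _ _ => False
  | .ex _ _ => False
  | _ => True

theorem QF.freeFor {φ : Formula} (h : QF φ) (t : Term) (x : ℕ) : φ.freeFor t x := by
  induction φ <;> simp_all [QF, Formula.freeFor]

theorem QF.substAll {φ : Formula} (h : QF φ) (v : ℕ → Term) : QF (φ.substAll v) := by
  induction φ <;> simp_all [QF, Formula.substAll]

theorem QF.substAll_substAll {φ : Formula} (h : QF φ) (v w : ℕ → Term) :
    (φ.substAll v).substAll w = φ.substAll fun y => (v y).substAll w := by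
  induction φ <;> simp_all [QF, Formula.substAll, Term.substAll_substAll]

theorem Provable.inst2 {T : Set Formula} {φ : Formula} (h : Provable T φ) (hq : QF φ)
    (hfv : φ.fv ⊆ {0, 1}) (t u : Term) :
    Provable T (φ.substAll fun y => if y = 0 then t else if y = 1 then u else Term.var y) := by
  obtain ⟨b, hb⟩ := Infinite.exists_notMem_finset (t.fv ∪ {0, 1})
  simp only [Finset.mem_union, Finset.mem_insert, Finset.mem_singleton, not_or] at hb
  obtain ⟨hbt, hb0, hb1⟩ := hb
  have h1 := h.substOf 1 (Term.var b) (hq.freeFor _ _)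
  have h2 := h1.substOf 0 t ((hq.substAll _).freeFor _ _)
  have h3 := h2.substOf b u (((hq.substAll _).substAll _).freeFor _ _)
  simp only [Formula.subst] at h3
  rw [(hq.substAll _).substAll_substAll, hq.substAll_substAll] at h3
  convert h3 using 1
  apply Formula.substAll_congr
  intro y hy
  have := hfv hy
  simp only [Finset.mem_insert, Finset.mem_singleton] at this
  rcases this with rfl | rfl
  · simp only [if_true, Function.update_of_ne (show (0 : ℕ) ≠ 1 by decide), Term.substAll,
      Function.update_self]
    rw [Term.substAll_congr (w := Term.var), Term.substAll_var]
    intro y hy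
    rw [Function.update_of_ne]; rintro rfl; exact hbt hy
  · simp [Term.substAll, Function.update_of_ne hb0]

theorem ball_substAll (x : ℕ) (t : Term) (φ : Formula) (v : ℕ → Term) :
    (Formula.ball x t φ).substAll v = Formula.ball x
      (t.substAll (Function.update v x (Term.var x)))
      (φ.substAll (Function.update v x (Term.var x))) := by
  simp [Formula.ball, Formula.lt, Formula.substAll, Term.substAll]

theorem bex_substAll (x : ℕ) (t : Term) (φ : Formula) (v : ℕ → Term) :
    (Formula.bex x t φ).substAll v = Formula.bex x
      (t.substAll (Function.update v x (Term.var x)))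
      (φ.substAll (Function.update v x (Term.var x))) := by
  simp [Formula.bex, Formula.lt, Formula.substAll, Term.substAll]

section Arith

theorem induct {T : Set Formula} (hT : Extends T PABox) {θ : Formula} (x : ℕ) (h0 : Provable T (θ.subst x Term.zero))
    (h1 : Provable T (θ.imp (θ.subst x (Term.succ (Term.var x))))) : Provable T θ := by
  have h2 := hT (inductionAx x θ) (Or.inr ⟨x, θ, rfl⟩)
  have h3 := Provable.gen x h1
  have h4 : Provable T (Formula.all x θ) := by
    apply provable_of_models
    intro V hV
    have a := hV.thm _ h2
    have b := hV.thm _ h3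
    have c := hV.thm _ h0
    simp only [inductionAx, hV.imp, hV.and] at a
    exact a ⟨c, b⟩
  have := Provable.mp (Provable.logic (LogicalAxiom.allE x (Term.var x) θ
    (Formula.freeFor_good (by simp [Term.fv])))) h4
  rwa [Formula.subst_self] at this

theorem casesRule {T : Set Formula} (hT : Extends T PABox) {θ : Formula} (x : ℕ) (h0 : Provable T (θ.subst x Term.zero))
    (h1 : Provable T (θ.subst x (Term.succ (Term.var x)))) : Provable T θ := by
  refine induct hT x h0 (provable_of_models fun V hV => ?_)
  rw [hV.imp]; exact fun _ => hV.thm _ h1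

theorem base {T : Set Formula} (hT : Extends T PABox) {φ : Formula} (h : φ ∈ baseAxioms) : Provable T φ := hT φ (Or.inl h)

theorem pNe {T : Set Formula} (hT : Extends T PABox) (t : Term) : Provable T (Formula.eq t.succ Term.zero).neg := by
  have := (base hT (φ := succNeZero) (by simp [baseAxioms])).inst2 (by simp [QF, succNeZero])
    (by decide) t t
  simpa [succNeZero, Formula.substAll, Term.substAll] using this

theorem pInj {T : Set Formula} (hT : Extends T PABox) (t u : Term) : Provable T ((Formula.eq t.succ u.succ).imp (Formula.eq t u)) := by
  have := (base hT (φ := succInj) (by simp [baseAxioms])).inst2 (by simp [QF, succInj])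
    (by decide) t u
  simpa [succInj, Formula.substAll, Term.substAll] using this

theorem pAddZ {T : Set Formula} (hT : Extends T PABox) (t : Term) : Provable T (Formula.eq (t.add Term.zero) t) := by
  have := (base hT (φ := addZero) (by simp [baseAxioms])).inst2 (by simp [QF, addZero])
    (by decide) t t
  simpa [addZero, Formula.substAll, Term.substAll] using this

theorem pAddS {T : Set Formula} (hT : Extends T PABox) (t u : Term) : Provable T (Formula.eq (t.add u.succ) (t.add u).succ) := by
  have := (base hT (φ := addSucc) (by simp [baseAxioms])).inst2 (by simp [QF, addSucc])
    (by decide) t u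
  simpa [addSucc, Formula.substAll, Term.substAll] using this

theorem pMulZ {T : Set Formula} (hT : Extends T PABox) (t : Term) : Provable T (Formula.eq (t.mul Term.zero) Term.zero) := by
  have := (base hT (φ := mulZero) (by simp [baseAxioms])).inst2 (by simp [QF, mulZero])
    (by decide) t t
  simpa [mulZero, Formula.substAll, Term.substAll] using this

theorem pMulS {T : Set Formula} (hT : Extends T PABox) (t u : Term) : Provable T (Formula.eq (t.mul u.succ) ((t.mul u).add t)) := by
  have := (base hT (φ := mulSucc) (by simp [baseAxioms])).inst2 (by simp [QF, mulSucc])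
    (by decide) t u
  simpa [mulSucc, Formula.substAll, Term.substAll] using this

theorem pSuccAdd {T : Set Formula} (hT : Extends T PABox) (t u : Term) : Provable T (Formula.eq (t.succ.add u) (t.add u).succ) := by
  have key : Provable T (Formula.eq ((Term.var 0).succ.add (Term.var 1))
      ((Term.var 0).add (Term.var 1)).succ) := by
    apply induct hT 1
    · simp [Formula.subst, Formula.substAll, Term.substAll]
      exact provable_of_models fun V hV => hV.eqTrans (hV.thm _ (pAddZ hT _))
        (hV.eqSymm (hV.eqSucc (hV.thm _ (pAddZ hT _))))
    · simp [Formula.subst, Formula.substAll, Term.substAll]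
      refine provable_of_models fun V hV => ?_
      rw [hV.imp]
      intro ih
      exact hV.eqTrans (hV.thm _ (pAddS hT _ _)) (hV.eqSucc (hV.eqTrans ih
        (hV.eqSymm (hV.thm _ (pAddS hT _ _)))))
  have := key.inst2 (by simp [QF]) (by decide) t u
  simpa [Formula.substAll, Term.substAll] using this

theorem pZeroAdd {T : Set Formula} (hT : Extends T PABox) (t : Term) : Provable T (Formula.eq (Term.zero.add t) t) := by
  have key : Provable T (Formula.eq (Term.zero.add (Term.var 0)) (Term.var 0)) := by
    apply induct hT 0
    · simp [Formula.subst, Formula.substAll, Term.substAll]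
      exact pAddZ hT _
    · simp [Formula.subst, Formula.substAll, Term.substAll]
      refine provable_of_models fun V hV => ?_
      rw [hV.imp]
      intro ih
      exact hV.eqTrans (hV.thm _ (pAddS hT _ _)) (hV.eqSucc ih)
  have := key.inst2 (by simp [QF]) (by decide) t t
  simpa [Formula.substAll, Term.substAll] using this

theorem pLeDef {T : Set Formula} (hT : Extends T PABox) : Provable T leDef := base hT (by simp [baseAxioms])

theorem pNotLtZero {T : Set Formula} (hT : Extends T PABox) (t : Term) : Provable T (Formula.le t.succ Term.zero).neg := by
  have key : Provable T (Formula.le (Term.var 0).succ Term.zero).neg := by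
    have h1 := ((pLeDef hT).substGood 1 Term.zero (by simp [Term.fv])).substGood 0
      (Term.var 0).succ (by simp [Term.fv])
    simp [leDef, Formula.iff, Formula.subst, Formula.substAll, Term.substAll] at h1
    have h2 : Provable T ((Formula.ex 2 (Formula.eq ((Term.var 0).succ.add (Term.var 2))
        Term.zero)).imp Formula.falsum) := by
      apply Provable.exImp (by simp [Formula.fv])
      refine provable_of_models fun V hV => ?_
      rw [hV.imp]
      intro h
      exact absurd (hV.eqTrans (hV.eqSymm (hV.thm _ (pSuccAdd hT _ _))) h)
        ((hV.neg _).1 (hV.thm _ (pNe hT _)))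
    refine provable_of_models fun V hV => ?_
    have a := hV.thm _ h1
    have b := hV.thm _ h2
    simp only [hV.and, hV.imp, hV.neg] at a b ⊢
    exact fun h => hV.fls (b (a.1 h))
  have := key.inst2 (by simp [QF]) (by decide) t t
  simpa [Formula.substAll, Term.substAll] using this

theorem pZeroLe {T : Set Formula} (hT : Extends T PABox) (t : Term) : Provable T (Formula.le Term.zero t) := by
  have key : Provable T (Formula.le Term.zero (Term.var 1)) := by
    have h1 := (pLeDef hT).substGood 0 Term.zero (by simp [Term.fv])
    simp [leDef, Formula.iff, Formula.subst, Formula.substAll, Term.substAll] at h1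
    refine provable_of_models fun V hV => ?_
    have a := hV.thm _ h1
    simp only [hV.and, hV.imp] at a ⊢
    apply a.2
    apply hV.exI (Term.var 1) (by simp [Formula.freeFor])
    simp [Formula.subst, Formula.substAll, Term.substAll]
    exact hV.thm _ (pZeroAdd hT _)
  have := key.inst2 (by simp [QF]) (by decide) t t
  simpa [Formula.substAll, Term.substAll] using this

theorem pSuccLe {T : Set Formula} (hT : Extends T PABox) (t u : Term) :
    Provable T ((Formula.le t.succ u.succ).iff (Formula.le t u)) := by
  have key : Provable T ((Formula.le (Term.var 0).succ (Term.var 1).succ).iff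
      (Formula.le (Term.var 0) (Term.var 1))) := by
    have h0 := pLeDef hT
    have h1 := ((pLeDef hT).substGood 1 (Term.var 1).succ (by simp [Term.fv])).substGood 0
      (Term.var 0).succ (by simp [Term.fv])
    simp [leDef, Formula.iff, Formula.subst, Formula.substAll, Term.substAll] at h1
    have h2 : Provable T ((Formula.ex 2 (Formula.eq ((Term.var 0).succ.add (Term.var 2))
        (Term.var 1).succ)).imp (Formula.ex 2 (Formula.eq ((Term.var 0).add (Term.var 2))
        (Term.var 1)))) := by
      apply Provable.exImp (by simp [Formula.fv])
      refine provable_of_models fun V hV => ?_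
      rw [hV.imp]
      intro h
      apply hV.exI (Term.var 2) (Formula.freeFor_good (by simp [Term.fv]))
      rw [Formula.subst_self]
      exact (hV.imp _ _).1 (hV.thm _ (pInj hT _ _))
        (hV.eqTrans (hV.eqSymm (hV.thm _ (pSuccAdd hT _ _))) h)
    have h3 : Provable T ((Formula.ex 2 (Formula.eq ((Term.var 0).add (Term.var 2))
        (Term.var 1))).imp (Formula.ex 2 (Formula.eq ((Term.var 0).succ.add (Term.var 2))
        (Term.var 1).succ))) := by
      apply Provable.exImp (by simp [Formula.fv])
      refine provable_of_models fun V hV => ?_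
      rw [hV.imp]
      intro h
      apply hV.exI (Term.var 2) (Formula.freeFor_good (by simp [Term.fv]))
      rw [Formula.subst_self]
      exact hV.eqTrans (hV.thm _ (pSuccAdd hT _ _)) (hV.eqSucc h)
    refine provable_of_models fun V hV => ?_
    have a := hV.thm _ h1
    have b := hV.thm _ h0
    have c := hV.thm _ h2
    have d := hV.thm _ h3
    simp only [leDef, hV.and, hV.imp, hV.iff] at a b c d ⊢
    tauto
  have := key.inst2 (by simp [QF, Formula.iff]) (by decide) t u
  simpa [Formula.iff, Formula.substAll, Term.substAll] using this

/-! ### Numerals -/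

theorem numAdd {T : Set Formula} (hT : Extends T PABox) (n m : ℕ) : Provable T (Formula.eq ((Term.numeral n).add (Term.numeral m))
    (Term.numeral (n + m))) := by
  induction m with
  | zero => exact pAddZ hT _
  | succ m ih =>
    exact provable_of_models fun V hV => hV.eqTrans (hV.thm _ (pAddS hT _ _))
      (hV.eqSucc (hV.thm _ ih))

theorem numMul {T : Set Formula} (hT : Extends T PABox) (n m : ℕ) : Provable T (Formula.eq ((Term.numeral n).mul (Term.numeral m))
    (Term.numeral (n * m))) := by
  induction m with
  | zero => exact pMulZ hT _
  | succ m ih =>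
    exact provable_of_models fun V hV => hV.eqTrans (hV.thm _ (pMulS hT _ _))
      (hV.eqTrans (hV.eqAdd (hV.thm _ ih) (hV.eqRefl _)) (hV.thm _ (numAdd hT _ _)))

theorem termEval {T : Set Formula} (hT : Extends T PABox) (t : Term) (v : ℕ → ℕ) :
    Provable T (Formula.eq (t.substAll (numeralSubst v)) (Term.numeral (t.val v))) := by
  induction t with
  | var x => exact Provable.logic (LogicalAxiom.eqRefl _)
  | zero => exact Provable.logic (LogicalAxiom.eqRefl _)
  | succ t ih => exact provable_of_models fun V hV => hV.eqSucc (hV.thm _ ih)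
  | add t u iht ihu =>
    exact provable_of_models fun V hV => hV.eqTrans (hV.eqAdd (hV.thm _ iht) (hV.thm _ ihu))
      (hV.thm _ (numAdd hT _ _))
  | mul t u iht ihu =>
    exact provable_of_models fun V hV => hV.eqTrans (hV.eqMul (hV.thm _ iht) (hV.thm _ ihu))
      (hV.thm _ (numMul hT _ _))

theorem numNe {T : Set Formula} (hT : Extends T PABox) {n m : ℕ} (h : n ≠ m) :
    Provable T (Formula.eq (Term.numeral n) (Term.numeral m)).neg := by
  induction n generalizing m with
  | zero =>
    cases m with
    | zero => exact absurd rfl h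
    | succ m =>
      refine provable_of_models fun V hV => ?_
      have := hV.thm _ (pNe hT (Term.numeral m))
      rw [hV.neg] at this ⊢
      exact fun a => this (hV.eqSymm a)
  | succ n ih =>
    cases m with
    | zero => exact pNe hT _
    | succ m =>
      refine provable_of_models fun V hV => ?_
      have a := hV.thm _ (ih (m := m) (by omega))
      have b := hV.thm _ (pInj hT (Term.numeral n) (Term.numeral m))
      simp only [hV.neg, hV.imp, Term.numeral] at a b ⊢
      exact fun h => a (b h)

theorem numLe {T : Set Formula} (hT : Extends T PABox) (n m : ℕ) :
    (n ≤ m → Provable T (Formula.le (Term.numeral n) (Term.numeral m))) ∧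
    (¬ n ≤ m → Provable T (Formula.le (Term.numeral n) (Term.numeral m)).neg) := by
  induction n generalizing m with
  | zero => exact ⟨fun _ => pZeroLe hT _, fun h => absurd (Nat.zero_le _) h⟩
  | succ n ih =>
    cases m with
    | zero => exact ⟨fun h => by omega, fun _ => pNotLtZero hT _⟩
    | succ m =>
      have b := pSuccLe hT (Term.numeral n) (Term.numeral m)
      constructor
      · intro h
        refine provable_of_models fun V hV => ?_
        have b' := hV.thm _ b
        rw [hV.iff] at b'
        exact b'.2 (hV.thm _ ((ih m).1 (by omega)))
      · intro h
        refine provable_of_models fun V hV => ?_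
        have b' := hV.thm _ b
        have a := hV.thm _ ((ih m).2 (by omega))
        rw [hV.iff] at b'
        rw [hV.neg] at a ⊢
        exact fun h => a (b'.1 h)

/-! ### Bounded quantifiers over numerals -/

theorem subst_succ_numeral (θ : Formula) (x i : ℕ) :
    (θ.subst x (Term.var x).succ).subst x (Term.numeral i)
      = θ.subst x (Term.numeral (i + 1)) := by
  rw [Formula.subst, Formula.subst, Formula.substAll_substAll _
    (Good.var.update (by simp [Term.fv]))]
  apply Formula.substAll_congr
  intro y _
  by_cases e : y = x
  · subst e; simp [Term.substAll, Term.numeral]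
  · simp [Function.update_of_ne e, Term.substAll]

theorem ballRule {T : Set Formula} (hT : Extends T PABox) (x k : ℕ) (θ : Formula)
    (h : ∀ i < k, Provable T (θ.subst x (Term.numeral i))) :
    Provable T ((Formula.lt (Term.var x) (Term.numeral k)).imp θ) := by
  induction k generalizing θ with
  | zero =>
    refine provable_of_models fun V hV => ?_
    have a := hV.thm _ (pNotLtZero hT (Term.var x))
    rw [hV.neg] at a
    rw [hV.imp]
    exact fun h => absurd h a
  | succ k ih =>
    apply casesRule hT x
    · have a := h 0 (by omega)
      refine provable_of_models fun V hV => ?_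
      simp only [Formula.subst, Formula.substAll, hV.imp]
      exact fun _ => hV.thm _ a
    · have a := ih (θ.subst x (Term.var x).succ) (fun i hi => by
        rw [subst_succ_numeral]; exact h _ (by omega))
      have b := pSuccLe hT (Term.var x).succ (Term.numeral k)
      refine provable_of_models fun V hV => ?_
      have a' := hV.thm _ a
      have b' := hV.thm _ b
      simp only [Formula.subst, Formula.substAll, hV.imp, hV.iff, Formula.lt, Term.substAll,
        Function.update_self, numeral_substAll, Term.numeral] at a' b' ⊢
      exact fun h => a' (b'.1 h)

/-! ### Completeness for bounded formulas -/

theorem bound_subst {x : ℕ} {t : Term} (hx : x ∉ t.fv) (v : ℕ → Term) :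
    t.substAll (Function.update v x (Term.var x)) = t.substAll v :=
  Term.substAll_congr fun y hy => by
    rw [Function.update_of_ne]; rintro rfl; exact hx hy

theorem ballComplete {T : Set Formula} (hT : Extends T PABox) {x : ℕ} {t : Term} (hx : x ∉ t.fv) (θ : Formula) (v : ℕ → ℕ)
    (h : ∀ i < t.val v, Provable T (θ.subst x (Term.numeral i))) :
    Provable T ((Formula.lt (Term.var x) (t.substAll
      (Function.update (numeralSubst v) x (Term.var x)))).imp θ) := by
  rw [bound_subst hx]
  have a := ballRule hT x _ θ h
  have b := termEval hT t v
  refine provable_of_models fun V hV => ?_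
  have a' := hV.thm _ a
  have b' := hV.thm _ b
  rw [hV.imp] at a' ⊢
  exact fun h => a' (hV.eqLe (hV.eqRefl _) b' h)

theorem ltInstance {T : Set Formula} (hT : Extends T PABox) {x : ℕ} {t : Term} (hx : x ∉ t.fv) (v : ℕ → ℕ) {i : ℕ} (hi : i < t.val v) :
    Provable T ((Formula.lt (Term.var x) (t.substAll
      (Function.update (numeralSubst v) x (Term.var x)))).subst x (Term.numeral i)) := by
  rw [bound_subst hx]
  have : (t.substAll (numeralSubst v)).substAll (Function.update Term.var x (Term.numeral i))
      = t.substAll (numeralSubst v) := by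
    apply Term.substAll_closed
    ext y
    simp [Term.mem_fv_substAll, numeralSubst, numeral_fv]
  simp only [Formula.lt, Formula.subst, Formula.substAll, Term.substAll, this,
    Function.update_self]
  have a := (numLe hT (i + 1) (t.val v)).1 hi
  have b := termEval hT t v
  exact provable_of_models fun V hV => hV.eqLe (hV.eqRefl _) (hV.eqSymm (hV.thm _ b)) (hV.thm _ a)

theorem ballElim {T : Set Formula} (hT : Extends T PABox) {x : ℕ} {t : Term} (hx : x ∉ t.fv) {φ : Formula} (v : ℕ → ℕ)
    (h : Provable T ((Formula.ball x t φ).substAll (numeralSubst v))) {i : ℕ}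
    (hi : i < t.val v) : Provable T (φ.substAll (numeralSubst (Function.update v x i))) := by
  have a := ltInstance hT hx v hi
  rw [← Formula.subst_update_numeral]
  rw [ball_substAll] at h
  refine provable_of_models fun V hV => ?_
  have b := hV.allE (Term.numeral i) (Formula.freeFor_good (by simp [numeral_fv])) (hV.thm _ h)
  have a' := hV.thm _ a
  simp only [Formula.subst, Formula.substAll, hV.imp, Formula.lt] at b a' ⊢
  exact b a'

theorem term_val_update {x n : ℕ} {t : Term} (hx : x ∉ t.fv) (v : ℕ → ℕ) :
    t.val (Function.update v x n) = t.val v := by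
  induction t with
  | var y =>
    simp only [Term.fv, Finset.mem_singleton] at hx
    simp [Term.val, Function.update_of_ne (Ne.symm hx)]
  | zero => rfl
  | succ t ih => simp_all [Term.val, Term.fv]
  | add t u iht ihu => simp_all [Term.val, Term.fv]
  | mul t u iht ihu => simp_all [Term.val, Term.fv]

theorem delta0Complete {T : Set Formula} (hT : Extends T PABox) {φ : Formula} (h : IsDelta0 φ) (v : ℕ → ℕ) :
    (φ.val v → Provable T (φ.substAll (numeralSubst v))) ∧
    (¬ φ.val v → Provable T (φ.substAll (numeralSubst v)).neg) := by
  induction h generalizing v with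
  | falsum =>
    refine ⟨fun h => h.elim, fun _ => provable_of_models fun V hV => ?_⟩
    simp [Formula.substAll, hV.neg, hV.fls]
  | eq t u =>
    have a := termEval hT t v
    have b := termEval hT u v
    constructor
    · intro h
      simp only [Formula.val] at h
      rw [← h] at b
      exact provable_of_models fun V hV => hV.eqTrans (hV.thm _ a) (hV.eqSymm (hV.thm _ b))
    · intro h
      have c := numNe hT h
      refine provable_of_models fun V hV => ?_
      have c' := hV.thm _ c
      rw [hV.neg] at c' ⊢
      exact fun h => c' (hV.eqTrans (hV.eqSymm (hV.thm _ a)) (hV.eqTrans h (hV.thm _ b)))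
  | le t u =>
    have a := termEval hT t v
    have b := termEval hT u v
    constructor
    · intro h
      have c := (numLe hT _ _).1 h
      exact provable_of_models fun V hV => hV.eqLe (hV.eqSymm (hV.thm _ a))
        (hV.eqSymm (hV.thm _ b)) (hV.thm _ c)
    · intro h
      have c := (numLe hT _ _).2 h
      refine provable_of_models fun V hV => ?_
      have c' := hV.thm _ c
      rw [hV.neg] at c' ⊢
      exact fun h => c' (hV.eqLe (hV.thm _ a) (hV.thm _ b) h)
  | @and φ ψ _ _ ih1 ih2 =>
    have a := ih1 v
    have b := ih2 v
    by_cases h1 : φ.val v <;> by_cases h2 : ψ.val v <;>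
      simp only [Formula.val, h1, h2, true_implies, not_true_eq_false, false_implies, and_true,
        true_and, not_false_eq_true, and_self, false_and, and_false] at a b ⊢ <;>
      refine provable_of_models fun V hV => ?_ <;>
      have a' := hV.thm _ a <;> have b' := hV.thm _ b <;>
      simp only [Formula.substAll, hV.and, hV.neg] at a' b' ⊢ <;> tauto
  | @or φ ψ _ _ ih1 ih2 =>
    have a := ih1 v
    have b := ih2 v
    by_cases h1 : φ.val v <;> by_cases h2 : ψ.val v <;>
      simp only [Formula.val, h1, h2, true_implies, not_true_eq_false, false_implies, and_true,
        true_and, not_false_eq_true, or_self, or_true, true_or, false_or, or_false] at a b ⊢ <;>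
      refine provable_of_models fun V hV => ?_ <;>
      have a' := hV.thm _ a <;> have b' := hV.thm _ b <;>
      simp only [Formula.substAll, hV.or, hV.neg] at a' b' ⊢ <;> tauto
  | @imp φ ψ _ _ ih1 ih2 =>
    have a := ih1 v
    have b := ih2 v
    by_cases h1 : φ.val v <;> by_cases h2 : ψ.val v <;>
      simp only [Formula.val, h1, h2, true_implies, not_true_eq_false, false_implies, and_true,
        true_and, not_false_eq_true, implies_true] at a b ⊢ <;>
      refine provable_of_models fun V hV => ?_ <;>
      have a' := hV.thm _ a <;> have b' := hV.thm _ b <;>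
      simp only [Formula.substAll, hV.imp, hV.neg] at a' b' ⊢ <;> tauto
  | @neg φ _ ih1 =>
    have a := ih1 v
    by_cases h1 : φ.val v <;>
      simp only [Formula.val, h1, true_implies, not_true_eq_false, false_implies, and_true,
        true_and, not_false_eq_true] at a ⊢ <;>
      refine provable_of_models fun V hV => ?_ <;>
      have a' := hV.thm _ a <;>
      simp only [Formula.substAll, hV.neg] at a' ⊢ <;> tauto
  | @ball x t φ hx _ ih =>
    constructor
    · intro h
      simp only [Formula.ball, Formula.lt, Formula.val, Term.val, Function.update_self,
        term_val_update hx, Nat.succ_le_iff] at h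
      rw [ball_substAll]
      exact Provable.gen x (ballComplete hT hx _ v fun i hi => by
        rw [Formula.subst_update_numeral]; exact (ih _).1 (h i hi))
    · intro h
      simp only [Formula.ball, Formula.lt, Formula.val, Term.val, Function.update_self,
        term_val_update hx, Nat.succ_le_iff, not_forall] at h
      obtain ⟨i, hi, h⟩ := h
      have a := (ih _).2 h
      have b := ltInstance hT hx v hi
      rw [← Formula.subst_update_numeral] at a
      refine provable_of_models fun V hV => ?_
      rw [hV.neg, ball_substAll]
      intro hc
      have c := hV.allE (Term.numeral i) (Formula.freeFor_good (by simp [numeral_fv])) hc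
      have a' := hV.thm _ a
      have b' := hV.thm _ b
      simp only [Formula.subst, Formula.substAll, hV.imp, Formula.lt, hV.neg] at a' b' c
      exact a' (c b')
  | @bex x t φ hx _ ih =>
    constructor
    · intro h
      simp only [Formula.bex, Formula.lt, Formula.val, Term.val, Function.update_self,
        term_val_update hx, Nat.succ_le_iff] at h
      obtain ⟨i, hi, h⟩ := h
      have a := (ih _).1 h
      have b := ltInstance hT hx v hi
      rw [← Formula.subst_update_numeral] at a
      refine provable_of_models fun V hV => ?_
      rw [bex_substAll]
      refine hV.exI (Term.numeral i) (Formula.freeFor_good (by simp [numeral_fv])) ?_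
      have a' := hV.thm _ a
      have b' := hV.thm _ b
      simp only [Formula.subst, Formula.substAll, hV.and, Formula.lt] at a' b' ⊢
      exact ⟨b', a'⟩
    · intro h
      simp only [Formula.bex, Formula.lt, Formula.val, Term.val, Function.update_self,
        term_val_update hx, Nat.succ_le_iff, not_exists, not_and] at h
      have a := ballComplete hT hx
        (φ.substAll (Function.update (numeralSubst v) x (Term.var x))).neg v fun i hi => by
          have := (ih _).2 (h i hi)
          rw [← Formula.subst_update_numeral] at this
          exact this
      have b : Provable T (((Formula.bex x t φ).substAll (numeralSubst v)).imp
          Formula.falsum) := by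
        apply Provable.exImp (by simp [Formula.fv])
        refine provable_of_models fun V hV => ?_
        have a' := hV.thm _ a
        simp only [Formula.lt, Formula.substAll, Term.substAll, Function.update_self, hV.imp,
          hV.and, hV.neg] at a' ⊢
        exact fun h => absurd h.2 (a' h.1)
      refine provable_of_models fun V hV => ?_
      have b' := hV.thm _ b
      simp only [hV.imp, hV.neg] at b' ⊢
      exact fun h => hV.fls (b' h)

end Arith

/-- A version of ΣB with Δ₀ formulas in the base. -/
inductive IsSB : Formula → Prop
  | delta0 {φ : Formula} : IsDelta0 φ → IsSB φ
  | b (ψ : Formula) : IsSB (Formula.box ψ)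
  | and {φ ψ : Formula} : IsSB φ → IsSB ψ → IsSB (φ.and ψ)
  | or {φ ψ : Formula} : IsSB φ → IsSB ψ → IsSB (φ.or ψ)
  | ex {x : ℕ} {φ : Formula} : IsSB φ → IsSB (Formula.ex x φ)
  | ball {x : ℕ} {t : Term} {φ : Formula} :
      x ∉ t.fv → IsSB φ → IsSB (Formula.ball x t φ)

theorem IsSB.of_sigma1 {φ : Formula} (h : IsSigma1 φ) : IsSB φ := by
  induction h with
  | delta0 h => exact .delta0 h
  | and _ _ h1 h2 => exact .and h1 h2
  | or _ _ h1 h2 => exact .or h1 h2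
  | ex _ h => exact .ex h
  | ball hx _ h => exact .ball hx h

theorem isSB_iff {φ : Formula} : IsSB φ ↔ IsSigmaB φ := by
  constructor
  · intro h
    induction h with
    | delta0 h => exact .sigma1 (.delta0 h)
    | b ψ => exact .b ψ
    | and _ _ h1 h2 => exact .and h1 h2
    | or _ _ h1 h2 => exact .or h1 h2
    | ex _ h => exact .ex h
    | ball hx _ h => exact .ball hx h
  · intro h
    induction h with
    | sigma1 h => exact .of_sigma1 h
    | b ψ => exact .b ψ
    | and _ _ h1 h2 => exact .and h1 h2
    | or _ _ h1 h2 => exact .or h1 h2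
    | ex _ h => exact .ex h
    | ball hx _ h => exact .ball hx h

theorem term_ball_subst {x : ℕ} {t : Term} (hx : x ∉ t.fv) {v : ℕ → Term} (hv : Good v) :
    x ∉ (t.substAll (Function.update v x (Term.var x))).fv := by
  rw [bound_subst hx, Formula.fv_substAll_term hv]; tauto

theorem IsDelta0.substAll {φ : Formula} (h : IsDelta0 φ) {v : ℕ → Term} (hv : Good v) :
    IsDelta0 (φ.substAll v) := by
  induction h generalizing v with
  | falsum => exact .falsum
  | eq t u => exact .eq _ _
  | le t u => exact .le _ _
  | and _ _ h1 h2 => exact .and (h1 hv) (h2 hv)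
  | or _ _ h1 h2 => exact .or (h1 hv) (h2 hv)
  | imp _ _ h1 h2 => exact .imp (h1 hv) (h2 hv)
  | neg _ h1 => exact .neg (h1 hv)
  | @ball x t φ hx _ h =>
    have := IsDelta0.ball (term_ball_subst hx hv) (h (hv.updateVar (x := x)))
    simpa [Formula.ball, Formula.substAll, Formula.lt, Term.substAll] using this
  | @bex x t φ hx _ h =>
    have := IsDelta0.bex (term_ball_subst hx hv) (h (hv.updateVar (x := x)))
    simpa [Formula.bex, Formula.substAll, Formula.lt, Term.substAll] using this

theorem IsSB.substAll {φ : Formula} (h : IsSB φ) {v : ℕ → Term} (hv : Good v) :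
    IsSB (φ.substAll v) := by
  induction h generalizing v with
  | delta0 h => exact .delta0 (h.substAll hv)
  | b ψ => exact .b _
  | and _ _ h1 h2 => exact .and (h1 hv) (h2 hv)
  | or _ _ h1 h2 => exact .or (h1 hv) (h2 hv)
  | ex _ h => exact .ex (h hv.updateVar)
  | @ball x t φ hx _ h =>
    have := IsSB.ball (term_ball_subst hx hv) (h (hv.updateVar (x := x)))
    simpa [Formula.ball, Formula.substAll, Formula.lt, Term.substAll] using this

theorem rhoSat_delta0 {T : Set Formula} {φ : Formula} (h : IsDelta0 φ) (v : ℕ → ℕ) :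
    RhoSat T φ v ↔ φ.val v := by
  induction h generalizing v <;>
    simp_all [RhoSat, Formula.val, Formula.ball, Formula.bex, Formula.lt]

theorem sbComplete {T : Set Formula} (hT : Extends T PABox) {φ : Formula} (h : IsSB φ)
    (v : ℕ → ℕ) (hs : RhoSat T φ v) : Provable T (φ.substAll (numeralSubst v)) := by
  induction h generalizing v with
  | delta0 h => exact (delta0Complete hT h v).1 ((rhoSat_delta0 h v).1 hs)
  | b ψ => exact hs
  | and _ _ h1 h2 =>
    exact provable_of_models fun V hV =>
      (hV.and _ _).2 ⟨hV.thm _ (h1 v hs.1), hV.thm _ (h2 v hs.2)⟩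
  | or _ _ h1 h2 =>
    rcases hs with hs | hs
    · exact provable_of_models fun V hV => (hV.or _ _).2 (Or.inl (hV.thm _ (h1 v hs)))
    · exact provable_of_models fun V hV => (hV.or _ _).2 (Or.inr (hV.thm _ (h2 v hs)))
  | @ex x φ _ ih =>
    obtain ⟨i, hi⟩ := hs
    have a := ih _ hi
    rw [← Formula.subst_update_numeral] at a
    exact provable_of_models fun V hV => hV.exI (Term.numeral i)
      (Formula.freeFor_good (by simp [numeral_fv])) (hV.thm _ a)
  | @ball x t φ hx _ ih =>
    simp only [Formula.ball, Formula.lt, RhoSat, Term.val, Function.update_self,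
        term_val_update hx, Nat.succ_le_iff] at hs
    rw [ball_substAll]
    exact Provable.gen x (ballComplete hT hx _ v fun i hi => by
        rw [Formula.subst_update_numeral]; exact ih _ (hs i hi))

/-- Part (2). -/
theorem part2 {T : Set Formula} (hT : Extends T PABox) (hs : WeaklySigmaBSound T) :
    HasEP T IsSigmaB := by
  intro x φ hφ hfv hp
  have hsent : Sentence (Formula.ex x φ) := by
    simp only [Sentence, Formula.fv]
    ext y
    simp only [Finset.mem_erase, Finset.notMem_empty, iff_false, not_and]
    intro h1 h2
    exact h1 (Finset.mem_singleton.1 (hfv h2))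
  obtain ⟨n, hn⟩ := hs _ (.ex hφ) hsent hp
  refine ⟨n, ?_⟩
  have := sbComplete hT (isSB_iff.2 hφ) _ hn
  convert this using 1
  apply Formula.substAll_congr
  intro y hy
  have := Finset.mem_singleton.1 (hfv hy)
  subst this
  simp [numeralSubst]

end ModalArith

namespace ModalArith

/-! ### Definability by Sigma_1 formulas in the standard model -/

theorem Term.val_congr {t : Term} {v w : ℕ → ℕ} (h : ∀ y ∈ t.fv, v y = w y) :
    t.val v = t.val w := by
  induction t with
  | var x => exact h x (by simp [Term.fv])
  | zero => rfl
  | succ t ih => simp only [Term.val]; rw [ih h]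
  | add t u ih1 ih2 =>
    simp only [Term.fv, Finset.mem_union] at h
    simp only [Term.val]; rw [ih1 fun y hy => h y (Or.inl hy), ih2 fun y hy => h y (Or.inr hy)]
  | mul t u ih1 ih2 =>
    simp only [Term.fv, Finset.mem_union] at h
    simp only [Term.val]; rw [ih1 fun y hy => h y (Or.inl hy), ih2 fun y hy => h y (Or.inr hy)]

theorem Formula.val_congr {φ : Formula} {v w : ℕ → ℕ} (h : ∀ y ∈ φ.fv, v y = w y) :
    φ.val v ↔ φ.val w := by
  induction φ generalizing v w with
  | falsum => rfl
  | eq t u =>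
    simp only [Formula.fv, Finset.mem_union] at h
    simp only [Formula.val]
    rw [Term.val_congr fun y hy => h y (Or.inl hy), Term.val_congr fun y hy => h y (Or.inr hy)]
  | le t u =>
    simp only [Formula.fv, Finset.mem_union] at h
    simp only [Formula.val]
    rw [Term.val_congr fun y hy => h y (Or.inl hy), Term.val_congr fun y hy => h y (Or.inr hy)]
  | and φ ψ ih1 ih2 =>
    simp only [Formula.fv, Finset.mem_union] at h
    simp only [Formula.val]; rw [ih1 fun y hy => h y (Or.inl hy), ih2 fun y hy => h y (Or.inr hy)]
  | or φ ψ ih1 ih2 =>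
    simp only [Formula.fv, Finset.mem_union] at h
    simp only [Formula.val]; rw [ih1 fun y hy => h y (Or.inl hy), ih2 fun y hy => h y (Or.inr hy)]
  | imp φ ψ ih1 ih2 =>
    simp only [Formula.fv, Finset.mem_union] at h
    simp only [Formula.val]; rw [ih1 fun y hy => h y (Or.inl hy), ih2 fun y hy => h y (Or.inr hy)]
  | neg φ ih => simp only [Formula.val]; rw [ih h]
  | box φ ih => rfl
  | all x φ ih =>
    simp only [Formula.val]
    refine forall_congr' fun n => ih fun y hy => ?_
    by_cases e : y = x
    · subst e; simp
    · simp [e, h y (by simp [Formula.fv, e, hy])]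
  | ex x φ ih =>
    simp only [Formula.val]
    refine exists_congr fun n => ih fun y hy => ?_
    by_cases e : y = x
    · subst e; simp
    · simp [e, h y (by simp [Formula.fv, e, hy])]

theorem Term.val_rename (t : Term) (e v : ℕ → ℕ) :
    (t.substAll fun i => Term.var (e i)).val v = t.val (v ∘ e) := by
  induction t with
  | var x => rfl
  | zero => rfl
  | succ t ih => simp [Term.substAll, Term.val, ih]
  | add t u ih1 ih2 => simp [Term.substAll, Term.val, ih1, ih2]
  | mul t u ih1 ih2 => simp [Term.substAll, Term.val, ih1, ih2]

/-- `P` is Sigma_1 definable, as a predicate of a stream of natural numbers. -/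
def Sg (P : (ℕ → ℕ) → Prop) : Prop :=
  ∃ N : ℕ, ∀ e : ℕ → ℕ, ∃ φ : Formula, IsSigma1 φ ∧ (∀ x ∈ φ.fv, ∃ i < N, e i = x) ∧
    ∀ v, φ.val v ↔ P (v ∘ e)

theorem Sg.congr {P Q : (ℕ → ℕ) → Prop} (h : Sg P) (e : ∀ v, Q v ↔ P v) : Sg Q := by
  have : Q = P := funext fun v => propext (e v)
  rwa [this]

theorem Sg.rename {P : (ℕ → ℕ) → Prop} (h : Sg P) (r : ℕ → ℕ) : Sg (fun v => P fun i => v (r i)) := by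
  obtain ⟨N, h⟩ := h
  refine ⟨(Finset.range N).sup r + 1, fun e => ?_⟩
  obtain ⟨φ, h1, h2, h3⟩ := h (e ∘ r)
  refine ⟨φ, h1, fun x hx => ?_, fun v => h3 v⟩
  obtain ⟨i, hi, rfl⟩ := h2 x hx
  exact ⟨r i, Nat.lt_succ_of_le (Finset.le_sup (f := r) (Finset.mem_range.2 hi)), rfl⟩

theorem Sg.and {P Q : (ℕ → ℕ) → Prop} (h : Sg P) (h' : Sg Q) : Sg (fun v => P v ∧ Q v) := by
  obtain ⟨N, h⟩ := h
  obtain ⟨M, h'⟩ := h'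
  refine ⟨max N M, fun e => ?_⟩
  obtain ⟨φ, h1, h2, h3⟩ := h e
  obtain ⟨ψ, k1, k2, k3⟩ := h' e
  refine ⟨φ.and ψ, h1.and k1, fun x hx => ?_, fun v => by simp only [Formula.val, h3, k3]⟩
  simp only [Formula.fv, Finset.mem_union] at hx
  rcases hx with hx | hx
  · obtain ⟨i, hi, rfl⟩ := h2 x hx; exact ⟨i, by omega, rfl⟩
  · obtain ⟨i, hi, rfl⟩ := k2 x hx; exact ⟨i, by omega, rfl⟩

theorem Sg.or {P Q : (ℕ → ℕ) → Prop} (h : Sg P) (h' : Sg Q) : Sg (fun v => P v ∨ Q v) := by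
  obtain ⟨N, h⟩ := h
  obtain ⟨M, h'⟩ := h'
  refine ⟨max N M, fun e => ?_⟩
  obtain ⟨φ, h1, h2, h3⟩ := h e
  obtain ⟨ψ, k1, k2, k3⟩ := h' e
  refine ⟨φ.or ψ, h1.or k1, fun x hx => ?_, fun v => by simp only [Formula.val, h3, k3]⟩
  simp only [Formula.fv, Finset.mem_union] at hx
  rcases hx with hx | hx
  · obtain ⟨i, hi, rfl⟩ := h2 x hx; exact ⟨i, by omega, rfl⟩
  · obtain ⟨i, hi, rfl⟩ := k2 x hx; exact ⟨i, by omega, rfl⟩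

/-- Common core of the quantifier cases. -/
theorem Sg.quant {P : ℕ → (ℕ → ℕ) → Prop} (h : Sg (fun v => P (v 0) fun i => v (i + 1))) :
    ∃ N : ℕ, ∀ (e : ℕ → ℕ) (x : ℕ), (∀ i < N, e i ≠ x) → ∃ φ : Formula, IsSigma1 φ ∧
      (∀ y ∈ φ.fv, y = x ∨ ∃ i < N, e i = y) ∧
      ∀ v m, φ.val (Function.update v x m) ↔ P m (v ∘ e) := by
  obtain ⟨N, h⟩ := h
  refine ⟨N, fun e x hx => ?_⟩
  obtain ⟨φ, h1, h2, h3⟩ := h (fun i => Nat.casesOn i x e)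
  refine ⟨φ, h1, fun y hy => ?_, fun v m => ?_⟩
  · obtain ⟨i, hi, rfl⟩ := h2 y hy
    cases i with
    | zero => exact Or.inl rfl
    | succ i => exact Or.inr ⟨i, by omega, rfl⟩
  · obtain ⟨ψ, k1, k2, k3⟩ := h id
    rw [h3]
    have key : ∀ w w' : ℕ → ℕ, (∀ i < N, w i = w' i) →
        (P (w 0) (fun i => w (i + 1)) ↔ P (w' 0) (fun i => w' (i + 1))) := by
      intro w w' hw
      have a := k3 w
      have b := k3 w'
      simp only [Function.comp_id] at a b
      rw [← a, ← b]
      apply Formula.val_congr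
      intro y hy
      obtain ⟨i, hi, rfl⟩ := k2 y hy
      exact hw _ hi
    have := key (Function.update v x m ∘ fun i => Nat.casesOn i x e)
      (fun i => Nat.casesOn i m (v ∘ e)) (by
        intro i hi
        cases i with
        | zero => simp
        | succ i => simp [hx i (by omega)])
    exact this

theorem exists_fresh (e : ℕ → ℕ) (N : ℕ) : ∃ x, ∀ i < N, e i ≠ x := by
  refine ⟨(Finset.range N).sup e + 1, fun i hi => ?_⟩
  have := Finset.le_sup (f := e) (Finset.mem_range.2 hi)
  omega

theorem Sg.ex {P : ℕ → (ℕ → ℕ) → Prop} (h : Sg (fun v => P (v 0) fun i => v (i + 1))) :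
    Sg (fun v => ∃ m, P m v) := by
  obtain ⟨N, h⟩ := h.quant
  refine ⟨N, fun e => ?_⟩
  obtain ⟨x, hx⟩ := exists_fresh e N
  obtain ⟨φ, h1, h2, h3⟩ := h e x hx
  refine ⟨Formula.ex x φ, h1.ex, fun y hy => ?_, fun v => by simp only [Formula.val, h3]⟩
  simp only [Formula.fv, Finset.mem_erase] at hy
  exact (h2 y hy.2).resolve_left hy.1

theorem Sg.ballVar {P : ℕ → (ℕ → ℕ) → Prop} (j : ℕ)
    (h : Sg (fun v => P (v 0) fun i => v (i + 1))) :
    Sg (fun v => ∀ m < v j, P m v) := by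
  obtain ⟨N, h⟩ := h.quant
  refine ⟨max N (j + 1), fun e => ?_⟩
  obtain ⟨x, hx⟩ := exists_fresh e (max N (j + 1))
  obtain ⟨φ, h1, h2, h3⟩ := h e x (fun i hi => hx i (by omega))
  have hj := hx j (by omega)
  refine ⟨Formula.ball x (Term.var (e j)) φ, h1.ball (by simp [Term.fv, hj.symm]),
    fun y hy => ?_, fun v => ?_⟩
  · simp only [Formula.ball, Formula.lt, Formula.fv, Term.fv, Finset.mem_erase,
      Finset.mem_union, Finset.mem_singleton] at hy
    rcases hy with ⟨a, (b | b) | b⟩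
    · exact absurd b a
    · exact ⟨j, by omega, b.symm⟩
    · obtain ⟨i, hi, rfl⟩ := (h2 y b).resolve_left a
      exact ⟨i, by omega, rfl⟩
  · simp [Formula.ball, Formula.lt, Formula.val, Term.val, h3, hj]

theorem Sg.termEq (t u : Term) : Sg (fun v => t.val v = u.val v) := by
  refine ⟨(t.fv ∪ u.fv).sup id + 1, fun e => ⟨Formula.eq (t.substAll fun i => Term.var (e i))
    (u.substAll fun i => Term.var (e i)), .delta0 (.eq _ _), fun x hx => ?_, fun v => ?_⟩⟩
  · simp only [Formula.fv, Finset.mem_union, Term.mem_fv_substAll, Term.fv,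
      Finset.mem_singleton] at hx
    have : ∃ y ∈ t.fv ∪ u.fv, x = e y := by
      rcases hx with ⟨y, hy, rfl⟩ | ⟨y, hy, rfl⟩
      · exact ⟨y, by simp [hy], rfl⟩
      · exact ⟨y, by simp [hy], rfl⟩
    obtain ⟨y, hy, rfl⟩ := this
    exact ⟨y, Nat.lt_succ_of_le (Finset.le_sup (f := id) hy), rfl⟩
  · simp [Formula.val, Term.val_rename]

theorem Sg.termLe (t u : Term) : Sg (fun v => t.val v ≤ u.val v) := by
  refine ⟨(t.fv ∪ u.fv).sup id + 1, fun e => ⟨Formula.le (t.substAll fun i => Term.var (e i))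
    (u.substAll fun i => Term.var (e i)), .delta0 (.le _ _), fun x hx => ?_, fun v => ?_⟩⟩
  · simp only [Formula.fv, Finset.mem_union, Term.mem_fv_substAll, Term.fv,
      Finset.mem_singleton] at hx
    have : ∃ y ∈ t.fv ∪ u.fv, x = e y := by
      rcases hx with ⟨y, hy, rfl⟩ | ⟨y, hy, rfl⟩
      · exact ⟨y, by simp [hy], rfl⟩
      · exact ⟨y, by simp [hy], rfl⟩
    obtain ⟨y, hy, rfl⟩ := this
    exact ⟨y, Nat.lt_succ_of_le (Finset.le_sup (f := id) hy), rfl⟩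
  · simp [Formula.val, Term.val_rename]

/-- `f` has a Sigma_1 definable graph. -/
def SgF (f : (ℕ → ℕ) → ℕ) : Prop := Sg (fun v => v 0 = f fun i => v (i + 1))

theorem SgF.ofTerm (t : Term) : SgF (fun v => t.val v) := by
  refine (Sg.termEq (Term.var 0) (t.substAll fun i => Term.var (i + 1))).congr fun v => ?_
  rw [Term.val_rename]; rfl

theorem SgF.var (i : ℕ) : SgF (fun v => v i) := SgF.ofTerm (Term.var i)

theorem numeral_val (n : ℕ) (v : ℕ → ℕ) : (Term.numeral n).val v = n := by
  induction n with
  | zero => rfl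
  | succ n ih => simp [Term.numeral, Term.val, ih]

theorem SgF.const (n : ℕ) : SgF (fun _ => n) := by
  have := SgF.ofTerm (Term.numeral n)
  simpa only [numeral_val] using this

theorem Sg.app1 {R : ℕ → Prop} (hR : Sg (fun v => R (v 0))) {f : (ℕ → ℕ) → ℕ} (hf : SgF f) :
    Sg (fun v => R (f v)) := by
  refine (Sg.ex (P := fun m v => m = f v ∧ R m) (Sg.and hf hR)).congr fun v => ?_
  simp

theorem Sg.app2 {R : ℕ → ℕ → Prop} (hR : Sg (fun v => R (v 0) (v 1))) {f g : (ℕ → ℕ) → ℕ}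
    (hf : SgF f) (hg : SgF g) : Sg (fun v => R (f v) (g v)) := by
  refine (Sg.ex (P := fun m v => m = f v ∧ R m (g v)) (Sg.and hf
    (Sg.ex (P := fun k v => k = g (fun i => v (i + 1)) ∧ R (v 0) k) (Sg.and
      (Sg.rename hg fun i => Nat.casesOn i 0 fun j => j + 2) (hR.rename fun i =>
        Nat.casesOn i 1 fun _ => 0)) |>.congr fun v => ?_))).congr fun v => ?_
  all_goals simp

theorem Sg.app3 {R : ℕ → ℕ → ℕ → Prop} (hR : Sg (fun v => R (v 0) (v 1) (v 2)))
    {f g h : (ℕ → ℕ) → ℕ}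
    (hf : SgF f) (hg : SgF g) (hh : SgF h) : Sg (fun v => R (f v) (g v) (h v)) := by
  refine (Sg.ex (P := fun m v => m = f v ∧ R m (g v) (h v)) (Sg.and hf
    (Sg.ex (P := fun k v => k = g (fun i => v (i + 1)) ∧ R (v 0) k (h (fun i => v (i + 1))))
      (Sg.and (Sg.rename hg fun i => Nat.casesOn i 0 fun j => j + 2)
      (Sg.ex (P := fun k v => k = h (fun i => v (i + 2)) ∧ R (v 1) (v 0) k) (Sg.and
      (Sg.rename hh fun i => Nat.casesOn i 0 fun j => j + 3) (hR.rename fun i =>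
        Nat.casesOn i 2 fun j => Nat.casesOn j 1 fun _ => 0)) |>.congr fun v => ?_))
        |>.congr fun v => ?_))).congr fun v => ?_
  all_goals simp

theorem SgF.tail {f : (ℕ → ℕ) → ℕ} (hf : SgF f) : SgF (fun v => f fun i => v (i + 1)) := by
  have := Sg.rename hf (fun i => Nat.casesOn i 0 fun j => j + 2)
  exact this

theorem SgF.app1 {F : ℕ → ℕ} (hF : SgF (fun v => F (v 0))) {f : (ℕ → ℕ) → ℕ}
    (hf : SgF f) : SgF (fun v => F (f v)) := by
  have := Sg.app2 (R := fun a b => a = F b) (f := fun v => v 0)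
    (g := fun v => f fun i => v (i + 1)) hF (SgF.var 0)
    hf.tail
  exact this

theorem SgF.app2 {F : ℕ → ℕ → ℕ} (hF : SgF (fun v => F (v 0) (v 1))) {f g : (ℕ → ℕ) → ℕ}
    (hf : SgF f) (hg : SgF g) : SgF (fun v => F (f v) (g v)) := by
  have := Sg.app3 (R := fun a b c => a = F b c) (f := fun v => v 0)
    (g := fun v => f fun i => v (i + 1)) (h := fun v => g fun i => v (i + 1)) hF (SgF.var 0)
    hf.tail
    hg.tail
  exact this

theorem SgF.add {f g : (ℕ → ℕ) → ℕ} (hf : SgF f) (hg : SgF g) : SgF (fun v => f v + g v) :=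
  SgF.app2 (F := fun a b => a + b) (SgF.ofTerm ((Term.var 0).add (Term.var 1))) hf hg

theorem SgF.mul {f g : (ℕ → ℕ) → ℕ} (hf : SgF f) (hg : SgF g) : SgF (fun v => f v * g v) :=
  SgF.app2 (F := fun a b => a * b) (SgF.ofTerm ((Term.var 0).mul (Term.var 1))) hf hg

theorem Sg.eq {f g : (ℕ → ℕ) → ℕ} (hf : SgF f) (hg : SgF g) : Sg (fun v => f v = g v) :=
  Sg.app2 (R := fun a b => a = b) (Sg.termEq (Term.var 0) (Term.var 1)) hf hg

theorem Sg.le {f g : (ℕ → ℕ) → ℕ} (hf : SgF f) (hg : SgF g) : Sg (fun v => f v ≤ g v) :=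
  Sg.app2 (R := fun a b => a ≤ b) (Sg.termLe (Term.var 0) (Term.var 1)) hf hg

theorem Sg.lt {f g : (ℕ → ℕ) → ℕ} (hf : SgF f) (hg : SgF g) : Sg (fun v => f v < g v) :=
  Sg.app2 (R := fun a b => a < b) (Sg.termLe (Term.var 0).succ (Term.var 1)) hf hg

theorem Sg.ne {f g : (ℕ → ℕ) → ℕ} (hf : SgF f) (hg : SgF g) : Sg (fun v => f v ≠ g v) :=
  ((Sg.lt hf hg).or (Sg.lt hg hf)).congr fun _ => by omega

theorem Sg.ball {P : ℕ → (ℕ → ℕ) → Prop} {f : (ℕ → ℕ) → ℕ}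
    (hf : SgF f) (h : Sg (fun v => P (v 0) fun i => v (i + 1))) :
    Sg (fun v => ∀ m < f v, P m v) := by
  refine (Sg.ex (P := fun b v => b = f v ∧ ∀ m < b, P m v) (Sg.and hf
    (Sg.ballVar (P := fun m v => P m fun i => v (i + 1)) 0
      (h.rename fun i => Nat.casesOn i 0 fun j => j + 2)))).congr fun v => ?_
  simp

theorem Sg.true : Sg (fun _ => True) := (Sg.termEq Term.zero Term.zero).congr fun _ => by simp

theorem SgF.pair {f g : (ℕ → ℕ) → ℕ} (hf : SgF f) (hg : SgF g) :
    SgF (fun v => Nat.pair (f v) (g v)) := by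
  refine SgF.app2 (F := Nat.pair) ?_ hf hg
  have a : ∀ i, SgF (fun v => v i) := SgF.var
  refine (((Sg.lt (a 1) (a 2)).and (Sg.eq (a 0) (((a 2).mul (a 2)).add (a 1)))).or
    ((Sg.le (a 2) (a 1)).and (Sg.eq (a 0) ((((a 1).mul (a 1)).add (a 1)).add (a 2))))).congr
    fun v => ?_
  simp only [Nat.pair]
  split_ifs with h
  · simp [h]; try omega
  · simp at h; simp [h]; try omega

theorem SgF.fst {f : (ℕ → ℕ) → ℕ} (hf : SgF f) : SgF (fun v => (f v).unpair.1) := by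
  refine SgF.app1 (F := fun n => n.unpair.1) ?_ hf
  refine (Sg.ex (P := fun b v => Nat.pair (v 0) b = v 1)
    (Sg.eq (SgF.pair (SgF.var 1) (SgF.var 0)) (SgF.var 2))).congr fun v => ?_
  constructor
  · intro h; exact ⟨(v 1).unpair.2, by simp only at h; rw [h, Nat.pair_unpair]⟩
  · rintro ⟨b, h⟩; simp only; rw [← h, Nat.unpair_pair]

theorem SgF.snd {f : (ℕ → ℕ) → ℕ} (hf : SgF f) : SgF (fun v => (f v).unpair.2) := by
  refine SgF.app1 (F := fun n => n.unpair.2) ?_ hf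
  refine (Sg.ex (P := fun b v => Nat.pair b (v 0) = v 1)
    (Sg.eq (SgF.pair (SgF.var 0) (SgF.var 1)) (SgF.var 2))).congr fun v => ?_
  constructor
  · intro h; exact ⟨(v 1).unpair.1, by simp only at h; rw [h, Nat.pair_unpair]⟩
  · rintro ⟨b, h⟩; simp only; rw [← h, Nat.unpair_pair]

theorem SgF.modSucc {f g : (ℕ → ℕ) → ℕ} (hf : SgF f) (hg : SgF g) :
    SgF (fun v => f v % (g v + 1)) := by
  refine SgF.app2 (F := fun a b => a % (b + 1)) ?_ hf hg
  have a : ∀ i, SgF (fun v => v i) := SgF.var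
  refine (Sg.ex (P := fun q v => v 1 = (v 2 + 1) * q + v 0 ∧ v 0 < v 2 + 1)
    ((Sg.eq (a 2) ((((a 3).add (SgF.const 1)).mul (a 0)).add (a 1))).and
      (Sg.lt (a 1) ((a 3).add (SgF.const 1))))).congr fun v => ?_
  constructor
  · intro h; simp only at h
    refine ⟨v 1 / (v 2 + 1), ?_, ?_⟩
    · rw [h, Nat.div_add_mod]
    · rw [h]; exact Nat.mod_lt _ (by omega)
  · rintro ⟨q, h1, h2⟩; simp only
    rw [h1, Nat.mul_add_mod, Nat.mod_eq_of_lt h2]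

theorem SgF.beta {f g : (ℕ → ℕ) → ℕ} (hf : SgF f) (hg : SgF g) :
    SgF (fun v => Nat.beta (f v) (g v)) :=
  SgF.modSucc hf.fst ((hg.add (SgF.const 1)).mul hf.snd)

theorem exists_beta (s : ℕ → ℕ) (n : ℕ) : ∃ c, ∀ i < n, Nat.beta c i = s i := by
  refine ⟨Nat.unbeta ((List.range n).map s), fun i hi => ?_⟩
  have := Nat.beta_unbeta_coe ((List.range n).map s) ⟨i, by simpa using hi⟩
  simpa using this

theorem partrec_sg {f : ℕ →. ℕ} (hf : Nat.Partrec f) : Sg (fun v => v 0 ∈ f (v 1)) := by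
  have a : ∀ i, SgF (fun v => v i) := SgF.var
  induction hf with
  | zero => exact (Sg.eq (a 0) (SgF.const 0)).congr fun v => by simp [pure, PFun.pure]
  | succ => exact (Sg.eq (a 0) ((a 1).add (SgF.const 1))).congr fun v => by simp
  | left => exact (Sg.eq (a 0) (a 1).fst).congr fun v => by simp
  | right => exact (Sg.eq (a 0) (a 1).snd).congr fun v => by simp
  | @pair f g _ _ h1 h2 =>
    refine (Sg.ex (P := fun x v => ∃ y, x ∈ f (v 1) ∧ y ∈ g (v 1) ∧ v 0 = Nat.pair x y)
      (Sg.ex ?_)).congr fun v => ?_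
    · exact (Sg.app2 (R := fun x y => x ∈ f y) h1 (a 1) (a 3)).and
        ((Sg.app2 (R := fun x y => x ∈ g y) h2 (a 0) (a 3)).and
          (Sg.eq (a 2) ((a 1).pair (a 0))))
    · simp [Seq.seq, eq_comm]
  | @comp f g _ _ h1 h2 =>
    refine (Sg.ex (P := fun x v => x ∈ g (v 1) ∧ v 0 ∈ f x)
      ((Sg.app2 (R := fun x y => x ∈ g y) h2 (a 0) (a 2)).and
        (Sg.app2 (R := fun x y => x ∈ f y) h1 (a 1) (a 0)))).congr fun v => ?_
    exact Part.mem_bind_iff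
  | @prec f g _ _ h1 h2 =>
    refine (Sg.ex (P := fun s v => Nat.beta s 0 ∈ f (v 1).unpair.1 ∧
      v 0 = Nat.beta s (v 1).unpair.2 ∧ ∀ y < (v 1).unpair.2, Nat.beta s (y + 1) ∈
        g (Nat.pair (v 1).unpair.1 (Nat.pair y (Nat.beta s y)))) ?_).congr fun v => ?_
    · refine (Sg.app2 (R := fun x y => x ∈ f y) h1 ((a 0).beta (SgF.const 0)) (a 2).fst).and
        ((Sg.eq (a 1) ((a 0).beta (a 2).snd)).and (Sg.ball (a 2).snd ?_))
      exact Sg.app2 (R := fun x y => x ∈ g y) h2 ((a 1).beta ((a 0).add (SgF.const 1)))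
        ((a 3).fst.pair ((a 0).pair ((a 1).beta (a 0))))
    · simp only [Nat.unpaired]
      generalize (v 1).unpair.1 = x
      generalize (v 1).unpair.2 = n
      generalize v 0 = m
      constructor
      · intro h
        have : ∃ s : ℕ → ℕ, s 0 ∈ f x ∧ m = s n ∧
            ∀ y < n, s (y + 1) ∈ g (Nat.pair x (Nat.pair y (s y))) := by
          induction n generalizing m with
          | zero => exact ⟨fun _ => m, h, rfl, by simp⟩
          | succ n ih =>
            simp only [Part.bind_eq_bind, Part.mem_bind_iff] at h
            obtain ⟨k, hk, h⟩ := h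
            obtain ⟨s, s0, s1, s2⟩ := ih k hk
            refine ⟨Function.update s (n + 1) m, by simpa, by simp, fun y hy => ?_⟩
            rcases Nat.lt_succ_iff_lt_or_eq.1 hy with hy | rfl
            · rw [Function.update_of_ne (by omega), Function.update_of_ne (by omega)]
              exact s2 y hy
            · rw [Function.update_self, Function.update_of_ne (by omega), ← s1]; exact h
        obtain ⟨s, s0, s1, s2⟩ := this
        obtain ⟨c, hc⟩ := exists_beta s (n + 1)
        refine ⟨c, by rw [hc _ (by omega)]; exact s0, by rw [hc _ (by omega)]; exact s1,
          fun y hy => ?_⟩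
        rw [hc _ (by omega), hc _ (by omega)]; exact s2 y hy
      · rintro ⟨c, s0, rfl, s2⟩
        induction n with
        | zero => exact s0
        | succ n ih =>
          simp only [Part.bind_eq_bind, Part.mem_bind_iff]
          exact ⟨_, ih (fun y hy => s2 y (by omega)), s2 n (by omega)⟩
  | @rfind f _ h1 =>
    refine (Sg.and (P := fun v => 0 ∈ f (Nat.pair (v 1) (v 0)))
      (Q := fun v => ∀ k < v 0, ∃ z, z ≠ 0 ∧ z ∈ f (Nat.pair (v 1) k))
      (Sg.app2 (R := fun x y => x ∈ f y) h1 (SgF.const 0) ((a 1).pair (a 0)))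
      (Sg.ball (a 0) (Sg.ex ((Sg.ne (a 0) (SgF.const 0)).and
        (Sg.app2 (R := fun x y => x ∈ f y) h1 (a 0) ((a 3).pair (a 1))))))).congr fun v => ?_
    refine Nat.mem_rfind.trans ?_
    simp only [Part.map_eq_map, Part.mem_map_iff, decide_eq_true_eq, decide_eq_false_iff_not]
    constructor
    · rintro ⟨⟨_, h, rfl⟩, h2⟩
      exact ⟨h, fun k hk => let ⟨z, a, b⟩ := h2 hk; ⟨z, b, a⟩⟩
    · rintro ⟨h, h2⟩
      exact ⟨⟨_, h, rfl⟩, fun {k} hk => let ⟨z, a, b⟩ := h2 k hk; ⟨z, b, a⟩⟩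

end ModalArith

namespace ModalArith

theorem Sg.appTail {P : ℕ → (ℕ → ℕ) → Prop} (h : Sg (fun v => P (v 0) fun i => v (i + 1)))
    {f : (ℕ → ℕ) → ℕ} (hf : SgF f) (r : ℕ → ℕ) : Sg (fun v => P (f v) fun i => v (r i)) := by
  refine (Sg.ex (P := fun m v => m = f v ∧ P m fun i => v (r i)) (Sg.and hf
    (h.rename fun i => Nat.casesOn i 0 fun j => r j + 1))).congr fun v => ?_
  simp

theorem Sg.app4 {R : ℕ → ℕ → ℕ → ℕ → Prop} (hR : Sg (fun v => R (v 0) (v 1) (v 2) (v 3)))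
    {f g h k : (ℕ → ℕ) → ℕ}
    (hf : SgF f) (hg : SgF g) (hh : SgF h) (hk : SgF k) :
    Sg (fun v => R (f v) (g v) (h v) (k v)) := by
  have h1 : Sg (fun v => v 0 = f fun i => v (i + 4)) :=
    Sg.rename hf fun i => Nat.casesOn i 0 fun j => j + 4
  have h2 : Sg (fun v => v 1 = g fun i => v (i + 4)) :=
    Sg.rename hg fun i => Nat.casesOn i 1 fun j => j + 4
  have h3 : Sg (fun v => v 2 = h fun i => v (i + 4)) :=
    Sg.rename hh fun i => Nat.casesOn i 2 fun j => j + 4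
  have h4 : Sg (fun v => v 3 = k fun i => v (i + 4)) :=
    Sg.rename hk fun i => Nat.casesOn i 3 fun j => j + 4
  refine (Sg.ex (P := fun d v => ∃ c b a, (a = f v ∧ b = g v ∧ c = h v ∧ d = k v) ∧ R a b c d)
    (Sg.ex (Sg.ex (Sg.ex ((h1.and (h2.and (h3.and h4))).and hR))))).congr fun v => ?_
  constructor
  · intro h; exact ⟨_, _, _, _, ⟨rfl, rfl, rfl, rfl⟩, h⟩
  · rintro ⟨_, _, _, _, ⟨rfl, rfl, rfl, rfl⟩, h⟩; exact h

/-- Least set containing `A` and closed under the two-premise rules `R`. -/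
inductive Cl (A : ℕ → Prop) (R : ℕ → ℕ → ℕ → Prop) : ℕ → Prop
  | base {c : ℕ} : A c → Cl A R c
  | step {c a b : ℕ} : Cl A R a → Cl A R b → R c a b → Cl A R c

theorem cl_iff (A : ℕ → Prop) (R : ℕ → ℕ → ℕ → Prop) (c : ℕ) :
    Cl A R c ↔ ∃ s n, c = Nat.beta s n ∧ ∀ i < n + 1, A (Nat.beta s i) ∨
      ∃ j k, j < i ∧ k < i ∧ R (Nat.beta s i) (Nat.beta s j) (Nat.beta s k) := by
  constructor
  · intro h
    have : ∃ (s : ℕ → ℕ) (n : ℕ), c = s n ∧ ∀ i < n + 1, A (s i) ∨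
        ∃ j k, j < i ∧ k < i ∧ R (s i) (s j) (s k) := by
      induction h with
      | @base c h => exact ⟨fun _ => c, 0, rfl, fun i _ => Or.inl h⟩
      | @step c a b _ _ h ih1 ih2 =>
        obtain ⟨s, n, rfl, hs⟩ := ih1
        obtain ⟨s', n', rfl, hs'⟩ := ih2
        let u : ℕ → ℕ := fun i => if i ≤ n then s i else if i ≤ n + 1 + n' then s' (i - (n + 1))
          else c
        have u1 : ∀ i, i ≤ n → u i = s i := fun i hi => by simp [u, hi]
        have u2 : ∀ i, i ≤ n' → u (n + 1 + i) = s' i := fun i hi => by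
          have a : ¬ (n + 1 + i ≤ n) := by omega
          have b : n + 1 + i ≤ n + 1 + n' := by omega
          simp [u, a, hi]
        have u3 : u (n + 1 + n' + 1) = c := by
          have a : ¬ (n + 1 + n' + 1 ≤ n) := by omega
          simp [u, a]
        refine ⟨u, n + 1 + n' + 1, u3.symm, fun i hi => ?_⟩
        by_cases h1 : i ≤ n
        · rcases hs i (by omega) with q | ⟨j, k, hj, hk, q⟩
          · left; rwa [u1 i h1]
          · right; refine ⟨j, k, hj, hk, ?_⟩
            rwa [u1 i h1, u1 j (by omega), u1 k (by omega)]
        by_cases h2 : i ≤ n + 1 + n'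
        · obtain ⟨i, rfl⟩ : ∃ i', i = n + 1 + i' := ⟨i - (n + 1), by omega⟩
          rcases hs' i (by omega) with q | ⟨j, k, hj, hk, q⟩
          · left; rwa [u2 i (by omega)]
          · right; refine ⟨n + 1 + j, n + 1 + k, by omega, by omega, ?_⟩
            rwa [u2 i (by omega), u2 j (by omega), u2 k (by omega)]
        · obtain rfl : i = n + 1 + n' + 1 := by omega
          right; refine ⟨n, n + 1 + n', by omega, by omega, ?_⟩
          rwa [u3, u1 n le_rfl, u2 n' le_rfl]
    obtain ⟨s, n, rfl, hs⟩ := this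
    obtain ⟨d, hd⟩ := exists_beta s (n + 1)
    refine ⟨d, n, (hd n (by omega)).symm, fun i hi => ?_⟩
    rcases hs i hi with q | ⟨j, k, hj, hk, q⟩
    · left; rwa [hd i hi]
    · right; refine ⟨j, k, hj, hk, ?_⟩
      rwa [hd i hi, hd j (by omega), hd k (by omega)]
  · rintro ⟨s, n, rfl, h⟩
    have : ∀ i, i < n + 1 → Cl A R (Nat.beta s i) := by
      intro i
      induction i using Nat.strong_induction_on with
      | _ i ih =>
        intro hi
        rcases h i hi with q | ⟨j, k, hj, hk, q⟩
        · exact .base q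
        · exact .step (ih j hj (by omega)) (ih k hk (by omega)) q
    exact this n (by omega)

theorem Sg.cl {A : ℕ → (ℕ → ℕ) → Prop} {R : ℕ → ℕ → ℕ → (ℕ → ℕ) → Prop} {f : (ℕ → ℕ) → ℕ}
    (hA : Sg (fun v => A (v 0) fun i => v (i + 1)))
    (hR : Sg (fun v => R (v 0) (v 1) (v 2) fun i => v (i + 3))) (hf : SgF f) :
    Sg (fun v => Cl (fun c => A c v) (fun c a b => R c a b v) (f v)) := by
  have a : ∀ i, SgF (fun v => v i) := SgF.var
  have key : Sg (fun v => Cl (fun c => A c fun i => v (i + 1))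
      (fun c a b => R c a b fun i => v (i + 1)) (v 0)) := by
    refine Sg.congr ?_ (fun v => cl_iff _ _ _)
    refine Sg.ex (Sg.ex (Sg.and (Sg.eq (a 2) ((a 1).beta (a 0))) (Sg.ball ((a 0).add (SgF.const 1))
      (Sg.or ?_ (Sg.ex (Sg.ex (Sg.and (Sg.lt (a 1) (a 2)) (Sg.and (Sg.lt (a 0) (a 2)) ?_))))))))
    · exact Sg.appTail hA ((a 2).beta (a 0)) fun i => i + 4
    · -- v = k, j, i, n, s, c, ...
      have e1 : Sg (fun v => v 0 = Nat.beta (v 7) (v 5)) := Sg.eq (a 0) ((a 7).beta (a 5))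
      have e2 : Sg (fun v => v 1 = Nat.beta (v 7) (v 4)) := Sg.eq (a 1) ((a 7).beta (a 4))
      have e3 : Sg (fun v => v 2 = Nat.beta (v 7) (v 3)) := Sg.eq (a 2) ((a 7).beta (a 3))
      have e4 : Sg (fun v => R (v 0) (v 1) (v 2) fun i => v (i + 9)) :=
        hR.rename fun i => Nat.casesOn i 0 fun i => Nat.casesOn i 1 fun i =>
          Nat.casesOn i 2 fun i => i + 9
      refine (Sg.ex (P := fun z v => ∃ y x, (x = Nat.beta (v 4) (v 2) ∧ y = Nat.beta (v 4) (v 1) ∧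
        z = Nat.beta (v 4) (v 0)) ∧ R x y z fun i => v (i + 6))
        (Sg.ex (Sg.ex ((e1.and (e2.and e3)).and e4)))).congr fun v => ?_
      constructor
      · intro h; exact ⟨_, _, _, ⟨rfl, rfl, rfl⟩, h⟩
      · rintro ⟨_, _, _, ⟨rfl, rfl, rfl⟩, h⟩; exact h
  exact Sg.appTail (P := fun m v => Cl (fun c => A c v) (fun c a b => R c a b v) m) key hf id

end ModalArith

namespace ModalArith

/-! ### Arithmetization of syntax -/

theorem Term.code_inj {t u : Term} (h : t.code = u.code) : t = u := by
  induction t generalizing u with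
  | var x => cases u <;> simp_all [Term.code, Nat.pair_eq_pair]
  | zero => cases u <;> simp_all [Term.code, Nat.pair_eq_pair]
  | succ t ih =>
    cases u <;> simp only [Term.code, Nat.pair_eq_pair] at h <;> first | omega | skip
    rw [ih h.2]
  | add t t' ih ih' =>
    cases u <;> simp only [Term.code, Nat.pair_eq_pair] at h <;> first | omega | skip
    rw [ih h.2.1, ih' h.2.2]
  | mul t t' ih ih' =>
    cases u <;> simp only [Term.code, Nat.pair_eq_pair] at h <;> first | omega | skip
    rw [ih h.2.1, ih' h.2.2]

theorem Formula.code_inj {φ ψ : Formula} (h : φ.code = ψ.code) : φ = ψ := by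
  induction φ generalizing ψ with
  | falsum => cases ψ <;> simp_all [Formula.code, Nat.pair_eq_pair]
  | eq t u =>
    cases ψ <;> simp only [Formula.code, Nat.pair_eq_pair] at h <;> first | omega | skip
    rw [Term.code_inj h.2.1, Term.code_inj h.2.2]
  | le t u =>
    cases ψ <;> simp only [Formula.code, Nat.pair_eq_pair] at h <;> first | omega | skip
    rw [Term.code_inj h.2.1, Term.code_inj h.2.2]
  | and t t' ih ih' =>
    cases ψ <;> simp only [Formula.code, Nat.pair_eq_pair] at h <;> first | omega | skip
    rw [ih h.2.1, ih' h.2.2]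
  | or t t' ih ih' =>
    cases ψ <;> simp only [Formula.code, Nat.pair_eq_pair] at h <;> first | omega | skip
    rw [ih h.2.1, ih' h.2.2]
  | imp t t' ih ih' =>
    cases ψ <;> simp only [Formula.code, Nat.pair_eq_pair] at h <;> first | omega | skip
    rw [ih h.2.1, ih' h.2.2]
  | neg t ih =>
    cases ψ <;> simp only [Formula.code, Nat.pair_eq_pair] at h <;> first | omega | skip
    rw [ih h.2]
  | all x t ih =>
    cases ψ <;> simp only [Formula.code, Nat.pair_eq_pair] at h <;> first | omega | skip
    rw [h.2.1, ih h.2.2]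
  | ex x t ih =>
    cases ψ <;> simp only [Formula.code, Nat.pair_eq_pair] at h <;> first | omega | skip
    rw [h.2.1, ih h.2.2]
  | box t ih =>
    cases ψ <;> simp only [Formula.code, Nat.pair_eq_pair] at h <;> first | omega | skip
    rw [ih h.2]

open Nat (pair) in
/-- Substitution graph for terms: `c` codes a pair (term, result of substituting `σ` for `x`). -/
def TSub (x σ t r : ℕ) : Prop :=
  Cl (fun c => c = pair (pair 0 x) σ ∨ (∃ y, y ≠ x ∧ c = pair (pair 0 y) (pair 0 y)) ∨
      c = pair (pair 1 0) (pair 1 0))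
    (fun c p q => c = pair (pair 2 p.unpair.1) (pair 2 p.unpair.2) ∨
      c = pair (pair 3 (pair p.unpair.1 q.unpair.1)) (pair 3 (pair p.unpair.2 q.unpair.2)) ∨
      c = pair (pair 4 (pair p.unpair.1 q.unpair.1)) (pair 4 (pair p.unpair.2 q.unpair.2)))
    (pair t r)

theorem tsub_iff (x : ℕ) (s : Term) (a r : ℕ) : TSub x s.code a r ↔
    ∃ t : Term, a = t.code ∧ r = (Term.subst x s t).code := by
  constructor
  · intro h
    have : ∃ t : Term, Nat.pair a r = Nat.pair t.code (Term.subst x s t).code := by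
      unfold TSub at h
      generalize Nat.pair a r = c at h
      induction h with
      | base h =>
        rcases h with rfl | ⟨y, hy, rfl⟩ | rfl
        · exact ⟨.var x, by simp [Term.code, Term.subst, Term.substAll]⟩
        · exact ⟨.var y, by simp [Term.code, Term.subst, Term.substAll, hy]⟩
        · exact ⟨.zero, by simp [Term.code, Term.subst, Term.substAll]⟩
      | step _ _ h ih1 ih2 =>
        obtain ⟨t, rfl⟩ := ih1
        obtain ⟨u, rfl⟩ := ih2
        simp only [Nat.unpair_pair] at h
        rcases h with rfl | rfl | rfl
        · exact ⟨.succ t, by simp [Term.code, Term.subst, Term.substAll]⟩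
        · exact ⟨.add t u, by simp [Term.code, Term.subst, Term.substAll]⟩
        · exact ⟨.mul t u, by simp [Term.code, Term.subst, Term.substAll]⟩
    simpa [Nat.pair_eq_pair] using this
  · rintro ⟨t, rfl, rfl⟩
    unfold TSub
    induction t with
    | var y =>
      by_cases h : y = x
      · subst h; exact .base (Or.inl (by simp [Term.code, Term.subst, Term.substAll]))
      · exact .base (Or.inr (Or.inl ⟨y, h, by simp [Term.code, Term.subst, Term.substAll, h]⟩))
    | zero => exact .base (Or.inr (Or.inr (by simp [Term.code, Term.subst, Term.substAll])))
    | succ t ih =>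
      exact .step ih ih (Or.inl (by simp [Term.code, Term.subst, Term.substAll]))
    | add t u ih1 ih2 =>
      exact .step ih1 ih2 (Or.inr (Or.inl (by simp [Term.code, Term.subst, Term.substAll])))
    | mul t u ih1 ih2 =>
      exact .step ih1 ih2 (Or.inr (Or.inr (by simp [Term.code, Term.subst, Term.substAll])))

theorem Sg.tsub {f g h k : (ℕ → ℕ) → ℕ} (hf : SgF f) (hg : SgF g) (hh : SgF h) (hk : SgF k) :
    Sg (fun v => TSub (f v) (g v) (h v) (k v)) := by
  refine Sg.app4 ?_ hf hg hh hk
  unfold TSub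
  apply Sg.cl
  all_goals repeat' first
    | with_reducible apply Sg.and
    | with_reducible apply Sg.or
    | with_reducible apply Sg.ne
    | with_reducible apply Sg.eq
    | with_reducible apply Sg.ex
    | with_reducible apply SgF.pair
    | with_reducible apply SgF.fst
    | with_reducible apply SgF.snd
    | with_reducible apply SgF.var
    | with_reducible apply SgF.const

/-- Codes of terms. -/
def CTerm (n : ℕ) : Prop := ∃ t : Term, n = t.code

theorem tsub_var (n : ℕ) : TSub 0 (Term.var 0).code n n ↔ CTerm n := by
  rw [tsub_iff]
  simp [Term.subst, Term.substAll_var, CTerm]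

theorem Sg.cterm {f : (ℕ → ℕ) → ℕ} (hf : SgF f) : Sg (fun v => CTerm (f v)) := by
  refine (Sg.tsub (SgF.const 0) (SgF.const (Term.var 0).code) hf hf).congr fun v => ?_
  rw [tsub_var]

/-- Codes of formulas. -/
def CForm (n : ℕ) : Prop := ∃ φ : Formula, n = φ.code

open Nat (pair) in
def CFormCl (n : ℕ) : Prop :=
  Cl (fun c => c = pair 0 0 ∨ ∃ t u, CTerm t ∧ CTerm u ∧
      (c = pair 1 (pair t u) ∨ c = pair 2 (pair t u)))
    (fun c p q => c = pair 3 (pair p q) ∨ c = pair 4 (pair p q) ∨ c = pair 5 (pair p q) ∨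
      c = pair 6 p ∨ (∃ y, c = pair 7 (pair y p)) ∨ (∃ y, c = pair 8 (pair y p)) ∨ c = pair 9 p) n

theorem cform_iff (n : ℕ) : CFormCl n ↔ CForm n := by
  constructor
  · intro h
    unfold CFormCl at h
    induction h with
    | base h =>
      rcases h with rfl | ⟨_, _, ⟨t, rfl⟩, ⟨u, rfl⟩, rfl | rfl⟩
      · exact ⟨.falsum, rfl⟩
      · exact ⟨.eq t u, rfl⟩
      · exact ⟨.le t u, rfl⟩
    | step _ _ h ih1 ih2 =>
      obtain ⟨φ, rfl⟩ := ih1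
      obtain ⟨ψ, rfl⟩ := ih2
      rcases h with rfl | rfl | rfl | rfl | ⟨y, rfl⟩ | ⟨y, rfl⟩ | rfl
      · exact ⟨φ.and ψ, rfl⟩
      · exact ⟨φ.or ψ, rfl⟩
      · exact ⟨φ.imp ψ, rfl⟩
      · exact ⟨φ.neg, rfl⟩
      · exact ⟨.all y φ, rfl⟩
      · exact ⟨.ex y φ, rfl⟩
      · exact ⟨φ.box, rfl⟩
  · rintro ⟨φ, rfl⟩
    unfold CFormCl
    induction φ with
    | falsum => exact .base (Or.inl rfl)
    | eq t u => exact .base (Or.inr ⟨_, _, ⟨t, rfl⟩, ⟨u, rfl⟩, Or.inl rfl⟩)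
    | le t u => exact .base (Or.inr ⟨_, _, ⟨t, rfl⟩, ⟨u, rfl⟩, Or.inr rfl⟩)
    | and φ ψ ih1 ih2 => exact .step ih1 ih2 (by simp [Formula.code])
    | or φ ψ ih1 ih2 => exact .step ih1 ih2 (by simp [Formula.code])
    | imp φ ψ ih1 ih2 => exact .step ih1 ih2 (by simp [Formula.code])
    | neg φ ih => exact .step ih ih (by simp [Formula.code])
    | all x φ ih => exact .step ih ih (by simp [Formula.code])
    | ex x φ ih => exact .step ih ih (by simp [Formula.code])
    | box φ ih => exact .step ih ih (by simp [Formula.code])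

theorem Sg.cform {f : (ℕ → ℕ) → ℕ} (hf : SgF f) : Sg (fun v => CForm (f v)) := by
  refine Sg.app1 (R := CForm) ?_ hf
  simp only [← cform_iff]
  unfold CFormCl
  apply Sg.cl
  all_goals repeat' first
    | with_reducible apply Sg.and
    | with_reducible apply Sg.or
    | with_reducible apply Sg.ne
    | with_reducible apply Sg.cterm
    | with_reducible apply Sg.eq
    | with_reducible apply Sg.ex
    | with_reducible apply SgF.pair
    | with_reducible apply SgF.fst
    | with_reducible apply SgF.snd
    | with_reducible apply SgF.var
    | with_reducible apply SgF.const

open Nat (pair) in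
/-- Substitution graph for formulas. -/
def FSub (x σ a r : ℕ) : Prop :=
  Cl (fun c => c = pair (pair 0 0) (pair 0 0) ∨
      (∃ t t' u u', TSub x σ t t' ∧ TSub x σ u u' ∧
        (c = pair (pair 1 (pair t u)) (pair 1 (pair t' u')) ∨
          c = pair (pair 2 (pair t u)) (pair 2 (pair t' u')))) ∨
      (∃ b, CForm b ∧ (c = pair (pair 7 (pair x b)) (pair 7 (pair x b)) ∨
        c = pair (pair 8 (pair x b)) (pair 8 (pair x b)))))
    (fun c p q =>
      c = pair (pair 3 (pair p.unpair.1 q.unpair.1)) (pair 3 (pair p.unpair.2 q.unpair.2)) ∨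
      c = pair (pair 4 (pair p.unpair.1 q.unpair.1)) (pair 4 (pair p.unpair.2 q.unpair.2)) ∨
      c = pair (pair 5 (pair p.unpair.1 q.unpair.1)) (pair 5 (pair p.unpair.2 q.unpair.2)) ∨
      c = pair (pair 6 p.unpair.1) (pair 6 p.unpair.2) ∨
      (∃ y, y ≠ x ∧ (c = pair (pair 7 (pair y p.unpair.1)) (pair 7 (pair y p.unpair.2)) ∨
        c = pair (pair 8 (pair y p.unpair.1)) (pair 8 (pair y p.unpair.2)))) ∨
      c = pair (pair 9 p.unpair.1) (pair 9 p.unpair.2))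
    (pair a r)

theorem subst_all_self (x : ℕ) (s : Term) (φ : Formula) :
    (Formula.all x φ).subst x s = Formula.all x φ :=
  Formula.subst_not_mem (by simp [Formula.fv])

theorem subst_ex_self (x : ℕ) (s : Term) (φ : Formula) :
    (Formula.ex x φ).subst x s = Formula.ex x φ :=
  Formula.subst_not_mem (by simp [Formula.fv])

theorem update_var_ne {x y : ℕ} (h : y ≠ x) (s : Term) :
    Function.update (Function.update Term.var x s) y (Term.var y) = Function.update Term.var x s := by
  funext z
  by_cases e : z = y
  · subst e; simp [h]
  · simp [e]

theorem subst_all_ne {x y : ℕ} (h : y ≠ x) (s : Term) (φ : Formula) :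
    (Formula.all y φ).subst x s = Formula.all y (φ.subst x s) := by
  simp [Formula.subst, Formula.substAll, update_var_ne h]

theorem subst_ex_ne {x y : ℕ} (h : y ≠ x) (s : Term) (φ : Formula) :
    (Formula.ex y φ).subst x s = Formula.ex y (φ.subst x s) := by
  simp [Formula.subst, Formula.substAll, update_var_ne h]

theorem fsub_iff (x : ℕ) (s : Term) (a r : ℕ) : FSub x s.code a r ↔
    ∃ φ : Formula, a = φ.code ∧ r = (φ.subst x s).code := by
  constructor
  · intro h
    have : ∃ φ : Formula, Nat.pair a r = Nat.pair φ.code (φ.subst x s).code := by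
      unfold FSub at h
      generalize Nat.pair a r = c at h
      induction h with
      | base h =>
        simp only [tsub_iff] at h
        rcases h with rfl | ⟨_, _, _, _, ⟨t, rfl, rfl⟩, ⟨u, rfl, rfl⟩, rfl | rfl⟩ |
          ⟨_, ⟨φ, rfl⟩, rfl | rfl⟩
        · exact ⟨.falsum, rfl⟩
        · exact ⟨.eq t u, rfl⟩
        · exact ⟨.le t u, rfl⟩
        · exact ⟨.all x φ, by rw [subst_all_self]; rfl⟩
        · exact ⟨.ex x φ, by rw [subst_ex_self]; rfl⟩
      | step _ _ h ih1 ih2 =>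
        obtain ⟨φ, rfl⟩ := ih1
        obtain ⟨ψ, rfl⟩ := ih2
        simp only [Nat.unpair_pair] at h
        rcases h with rfl | rfl | rfl | rfl | ⟨y, hy, rfl | rfl⟩ | rfl
        · exact ⟨φ.and ψ, rfl⟩
        · exact ⟨φ.or ψ, rfl⟩
        · exact ⟨φ.imp ψ, rfl⟩
        · exact ⟨φ.neg, rfl⟩
        · exact ⟨.all y φ, by rw [subst_all_ne hy]; rfl⟩
        · exact ⟨.ex y φ, by rw [subst_ex_ne hy]; rfl⟩
        · exact ⟨φ.box, rfl⟩
    simpa [Nat.pair_eq_pair] using this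
  · rintro ⟨φ, rfl, rfl⟩
    unfold FSub
    induction φ with
    | falsum => exact .base (Or.inl rfl)
    | eq t u =>
      exact .base (Or.inr (Or.inl ⟨_, _, _, _, (tsub_iff _ _ _ _).2 ⟨t, rfl, rfl⟩,
        (tsub_iff _ _ _ _).2 ⟨u, rfl, rfl⟩, Or.inl rfl⟩))
    | le t u =>
      exact .base (Or.inr (Or.inl ⟨_, _, _, _, (tsub_iff _ _ _ _).2 ⟨t, rfl, rfl⟩,
        (tsub_iff _ _ _ _).2 ⟨u, rfl, rfl⟩, Or.inr rfl⟩))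
    | and φ ψ ih1 ih2 =>
      exact .step ih1 ih2 (by simp [Formula.code, Formula.subst, Formula.substAll])
    | or φ ψ ih1 ih2 =>
      exact .step ih1 ih2 (by simp [Formula.code, Formula.subst, Formula.substAll])
    | imp φ ψ ih1 ih2 =>
      exact .step ih1 ih2 (by simp [Formula.code, Formula.subst, Formula.substAll])
    | neg φ ih => exact .step ih ih (by simp [Formula.code, Formula.subst, Formula.substAll])
    | box φ ih => exact .step ih ih (by simp [Formula.code, Formula.subst, Formula.substAll])
    | all y φ ih =>
      by_cases h : y = x
      · subst h
        rw [subst_all_self]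
        exact .base (Or.inr (Or.inr ⟨_, ⟨φ, rfl⟩, Or.inl rfl⟩))
      · rw [subst_all_ne h]
        exact .step ih ih (by simp [Formula.code, Nat.pair_eq_pair, h])
    | ex y φ ih =>
      by_cases h : y = x
      · subst h
        rw [subst_ex_self]
        exact .base (Or.inr (Or.inr ⟨_, ⟨φ, rfl⟩, Or.inr rfl⟩))
      · rw [subst_ex_ne h]
        exact .step ih ih (by simp [Formula.code, Nat.pair_eq_pair, h])

theorem Sg.fsub {f g h k : (ℕ → ℕ) → ℕ} (hf : SgF f) (hg : SgF g) (hh : SgF h) (hk : SgF k) :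
    Sg (fun v => FSub (f v) (g v) (h v) (k v)) := by
  refine Sg.app4 ?_ hf hg hh hk
  unfold FSub
  apply Sg.cl
  all_goals repeat' first
    | with_reducible apply Sg.and
    | with_reducible apply Sg.or
    | with_reducible apply Sg.ne
    | with_reducible apply Sg.tsub
    | with_reducible apply Sg.cform
    | with_reducible apply Sg.eq
    | with_reducible apply Sg.ex
    | with_reducible apply SgF.pair
    | with_reducible apply SgF.fst
    | with_reducible apply SgF.snd
    | with_reducible apply SgF.var
    | with_reducible apply SgF.const

theorem not_mem_fv_iff (x : ℕ) (φ : Formula) : FSub x Term.zero.code φ.code φ.code ↔ x ∉ φ.fv := by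
  rw [fsub_iff]
  constructor
  · rintro ⟨ψ, h1, h2⟩ h
    obtain rfl := Formula.code_inj h1
    have h2 := Formula.code_inj h2
    rw [h2, Formula.subst, Formula.fv_substAll (Good.var.update (by simp [Term.fv]))] at h
    simp [Term.fv] at h
  · intro h
    exact ⟨φ, rfl, by rw [Formula.subst_not_mem h]⟩

theorem not_mem_fv_term_iff (x : ℕ) (t : Term) : TSub x Term.zero.code t.code t.code ↔ x ∉ t.fv := by
  rw [tsub_iff]
  constructor
  · rintro ⟨ψ, h1, h2⟩ h
    obtain rfl := Term.code_inj h1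
    have h2 := Term.code_inj h2
    rw [h2, Term.subst, Formula.fv_substAll_term (Good.var.update (by simp [Term.fv]))] at h
    simp [Term.fv] at h
  · intro h
    refine ⟨t, rfl, ?_⟩
    rw [Term.subst, Term.substAll_congr (w := Term.var), Term.substAll_var]
    intro y hy
    rw [Function.update_of_ne]; rintro rfl; exact h hy

open Nat (pair) in
/-- Codes of formulas in which the term coded by `σ` is free for `x`. -/
def FFree (σ x n : ℕ) : Prop :=
  Cl (fun c => c = pair 0 0 ∨ (∃ t u, CTerm t ∧ CTerm u ∧
      (c = pair 1 (pair t u) ∨ c = pair 2 (pair t u))) ∨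
      (∃ b y, CForm b ∧ (x = y ∨ FSub x Term.zero.code b b) ∧
        (c = pair 7 (pair y b) ∨ c = pair 8 (pair y b))))
    (fun c p q => c = pair 3 (pair p q) ∨ c = pair 4 (pair p q) ∨ c = pair 5 (pair p q) ∨
      c = pair 6 p ∨ (∃ y, TSub y Term.zero.code σ σ ∧
        (c = pair 7 (pair y p) ∨ c = pair 8 (pair y p))) ∨ c = pair 9 p) n

theorem ffree_iff (s : Term) (x n : ℕ) : FFree s.code x n ↔
    ∃ φ : Formula, n = φ.code ∧ φ.freeFor s x := by
  constructor
  · intro h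
    unfold FFree at h
    induction h with
    | base h =>
      rcases h with rfl | ⟨_, _, ⟨t, rfl⟩, ⟨u, rfl⟩, rfl | rfl⟩ | ⟨_, y, ⟨φ, rfl⟩, h, h'⟩
      · exact ⟨.falsum, rfl, trivial⟩
      · exact ⟨.eq t u, rfl, trivial⟩
      · exact ⟨.le t u, rfl, trivial⟩
      · rw [not_mem_fv_iff] at h
        rcases h' with rfl | rfl
        · exact ⟨.all y φ, rfl, by simp only [Formula.freeFor]; tauto⟩
        · exact ⟨.ex y φ, rfl, by simp only [Formula.freeFor]; tauto⟩
    | step _ _ h ih1 ih2 =>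
      obtain ⟨φ, rfl, h1⟩ := ih1
      obtain ⟨ψ, rfl, h2⟩ := ih2
      simp only [not_mem_fv_term_iff] at h
      rcases h with rfl | rfl | rfl | rfl | ⟨y, hy, rfl | rfl⟩ | rfl
      · exact ⟨φ.and ψ, rfl, h1, h2⟩
      · exact ⟨φ.or ψ, rfl, h1, h2⟩
      · exact ⟨φ.imp ψ, rfl, h1, h2⟩
      · exact ⟨φ.neg, rfl, h1⟩
      · exact ⟨.all y φ, rfl, Or.inr (Or.inr ⟨hy, h1⟩)⟩
      · exact ⟨.ex y φ, rfl, Or.inr (Or.inr ⟨hy, h1⟩)⟩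
      · exact ⟨φ.box, rfl, h1⟩
  · rintro ⟨φ, rfl, h⟩
    unfold FFree
    induction φ with
    | falsum => exact .base (Or.inl rfl)
    | eq t u => exact .base (Or.inr (Or.inl ⟨_, _, ⟨t, rfl⟩, ⟨u, rfl⟩, Or.inl rfl⟩))
    | le t u => exact .base (Or.inr (Or.inl ⟨_, _, ⟨t, rfl⟩, ⟨u, rfl⟩, Or.inr rfl⟩))
    | and φ ψ ih1 ih2 => exact .step (ih1 h.1) (ih2 h.2) (by simp [Formula.code])
    | or φ ψ ih1 ih2 => exact .step (ih1 h.1) (ih2 h.2) (by simp [Formula.code])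
    | imp φ ψ ih1 ih2 => exact .step (ih1 h.1) (ih2 h.2) (by simp [Formula.code])
    | neg φ ih => exact .step (ih h) (ih h) (by simp [Formula.code])
    | box φ ih => exact .step (ih h) (ih h) (by simp [Formula.code])
    | all y φ ih =>
      rcases h with h | h | ⟨h1, h2⟩
      · exact .base (Or.inr (Or.inr ⟨_, y, ⟨φ, rfl⟩, Or.inl h, Or.inl rfl⟩))
      · exact .base (Or.inr (Or.inr ⟨_, y, ⟨φ, rfl⟩, Or.inr ((not_mem_fv_iff _ _).2 h), Or.inl rfl⟩))
      · refine .step (ih h2) (ih h2) ?_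
        simp only [not_mem_fv_term_iff]
        exact Or.inr (Or.inr (Or.inr (Or.inr (Or.inl ⟨y, h1, Or.inl rfl⟩))))
    | ex y φ ih =>
      rcases h with h | h | ⟨h1, h2⟩
      · exact .base (Or.inr (Or.inr ⟨_, y, ⟨φ, rfl⟩, Or.inl h, Or.inr rfl⟩))
      · exact .base (Or.inr (Or.inr ⟨_, y, ⟨φ, rfl⟩, Or.inr ((not_mem_fv_iff _ _).2 h), Or.inr rfl⟩))
      · refine .step (ih h2) (ih h2) ?_
        simp only [not_mem_fv_term_iff]
        exact Or.inr (Or.inr (Or.inr (Or.inr (Or.inl ⟨y, h1, Or.inr rfl⟩))))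

theorem Sg.ffree {f g h : (ℕ → ℕ) → ℕ} (hf : SgF f) (hg : SgF g) (hh : SgF h) :
    Sg (fun v => FFree (f v) (g v) (h v)) := by
  refine Sg.app3 ?_ hf hg hh
  unfold FFree
  apply Sg.cl
  all_goals repeat' first
    | with_reducible apply Sg.and
    | with_reducible apply Sg.or
    | with_reducible apply Sg.ne
    | with_reducible apply Sg.tsub
    | with_reducible apply Sg.fsub
    | with_reducible apply Sg.cterm
    | with_reducible apply Sg.cform
    | with_reducible apply Sg.eq
    | with_reducible apply Sg.ex
    | with_reducible apply SgF.pair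
    | with_reducible apply SgF.fst
    | with_reducible apply SgF.snd
    | with_reducible apply SgF.var
    | with_reducible apply SgF.const

open Nat (pair) in
/-- Graph of the code of the numeral. -/
def CNum (n c : ℕ) : Prop :=
  Cl (fun d => d = pair 0 (pair 1 0))
    (fun d p _ => d = pair (p.unpair.1 + 1) (pair 2 p.unpair.2)) (pair n c)

theorem cnum_iff (n c : ℕ) : CNum n c ↔ c = (Term.numeral n).code := by
  constructor
  · intro h
    have : ∃ m, Nat.pair n c = Nat.pair m (Term.numeral m).code := by
      unfold CNum at h
      generalize Nat.pair n c = c at h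
      induction h with
      | base h => exact ⟨0, h⟩
      | step _ _ h ih _ =>
        obtain ⟨m, rfl⟩ := ih
        simp only [Nat.unpair_pair] at h
        exact ⟨m + 1, h⟩
    obtain ⟨m, h⟩ := this
    rw [Nat.pair_eq_pair] at h
    obtain ⟨rfl, h⟩ := h
    exact h
  · rintro rfl
    unfold CNum
    induction n with
    | zero => exact .base rfl
    | succ n ih => exact .step ih ih (by simp [Term.numeral, Term.code])

theorem Sg.cnum {f g : (ℕ → ℕ) → ℕ} (hf : SgF f) (hg : SgF g) :
    Sg (fun v => CNum (f v) (g v)) := by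
  refine Sg.app2 ?_ hf hg
  unfold CNum
  apply Sg.cl
  all_goals repeat' first
    | with_reducible apply Sg.eq
    | with_reducible apply SgF.pair
    | with_reducible apply SgF.fst
    | with_reducible apply SgF.snd
    | with_reducible apply SgF.add
    | with_reducible apply SgF.var
    | with_reducible apply SgF.const

end ModalArith

namespace ModalArith

abbrev ci (a b : ℕ) : ℕ := Nat.pair 5 (Nat.pair a b)
abbrev ca (a b : ℕ) : ℕ := Nat.pair 3 (Nat.pair a b)
abbrev co (a b : ℕ) : ℕ := Nat.pair 4 (Nat.pair a b)
abbrev cn (a : ℕ) : ℕ := Nat.pair 6 a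
abbrev cAll (x a : ℕ) : ℕ := Nat.pair 7 (Nat.pair x a)
abbrev cEx (x a : ℕ) : ℕ := Nat.pair 8 (Nat.pair x a)
abbrev cEq (a b : ℕ) : ℕ := Nat.pair 1 (Nat.pair a b)
abbrev cLe (a b : ℕ) : ℕ := Nat.pair 2 (Nat.pair a b)

/-- Codes of propositional axioms. -/
def CLog1 (c : ℕ) : Prop := ∃ a b d, CForm a ∧ CForm b ∧ CForm d ∧
  (c = ci a (ci b a) ∨ c = ci (ci a (ci b d)) (ci (ci a b) (ci a d)) ∨ c = ci (cn (cn a)) a ∨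
    c = ci (ci a b) (ci (ci a (cn b)) (cn a)) ∨ c = ci (cn a) (ci a b) ∨
    c = ci (Nat.pair 0 0) a ∨ c = ci (ci a (Nat.pair 0 0)) (cn a) ∨
    c = ci (cn a) (ci a (Nat.pair 0 0)) ∨ c = ci a (ci b (ca a b)) ∨ c = ci (ca a b) a ∨
    c = ci (ca a b) b ∨ c = ci a (co a b) ∨ c = ci b (co a b) ∨
    c = ci (ci a d) (ci (ci b d) (ci (co a b) d)))

/-- Codes of quantifier axioms. -/
def CLog2 (c : ℕ) : Prop :=
  (∃ x t a r, CTerm t ∧ FFree t x a ∧ FSub x t a r ∧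
    (c = ci (cAll x a) r ∨ c = ci r (cEx x a))) ∨
  (∃ x a b, CForm a ∧ CForm b ∧
    ((FSub x Term.zero.code a a ∧ c = ci (cAll x (ci a b)) (ci a (cAll x b))) ∨
      (FSub x Term.zero.code b b ∧ c = ci (cAll x (ci a b)) (ci (cEx x a) b))))

/-- Codes of identity axioms. -/
def CLog3 (c : ℕ) : Prop := ∃ t u w z, CTerm t ∧ CTerm u ∧ CTerm w ∧ CTerm z ∧
  (c = cEq t t ∨ c = ci (cEq t u) (cEq u t) ∨ c = ci (cEq t u) (ci (cEq u w) (cEq t w)) ∨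
    c = ci (cEq t u) (cEq (Nat.pair 2 t) (Nat.pair 2 u)) ∨
    c = ci (cEq t u) (ci (cEq w z) (cEq (Nat.pair 3 (Nat.pair t w)) (Nat.pair 3 (Nat.pair u z)))) ∨
    c = ci (cEq t u) (ci (cEq w z) (cEq (Nat.pair 4 (Nat.pair t w)) (Nat.pair 4 (Nat.pair u z)))) ∨
    c = ci (cEq t u) (ci (cEq w z) (ci (cLe t w) (cLe u z))))

theorem clog_iff (c : ℕ) : (CLog1 c ∨ CLog2 c ∨ CLog3 c) ↔
    ∃ φ : Formula, c = φ.code ∧ LogicalAxiom φ := by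
  constructor
  · rintro (h | h | h)
    · obtain ⟨_, _, _, ⟨φ, rfl⟩, ⟨ψ, rfl⟩, ⟨χ, rfl⟩, h⟩ := h
      rcases h with h | h | h | h | h | h | h | h | h | h | h | h | h | h
      · exact ⟨_, And.symm ⟨LogicalAxiom.imp1 φ ψ, h⟩⟩
      · exact ⟨_, And.symm ⟨LogicalAxiom.imp2 φ ψ χ, h⟩⟩
      · exact ⟨_, And.symm ⟨LogicalAxiom.dne φ, h⟩⟩
      · exact ⟨_, And.symm ⟨LogicalAxiom.negI φ ψ, h⟩⟩
      · exact ⟨_, And.symm ⟨LogicalAxiom.negE φ ψ, h⟩⟩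
      · exact ⟨_, And.symm ⟨LogicalAxiom.falsumE φ, h⟩⟩
      · exact ⟨_, And.symm ⟨LogicalAxiom.negIntro φ, h⟩⟩
      · exact ⟨_, And.symm ⟨LogicalAxiom.negElimFalsum φ, h⟩⟩
      · exact ⟨_, And.symm ⟨LogicalAxiom.andI φ ψ, h⟩⟩
      · exact ⟨_, And.symm ⟨LogicalAxiom.andE1 φ ψ, h⟩⟩
      · exact ⟨_, And.symm ⟨LogicalAxiom.andE2 φ ψ, h⟩⟩
      · exact ⟨_, And.symm ⟨LogicalAxiom.orI1 φ ψ, h⟩⟩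
      · exact ⟨_, And.symm ⟨LogicalAxiom.orI2 φ ψ, h⟩⟩
      · exact ⟨_, And.symm ⟨LogicalAxiom.orE φ ψ χ, h⟩⟩
    · rcases h with ⟨x, _, a, r, ⟨t, rfl⟩, h1, h2, h⟩ | ⟨x, _, _, ⟨φ, rfl⟩, ⟨ψ, rfl⟩, h⟩
      · rw [ffree_iff] at h1
        rw [fsub_iff] at h2
        obtain ⟨φ, rfl, h1⟩ := h1
        obtain ⟨φ', h2, rfl⟩ := h2
        obtain rfl := Formula.code_inj h2
        rcases h with h | h
        · exact ⟨_, And.symm ⟨LogicalAxiom.allE x t φ h1, h⟩⟩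
        · exact ⟨_, And.symm ⟨LogicalAxiom.exI x t φ h1, h⟩⟩
      · rw [not_mem_fv_iff, not_mem_fv_iff] at h
        rcases h with ⟨h1, h⟩ | ⟨h1, h⟩
        · exact ⟨_, And.symm ⟨LogicalAxiom.allImp x φ ψ h1, h⟩⟩
        · exact ⟨_, And.symm ⟨LogicalAxiom.exE x φ ψ h1, h⟩⟩
    · obtain ⟨_, _, _, _, ⟨t, rfl⟩, ⟨u, rfl⟩, ⟨w, rfl⟩, ⟨z, rfl⟩, h⟩ := h
      rcases h with h | h | h | h | h | h | h
      · exact ⟨_, And.symm ⟨LogicalAxiom.eqRefl t, h⟩⟩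
      · exact ⟨_, And.symm ⟨LogicalAxiom.eqSymm t u, h⟩⟩
      · exact ⟨_, And.symm ⟨LogicalAxiom.eqTrans t u w, h⟩⟩
      · exact ⟨_, And.symm ⟨LogicalAxiom.eqSucc t u, h⟩⟩
      · exact ⟨_, And.symm ⟨LogicalAxiom.eqAdd t u w z, h⟩⟩
      · exact ⟨_, And.symm ⟨LogicalAxiom.eqMul t u w z, h⟩⟩
      · exact ⟨_, And.symm ⟨LogicalAxiom.eqLe t u w z, h⟩⟩
  · rintro ⟨_, rfl, h⟩
    cases h with
    | imp1 φ ψ =>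
      exact Or.inl ⟨_, _, _, ⟨φ, rfl⟩, ⟨ψ, rfl⟩, ⟨φ, rfl⟩, by simp [Formula.code]⟩
    | imp2 φ ψ χ =>
      exact Or.inl ⟨_, _, _, ⟨φ, rfl⟩, ⟨ψ, rfl⟩, ⟨χ, rfl⟩, by simp [Formula.code]⟩
    | dne φ =>
      exact Or.inl ⟨_, _, _, ⟨φ, rfl⟩, ⟨φ, rfl⟩, ⟨φ, rfl⟩, by simp [Formula.code]⟩
    | negI φ ψ =>
      exact Or.inl ⟨_, _, _, ⟨φ, rfl⟩, ⟨ψ, rfl⟩, ⟨φ, rfl⟩, by simp [Formula.code]⟩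
    | negE φ ψ =>
      exact Or.inl ⟨_, _, _, ⟨φ, rfl⟩, ⟨ψ, rfl⟩, ⟨φ, rfl⟩, by simp [Formula.code]⟩
    | falsumE φ =>
      exact Or.inl ⟨_, _, _, ⟨φ, rfl⟩, ⟨φ, rfl⟩, ⟨φ, rfl⟩, by simp [Formula.code]⟩
    | negIntro φ =>
      exact Or.inl ⟨_, _, _, ⟨φ, rfl⟩, ⟨φ, rfl⟩, ⟨φ, rfl⟩, by simp [Formula.code]⟩
    | negElimFalsum φ =>
      exact Or.inl ⟨_, _, _, ⟨φ, rfl⟩, ⟨φ, rfl⟩, ⟨φ, rfl⟩, by simp [Formula.code]⟩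
    | andI φ ψ =>
      exact Or.inl ⟨_, _, _, ⟨φ, rfl⟩, ⟨ψ, rfl⟩, ⟨φ, rfl⟩, by simp [Formula.code]⟩
    | andE1 φ ψ =>
      exact Or.inl ⟨_, _, _, ⟨φ, rfl⟩, ⟨ψ, rfl⟩, ⟨φ, rfl⟩, by simp [Formula.code]⟩
    | andE2 φ ψ =>
      exact Or.inl ⟨_, _, _, ⟨φ, rfl⟩, ⟨ψ, rfl⟩, ⟨φ, rfl⟩, by simp [Formula.code]⟩
    | orI1 φ ψ =>
      exact Or.inl ⟨_, _, _, ⟨φ, rfl⟩, ⟨ψ, rfl⟩, ⟨φ, rfl⟩, by simp [Formula.code]⟩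
    | orI2 φ ψ =>
      exact Or.inl ⟨_, _, _, ⟨φ, rfl⟩, ⟨ψ, rfl⟩, ⟨φ, rfl⟩, by simp [Formula.code]⟩
    | orE φ ψ χ =>
      exact Or.inl ⟨_, _, _, ⟨φ, rfl⟩, ⟨ψ, rfl⟩, ⟨χ, rfl⟩, by simp [Formula.code]⟩
    | allE x t φ h =>
      exact Or.inr (Or.inl (Or.inl ⟨x, _, _, _, ⟨t, rfl⟩, (ffree_iff _ _ _).2 ⟨φ, rfl, h⟩,
        (fsub_iff _ _ _ _).2 ⟨φ, rfl, rfl⟩, Or.inl rfl⟩))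
    | exI x t φ h =>
      exact Or.inr (Or.inl (Or.inl ⟨x, _, _, _, ⟨t, rfl⟩, (ffree_iff _ _ _).2 ⟨φ, rfl, h⟩,
        (fsub_iff _ _ _ _).2 ⟨φ, rfl, rfl⟩, Or.inr rfl⟩))
    | allImp x φ ψ h =>
      exact Or.inr (Or.inl (Or.inr ⟨x, _, _, ⟨φ, rfl⟩, ⟨ψ, rfl⟩,
        Or.inl ⟨(not_mem_fv_iff _ _).2 h, rfl⟩⟩))
    | exE x φ ψ h =>
      exact Or.inr (Or.inl (Or.inr ⟨x, _, _, ⟨φ, rfl⟩, ⟨ψ, rfl⟩,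
        Or.inr ⟨(not_mem_fv_iff _ _).2 h, rfl⟩⟩))
    | eqRefl t =>
      exact Or.inr (Or.inr ⟨_, _, _, _, ⟨t, rfl⟩, ⟨t, rfl⟩, ⟨t, rfl⟩, ⟨t, rfl⟩,
        by simp [Formula.code]⟩)
    | eqSymm t u =>
      exact Or.inr (Or.inr ⟨_, _, _, _, ⟨t, rfl⟩, ⟨u, rfl⟩, ⟨t, rfl⟩, ⟨t, rfl⟩,
        by simp [Formula.code]⟩)
    | eqTrans t u w =>
      exact Or.inr (Or.inr ⟨_, _, _, _, ⟨t, rfl⟩, ⟨u, rfl⟩, ⟨w, rfl⟩, ⟨t, rfl⟩,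
        by simp [Formula.code]⟩)
    | eqSucc t u =>
      exact Or.inr (Or.inr ⟨_, _, _, _, ⟨t, rfl⟩, ⟨u, rfl⟩, ⟨t, rfl⟩, ⟨t, rfl⟩,
        by simp [Formula.code, Term.code]⟩)
    | eqAdd t u w z =>
      exact Or.inr (Or.inr ⟨_, _, _, _, ⟨t, rfl⟩, ⟨u, rfl⟩, ⟨w, rfl⟩, ⟨z, rfl⟩,
        by simp [Formula.code, Term.code]⟩)
    | eqMul t u w z =>
      exact Or.inr (Or.inr ⟨_, _, _, _, ⟨t, rfl⟩, ⟨u, rfl⟩, ⟨w, rfl⟩, ⟨z, rfl⟩,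
        by simp [Formula.code, Term.code]⟩)
    | eqLe t u w z =>
      exact Or.inr (Or.inr ⟨_, _, _, _, ⟨t, rfl⟩, ⟨u, rfl⟩, ⟨w, rfl⟩, ⟨z, rfl⟩,
        by simp [Formula.code]⟩)

theorem sg_clog1 : Sg (fun v => CLog1 (v 0)) := by
  unfold CLog1
  repeat' first
    | with_reducible apply Sg.and
    | with_reducible apply Sg.or
    | with_reducible apply Sg.cform
    | with_reducible apply Sg.eq
    | with_reducible apply Sg.ex
    | with_reducible apply SgF.pair
    | with_reducible apply SgF.var
    | with_reducible apply SgF.const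

theorem sg_clog2 : Sg (fun v => CLog2 (v 0)) := by
  unfold CLog2
  repeat' first
    | with_reducible apply Sg.and
    | with_reducible apply Sg.or
    | with_reducible apply Sg.cform
    | with_reducible apply Sg.cterm
    | with_reducible apply Sg.ffree
    | with_reducible apply Sg.fsub
    | with_reducible apply Sg.eq
    | with_reducible apply Sg.ex
    | with_reducible apply SgF.pair
    | with_reducible apply SgF.var
    | with_reducible apply SgF.const

theorem sg_clog3 : Sg (fun v => CLog3 (v 0)) := by
  unfold CLog3
  repeat' first
    | with_reducible apply Sg.and
    | with_reducible apply Sg.or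
    | with_reducible apply Sg.cterm
    | with_reducible apply Sg.eq
    | with_reducible apply Sg.ex
    | with_reducible apply SgF.pair
    | with_reducible apply SgF.var
    | with_reducible apply SgF.const

theorem sg_ax {T : Set Formula} (hre : RE T) : Sg (fun v => ∃ φ ∈ T, Formula.code φ = v 0) := by
  have h := Sg.app2 (R := fun x y => x ∈ (Part.assert (∃ φ ∈ T, Formula.code φ = y)
    fun _ => Part.some 0 : Part ℕ)) (partrec_sg hre) (SgF.const 0) (SgF.var 0)
  refine h.congr fun v => ?_
  simp [Part.mem_assert_iff]

/-- Codes of theorems. -/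
def CPr (T : Set Formula) (c : ℕ) : Prop :=
  Cl (fun c => (∃ φ ∈ T, Formula.code φ = c) ∨ CLog1 c ∨ CLog2 c ∨ CLog3 c)
    (fun c p q => p = ci q c ∨ (∃ x, c = cAll x p) ∨ c = Nat.pair 9 p) c

theorem cpr_iff (T : Set Formula) (c : ℕ) : CPr T c ↔ ∃ φ : Formula, c = φ.code ∧ Provable T φ := by
  constructor
  · intro h
    unfold CPr at h
    induction h with
    | base h =>
      rw [clog_iff] at h
      rcases h with ⟨φ, h, rfl⟩ | ⟨φ, rfl, h⟩
      · exact ⟨φ, rfl, .ax h⟩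
      · exact ⟨φ, rfl, .logic h⟩
    | step _ _ h ih1 ih2 =>
      obtain ⟨φ, rfl, h1⟩ := ih1
      obtain ⟨ψ, rfl, h2⟩ := ih2
      rcases h with h | ⟨x, rfl⟩ | rfl
      · cases φ <;> simp only [Formula.code, Nat.pair_eq_pair] at h <;> first | omega | skip
        obtain ⟨_, h3, rfl⟩ := h
        obtain rfl := Formula.code_inj h3
        exact ⟨_, rfl, h1.mp h2⟩
      · exact ⟨_, rfl, h1.gen x⟩
      · exact ⟨_, rfl, h1.nec⟩
  · rintro ⟨φ, rfl, h⟩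
    unfold CPr
    induction h with
    | ax h => exact .base (Or.inl ⟨_, h, rfl⟩)
    | logic h => exact .base (Or.inr ((clog_iff _).2 ⟨_, rfl, h⟩))
    | mp _ _ ih1 ih2 => exact .step ih1 ih2 (Or.inl rfl)
    | gen x _ ih => exact .step ih ih (Or.inr (Or.inl ⟨x, rfl⟩))
    | nec _ ih => exact .step ih ih (Or.inr (Or.inr rfl))

theorem Sg.cpr {T : Set Formula} (hre : RE T) {f : (ℕ → ℕ) → ℕ} (hf : SgF f) :
    Sg (fun v => CPr T (f v)) := by
  unfold CPr
  refine Sg.cl (A := fun c _ => (∃ φ ∈ T, Formula.code φ = c) ∨ CLog1 c ∨ CLog2 c ∨ CLog3 c)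
    (R := fun c p q _ => p = ci q c ∨ (∃ x, c = cAll x p) ∨ c = Nat.pair 9 p) ?_ ?_ hf
  · exact (sg_ax hre).or (sg_clog1.or (sg_clog2.or sg_clog3))
  · repeat' first
    | with_reducible apply Sg.or
    | with_reducible apply Sg.eq
    | with_reducible apply Sg.ex
    | with_reducible apply SgF.pair
    | with_reducible apply SgF.var
    | with_reducible apply SgF.const

/-- The two self-referential sets. -/
def K1 (T : Set Formula) (p c : ℕ) : Prop :=
  ∃ χ ψ : Formula, c = (χ.or ψ).code ∧ Provable T (χ.subst p (Term.numeral c))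

def K2 (T : Set Formula) (p c : ℕ) : Prop :=
  ∃ χ ψ : Formula, c = (χ.or ψ).code ∧ Provable T (ψ.subst p (Term.numeral c))

theorem sg_K1 {T : Set Formula} (hre : RE T) (p : ℕ) : Sg (fun v => K1 T p (v 0)) := by
  have h : Sg (fun v => ∃ a b n r, v 0 = co a b ∧ CForm b ∧ CNum (v 0) n ∧ FSub p n a r ∧
      CPr T r) := by
    repeat' first
      | with_reducible apply Sg.and
      | with_reducible apply Sg.cform
      | with_reducible apply Sg.cnum
      | with_reducible apply Sg.fsub
      | with_reducible apply Sg.cpr hre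
      | with_reducible apply Sg.eq
      | with_reducible apply Sg.ex
      | with_reducible apply SgF.pair
      | with_reducible apply SgF.var
      | with_reducible apply SgF.const
  refine h.congr fun v => ?_
  constructor
  · rintro ⟨χ, ψ, h1, h2⟩
    exact ⟨_, _, _, _, h1, ⟨ψ, rfl⟩, (cnum_iff _ _).2 rfl, (fsub_iff _ _ _ _).2 ⟨χ, rfl, rfl⟩,
      (cpr_iff _ _).2 ⟨_, rfl, h2⟩⟩
  · rintro ⟨a, _, n, r, h1, ⟨ψ, rfl⟩, h2, h3, h4⟩
    rw [cnum_iff] at h2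
    subst h2
    rw [fsub_iff] at h3
    obtain ⟨χ, rfl, rfl⟩ := h3
    rw [cpr_iff] at h4
    obtain ⟨θ, h4, h5⟩ := h4
    obtain rfl := Formula.code_inj h4
    exact ⟨χ, ψ, h1, h5⟩

theorem sg_K2 {T : Set Formula} (hre : RE T) (p : ℕ) : Sg (fun v => K2 T p (v 0)) := by
  have h : Sg (fun v => ∃ a b n r, v 0 = co b a ∧ CForm b ∧ CNum (v 0) n ∧ FSub p n a r ∧
      CPr T r) := by
    repeat' first
      | with_reducible apply Sg.and
      | with_reducible apply Sg.cform
      | with_reducible apply Sg.cnum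
      | with_reducible apply Sg.fsub
      | with_reducible apply Sg.cpr hre
      | with_reducible apply Sg.eq
      | with_reducible apply Sg.ex
      | with_reducible apply SgF.pair
      | with_reducible apply SgF.var
      | with_reducible apply SgF.const
  refine h.congr fun v => ?_
  constructor
  · rintro ⟨χ, ψ, h1, h2⟩
    exact ⟨_, _, _, _, h1, ⟨χ, rfl⟩, (cnum_iff _ _).2 rfl, (fsub_iff _ _ _ _).2 ⟨ψ, rfl, rfl⟩,
      (cpr_iff _ _).2 ⟨_, rfl, h2⟩⟩
  · rintro ⟨a, _, n, r, h1, ⟨ψ, rfl⟩, h2, h3, h4⟩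
    rw [cnum_iff] at h2
    subst h2
    rw [fsub_iff] at h3
    obtain ⟨χ, rfl, rfl⟩ := h3
    rw [cpr_iff] at h4
    obtain ⟨θ, h4, h5⟩ := h4
    obtain rfl := Formula.code_inj h4
    exact ⟨ψ, χ, h1, h5⟩

theorem K1_iff (T : Set Formula) (p : ℕ) (χ ψ : Formula) : K1 T p (χ.or ψ).code ↔
    Provable T (χ.subst p (Term.numeral (χ.or ψ).code)) := by
  constructor
  · rintro ⟨χ', ψ', h1, h2⟩
    have := Formula.code_inj h1
    injection this with h3 h4
    subst h3 h4
    exact h2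
  · intro h; exact ⟨χ, ψ, rfl, h⟩

theorem K2_iff (T : Set Formula) (p : ℕ) (χ ψ : Formula) : K2 T p (χ.or ψ).code ↔
    Provable T (ψ.subst p (Term.numeral (χ.or ψ).code)) := by
  constructor
  · rintro ⟨χ', ψ', h1, h2⟩
    have := Formula.code_inj h1
    injection this with h3 h4
    subst h3 h4
    exact h2
  · intro h; exact ⟨χ, ψ, rfl, h⟩

/-! ### Normal form for Sigma_1 formulas -/

/-- All variables, free or bound. -/
def Formula.vars : Formula → Finset ℕ
  | .falsum => ∅
  | .eq t u => t.fv ∪ u.fv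
  | .le t u => t.fv ∪ u.fv
  | .and φ ψ => vars φ ∪ vars ψ
  | .or φ ψ => vars φ ∪ vars ψ
  | .imp φ ψ => vars φ ∪ vars ψ
  | .neg φ => vars φ
  | .all x φ => insert x (vars φ)
  | .ex x φ => insert x (vars φ)
  | .box φ => vars φ

theorem Formula.fv_subset_vars (φ : Formula) : φ.fv ⊆ φ.vars := by
  induction φ with
  | falsum => simp [fv, vars]
  | eq t u => simp [fv, vars]
  | le t u => simp [fv, vars]
  | and φ ψ ih1 ih2 => exact Finset.union_subset_union ih1 ih2
  | or φ ψ ih1 ih2 => exact Finset.union_subset_union ih1 ih2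
  | imp φ ψ ih1 ih2 => exact Finset.union_subset_union ih1 ih2
  | neg φ ih => exact ih
  | box φ ih => exact ih
  | all x φ ih => exact (Finset.erase_subset _ _).trans (ih.trans (Finset.subset_insert _ _))
  | ex x φ ih => exact (Finset.erase_subset _ _).trans (ih.trans (Finset.subset_insert _ _))

theorem sigma1_normal {φ : Formula} (h : IsSigma1 φ) {b : ℕ} (hb : b ∉ φ.vars) :
    ∃ δ : Formula, IsDelta0 δ ∧ δ.fv ⊆ insert b φ.fv ∧
      (∀ v, φ.val v ↔ ∃ m, δ.val (Function.update v b m)) ∧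
      (∀ v m m', m ≤ m' → δ.val (Function.update v b m) → δ.val (Function.update v b m')) := by
  induction h with
  | @delta0 φ h =>
    have hb' : b ∉ φ.fv := fun h => hb (φ.fv_subset_vars h)
    have key : ∀ v m, φ.val (Function.update v b m) ↔ φ.val v := fun v m =>
      Formula.val_congr fun y hy => by rw [Function.update_of_ne]; rintro rfl; exact hb' hy
    exact ⟨φ, h, Finset.subset_insert _ _, fun v => by simp [key], fun v m m' _ => by simp [key]⟩
  | @and φ ψ _ _ ih1 ih2 =>
    simp only [Formula.vars, Finset.mem_union, not_or] at hb
    obtain ⟨δ, d1, d2, d3, d4⟩ := ih1 hb.1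
    obtain ⟨ε, e1, e2, e3, e4⟩ := ih2 hb.2
    refine ⟨δ.and ε, d1.and e1, ?_, fun v => ?_, fun v m m' hm => ?_⟩
    · simp only [Formula.fv]
      intro y hy
      simp only [Finset.mem_union] at hy
      rcases hy with hy | hy
      · have := d2 hy; simp at this ⊢; tauto
      · have := e2 hy; simp at this ⊢; tauto
    · simp only [Formula.val, d3, e3]
      constructor
      · rintro ⟨⟨m, h⟩, ⟨m', h'⟩⟩
        exact ⟨max m m', d4 v _ _ (le_max_left _ _) h, e4 v _ _ (le_max_right _ _) h'⟩
      · rintro ⟨m, h, h'⟩; exact ⟨⟨m, h⟩, ⟨m, h'⟩⟩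
    · rintro ⟨h, h'⟩; exact ⟨d4 v _ _ hm h, e4 v _ _ hm h'⟩
  | @or φ ψ _ _ ih1 ih2 =>
    simp only [Formula.vars, Finset.mem_union, not_or] at hb
    obtain ⟨δ, d1, d2, d3, d4⟩ := ih1 hb.1
    obtain ⟨ε, e1, e2, e3, e4⟩ := ih2 hb.2
    refine ⟨δ.or ε, d1.or e1, ?_, fun v => ?_, fun v m m' hm => ?_⟩
    · simp only [Formula.fv]
      intro y hy
      simp only [Finset.mem_union] at hy
      rcases hy with hy | hy
      · have := d2 hy; simp at this ⊢; tauto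
      · have := e2 hy; simp at this ⊢; tauto
    · simp only [Formula.val, d3, e3, exists_or]
    · rintro (h | h)
      · exact Or.inl (d4 v _ _ hm h)
      · exact Or.inr (e4 v _ _ hm h)
  | @ex x φ _ ih =>
    simp only [Formula.vars, Finset.mem_insert, not_or] at hb
    obtain ⟨δ, d1, d2, d3, d4⟩ := ih hb.2
    have hbx : x ≠ b := fun h => hb.1 h.symm
    have key : ∀ v m, (Formula.bex x (Term.succ (Term.var b)) δ).val (Function.update v b m) ↔
        ∃ n, n ≤ m ∧ δ.val (Function.update (Function.update v x n) b m) := by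
      intro v m
      simp only [Formula.bex, Formula.lt, Formula.val, Term.val, Function.update_self,
        Function.update_of_ne hb.1]
      refine exists_congr fun n => ?_
      rw [Function.update_comm hbx]
      exact and_congr_left' (by omega)
    refine ⟨Formula.bex x (Term.succ (Term.var b)) δ, .bex (by simp [Term.fv, hbx]) d1,
      ?_, fun v => ?_, fun v m m' hm => ?_⟩
    · intro y hy
      simp only [Formula.bex, Formula.lt, Formula.fv, Term.fv, Finset.mem_erase, Finset.mem_union,
        Finset.mem_singleton] at hy
      rcases hy with ⟨h1, (h2 | h2) | h2⟩
      · exact absurd h2 h1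
      · simp [h2]
      · have := d2 h2
        simp only [Finset.mem_insert, Formula.fv, Finset.mem_erase] at this ⊢
        tauto
    · simp only [key]
      simp only [Formula.val, d3]
      constructor
      · rintro ⟨n, m, h⟩
        exact ⟨max n m, n, le_max_left _ _, d4 _ _ _ (le_max_right _ _) h⟩
      · rintro ⟨m, n, _, h⟩; exact ⟨n, m, h⟩
    · simp only [key]
      rintro ⟨n, h1, h2⟩
      exact ⟨n, h1.trans hm, d4 _ _ _ hm h2⟩
  | @ball x t φ hx _ ih =>
    simp only [Formula.ball, Formula.lt, Formula.vars, Term.fv, Finset.mem_insert,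
      Finset.mem_union, Finset.mem_singleton, not_or] at hb
    obtain ⟨hb1, ⟨_, hb2⟩, hb3⟩ := hb
    obtain ⟨δ, d1, d2, d3, d4⟩ := ih hb3
    have hbx : x ≠ b := fun h => hb1 h.symm
    have key0 : ∀ v (ψ : Formula), (Formula.ball x t ψ).val v ↔
        ∀ n < t.val v, ψ.val (Function.update v x n) := by
      intro v ψ
      simp only [Formula.ball, Formula.lt, Formula.val, Term.val, Function.update_self,
        term_val_update hx]
      rfl
    have key : ∀ v m, (Formula.ball x t δ).val (Function.update v b m) ↔
        ∀ n < t.val v, δ.val (Function.update (Function.update v x n) b m) := by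
      intro v m
      rw [key0, term_val_update hb2]
      refine forall_congr' fun n => ?_
      rw [Function.update_comm hbx]
    refine ⟨Formula.ball x t δ, .ball hx d1, ?_, fun v => ?_, fun v m m' hm => ?_⟩
    · intro y hy
      simp only [Formula.ball, Formula.lt, Formula.fv, Term.fv, Finset.mem_erase, Finset.mem_union,
        Finset.mem_singleton, Finset.mem_insert] at hy ⊢
      rcases hy with ⟨h1, h2 | h2⟩
      · tauto
      · have := d2 h2
        simp only [Finset.mem_insert] at this
        tauto
    · simp only [key]
      rw [key0]
      simp only [d3]
      constructor
      · intro h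
        choose g hg using h
        classical
        let G : ℕ → ℕ := fun n => if hn : n < t.val v then g n hn else 0
        refine ⟨(Finset.range (t.val v)).sup G, fun n hn => d4 _ _ _ ?_ (hg n hn)⟩
        have := Finset.le_sup (f := G) (Finset.mem_range.2 hn)
        simpa [G, hn] using this
      · rintro ⟨m, h⟩ n hn; exact ⟨m, h n hn⟩
    · simp only [key]
      intro h n hn
      exact d4 _ _ _ hm (h n hn)

/-- Sigma_1 numeration of a set by a single formula with a named variable. -/
theorem Sg.named {K : ℕ → Prop} (h : Sg (fun v => K (v 0))) (p : ℕ) :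
    ∃ φ, IsSigma1 φ ∧ φ.fv ⊆ {p} ∧ ∀ v, φ.val v ↔ K (v p) := by
  obtain ⟨N, h⟩ := h
  obtain ⟨φ, h1, h2, h3⟩ := h fun _ => p
  refine ⟨φ, h1, fun x hx => ?_, h3⟩
  obtain ⟨i, _, rfl⟩ := h2 x hx
  simp

end ModalArith

namespace ModalArith

/-- Iterated successor. -/
def sIt : ℕ → Term → Term
  | 0, t => t
  | n + 1, t => (sIt n t).succ

theorem sIt_fv (m : ℕ) (t : Term) : (sIt m t).fv = t.fv := by
  induction m with
  | zero => rfl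
  | succ m ih => exact ih

theorem sIt_substAll (m : ℕ) (t : Term) (v : ℕ → Term) :
    (sIt m t).substAll v = sIt m (t.substAll v) := by
  induction m with
  | zero => rfl
  | succ m ih => simp [sIt, Term.substAll, ih]

theorem le_sIt {T : Set Formula} (hT : Extends T PABox) (m : ℕ) (t : Term) :
    Provable T (Formula.le (Term.numeral m) (sIt m t)) := by
  induction m with
  | zero => exact pZeroLe hT t
  | succ m ih =>
    have a := pSuccLe hT (Term.numeral m) (sIt m t)
    refine provable_of_models fun V hV => ?_
    exact ((hV.iff _ _).1 (hV.thm _ a)).2 (hV.thm _ ih)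

theorem sentence_numeralSubst (φ : Formula) (v : ℕ → ℕ) :
    Sentence (φ.substAll (numeralSubst v)) := by
  unfold Sentence
  ext y
  simp [Formula.fv_substAll (good_numeralSubst v), numeralSubst, numeral_fv]

theorem delta0Sound {T : Set Formula} (hT : Extends T PABox) (hc : Consistent T) {φ : Formula}
    (h : IsDelta0 φ) (v : ℕ → ℕ) (hp : Provable T (φ.substAll (numeralSubst v))) : φ.val v := by
  by_contra hn
  have a := (delta0Complete hT h v).2 hn
  exact hc (provable_of_models fun V hV => absurd (hV.thm _ hp) ((hV.neg _).1 (hV.thm _ a)))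

theorem reduction {T : Set Formula} (hT : Extends T PABox) (hDP : HasDP T IsSigmaB) (x m : ℕ)
    (θ : Formula) (hθ : IsSB θ) (hfv : θ.fv ⊆ {x}) (h : Provable T (Formula.ex x θ))
    (hn : Provable T (θ.subst x (sIt m (Term.var x))).neg) :
    ∃ i, Provable T (θ.subst x (Term.numeral i)) := by
  induction m generalizing θ with
  | zero =>
    simp only [sIt, Formula.subst_self] at hn
    have a : Provable T (θ.imp Formula.falsum) :=
      provable_of_models fun V hV => (hV.imp _ _).2 fun a => absurd a ((hV.neg _).1 (hV.thm _ hn))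
    have b := Provable.mp (Provable.exImp (by simp [Formula.fv]) a) h
    exact ⟨0, Provable.mp (Provable.logic (.falsumE _)) b⟩
  | succ m ih =>
    have good : Good (Function.update Term.var x (Term.var x).succ) :=
      Good.var.update (by simp [Term.fv])
    have good0 : Good (Function.update Term.var x Term.zero) :=
      Good.var.update (by simp [Term.fv])
    have s0 : Sentence (θ.subst x Term.zero) := by
      unfold Sentence
      ext y
      simp only [Formula.subst, Formula.fv_substAll good0, Finset.notMem_empty, iff_false, not_and]
      intro hy
      have := Finset.mem_singleton.1 (hfv hy)
      subst this
      simp [Term.fv]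
    have f1 : (θ.subst x (Term.var x).succ).fv ⊆ {x} := by
      intro y hy
      rw [Formula.subst, Formula.fv_substAll good] at hy
      exact hfv hy.1
    have s1 : Sentence (Formula.ex x (θ.subst x (Term.var x).succ)) := by
      unfold Sentence
      ext y
      simp only [Formula.fv, Finset.mem_erase, Finset.notMem_empty, iff_false, not_and]
      intro h1 h2
      exact h1 (Finset.mem_singleton.1 (f1 h2))
    set G := (θ.subst x Term.zero).or (Formula.ex x (θ.subst x (Term.var x).succ)) with hG
    have sG : x ∉ G.fv := by
      have a : (θ.subst x Term.zero).fv = ∅ := s0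
      have b : (Formula.ex x (θ.subst x (Term.var x).succ)).fv = ∅ := s1
      rw [hG, Formula.fv, a, b]; simp
    have a : Provable T (θ.imp G) := by
      refine casesRule hT x ?_ ?_
      · change Provable T ((θ.subst x Term.zero).imp (G.subst x Term.zero))
        rw [Formula.subst_not_mem sG]
        exact Provable.logic (.orI1 _ _)
      · change Provable T ((θ.subst x (Term.var x).succ).imp (G.subst x (Term.var x).succ))
        rw [Formula.subst_not_mem sG]
        refine provable_of_models fun V hV => (hV.imp _ _).2 fun a => (hV.or _ _).2 (Or.inr ?_)
        refine hV.exI (Term.var x) (Formula.freeFor_good (by simp [Term.fv])) ?_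
        rwa [Formula.subst_self]
    have b := Provable.mp (Provable.exImp sG a) h
    have i0 : IsSB (θ.subst x Term.zero) := hθ.substAll good0
    have i1 : IsSB (θ.subst x (Term.var x).succ) := hθ.substAll good
    rcases hDP _ _ (isSB_iff.1 i0) (isSB_iff.1 i1.ex) s0 s1 b with h | h
    · exact ⟨0, h⟩
    · obtain ⟨i, hi⟩ := ih _ i1 f1 h (by
        convert hn using 2
        rw [Formula.subst, Formula.subst, Formula.substAll_substAll _ good]
        apply Formula.substAll_congr
        intro y _
        by_cases e : y = x
        · subst e; simp [Term.substAll, sIt]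
        · simp [Function.update_of_ne e, Term.substAll])
      rw [subst_succ_numeral] at hi
      exact ⟨i + 1, hi⟩

theorem witness {T : Set Formula} (hT : Extends T PABox) (hDP : HasDP T IsSigmaB) (x m : ℕ)
    (θ : Formula) (hθ : IsSB θ) (v : ℕ → ℕ)
    (h : Provable T ((Formula.ex x θ).substAll (numeralSubst v)))
    (hn : Provable T (θ.substAll
      (Function.update (numeralSubst v) x (sIt m (Term.var x)))).neg) :
    ∃ i, Provable T (θ.substAll (numeralSubst (Function.update v x i))) := by
  have g := (good_numeralSubst v).updateVar (x := x)
  obtain ⟨i, hi⟩ := reduction hT hDP x m _ (hθ.substAll g) (by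
    intro y hy
    rw [Formula.fv_substAll g] at hy
    by_contra hne
    rw [Finset.mem_singleton] at hne
    simp [Function.update_of_ne hne, numeralSubst, numeral_fv] at hy) h (by
    convert hn using 2
    rw [Formula.subst, Formula.substAll_substAll _ g]
    apply Formula.substAll_congr
    intro y _
    by_cases e : y = x
    · subst e; simp [Term.substAll]
    · simp [Function.update_of_ne e, numeralSubst])
  rw [Formula.subst_update_numeral] at hi
  exact ⟨i, hi⟩

/-- Bounded version of a formula. -/
def hat (z : ℕ) (α : Formula) (t : Term) : Formula := Formula.bex z t.succ α

theorem hat_delta0 {z : ℕ} {α : Formula} {t : Term} (hα : IsDelta0 α) (hz : z ∉ t.fv) :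
    IsDelta0 (hat z α t) := .bex hz hα

theorem hat_val {z : ℕ} {α : Formula} {t : Term} (hz : z ∉ t.fv) (v : ℕ → ℕ) :
    (hat z α t).val v ↔ ∃ n, n ≤ t.val v ∧ α.val (Function.update v z n) := by
  simp only [hat, Formula.bex, Formula.lt, Formula.val, Term.val, Function.update_self,
    term_val_update hz]
  exact exists_congr fun n => and_congr_left' (by omega)

theorem hat_fv {z p : ℕ} {α : Formula} {t : Term} (hα : α.fv ⊆ {z, p}) {y : ℕ}
    (hy : y ∈ (hat z α t).fv) : y ≠ z ∧ (y = p ∨ y ∈ t.fv) := by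
  simp only [hat, Formula.bex, Formula.lt, Formula.fv, Term.fv, Finset.mem_erase, Finset.mem_union,
    Finset.mem_singleton] at hy
  refine ⟨hy.1, ?_⟩
  rcases hy with ⟨h1, (h2 | h2) | h2⟩
  · exact absurd h2 h1
  · exact Or.inr h2
  · have := hα h2
    simp only [Finset.mem_insert, Finset.mem_singleton] at this
    tauto

theorem hat_subst {z x : ℕ} {α : Formula} {t : Term} (hx : x ∉ α.fv) (hxz : x ≠ z) :
    (hat z α (Term.var x)).subst x t = hat z α t := by
  simp only [hat, Formula.subst, bex_substAll]
  have : α.substAll (Function.update (Function.update Term.var x t) z (Term.var z)) = α := by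
    apply Formula.substAll_id
    intro y hy
    have : y ≠ x := by rintro rfl; exact hx hy
    by_cases e : y = z
    · subst e; simp
    · simp [Function.update_of_ne e, Function.update_of_ne this]
  rw [this]
  simp [Term.substAll, Function.update_of_ne hxz]

theorem hatTrue {T : Set Formula} (hT : Extends T PABox) {z x m : ℕ} {α : Formula}
    (hα : IsDelta0 α) (hx : x ∉ α.fv) (hxz : x ≠ z) (v : ℕ → ℕ)
    (h : α.val (Function.update v z m)) :
    Provable T ((hat z α (Term.var x)).substAll
      (Function.update (numeralSubst v) x (sIt m (Term.var x)))) := by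
  have a := (delta0Complete hT hα _).1 h
  rw [← Formula.subst_update_numeral] at a
  have b := le_sIt hT (m + 1) (Term.var x)
  have e : α.substAll (Function.update (Function.update (numeralSubst v) x (sIt m (Term.var x)))
      z (Term.var z)) = α.substAll (Function.update (numeralSubst v) z (Term.var z)) := by
    apply Formula.substAll_congr
    intro y hy
    have : y ≠ x := by rintro rfl; exact hx hy
    by_cases e : y = z
    · subst e; simp
    · simp [Function.update_of_ne e, Function.update_of_ne this]
  rw [hat, bex_substAll, e]
  refine provable_of_models fun V hV => ?_
  refine hV.exI (Term.numeral m) (Formula.freeFor_good (by simp [numeral_fv])) ?_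
  simp only [Formula.subst, Formula.substAll, Formula.lt]
  rw [hV.and]
  refine ⟨?_, hV.thm _ a⟩
  simpa [Term.substAll, sIt_substAll, Function.update_of_ne hxz, sIt, Term.numeral] using hV.thm _ b

theorem rhoSat_congr {T : Set Formula} {φ : Formula} {v w : ℕ → ℕ} (h : ∀ y ∈ φ.fv, v y = w y) :
    RhoSat T φ v ↔ RhoSat T φ w := by
  induction φ generalizing v w with
  | falsum => rfl
  | eq t u =>
    simp only [RhoSat]
    rw [Term.val_congr (t := t) (v := v) (w := w) fun y hy => h y (by simp [Formula.fv, hy]),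
      Term.val_congr (t := u) (v := v) (w := w) fun y hy => h y (by simp [Formula.fv, hy])]
  | le t u =>
    simp only [RhoSat]
    rw [Term.val_congr (t := t) (v := v) (w := w) fun y hy => h y (by simp [Formula.fv, hy]),
      Term.val_congr (t := u) (v := v) (w := w) fun y hy => h y (by simp [Formula.fv, hy])]
  | and φ ψ ih1 ih2 =>
    simp only [RhoSat]
    rw [ih1 fun y hy => h y (by simp [Formula.fv, hy]),
      ih2 fun y hy => h y (by simp [Formula.fv, hy])]
  | or φ ψ ih1 ih2 =>
    simp only [RhoSat]
    rw [ih1 fun y hy => h y (by simp [Formula.fv, hy]),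
      ih2 fun y hy => h y (by simp [Formula.fv, hy])]
  | imp φ ψ ih1 ih2 =>
    simp only [RhoSat]
    rw [ih1 fun y hy => h y (by simp [Formula.fv, hy]),
      ih2 fun y hy => h y (by simp [Formula.fv, hy])]
  | neg φ ih => exact not_congr (ih h)
  | box φ ih =>
    simp only [RhoSat]
    rw [Formula.substAll_congr (v := numeralSubst v) (w := numeralSubst w) fun y hy => by
      simp only [numeralSubst]; rw [h y hy]]
  | all x φ ih =>
    refine forall_congr' fun n => ih fun y hy => ?_
    by_cases e : y = x
    · subst e; simp
    · simp only [Function.update_of_ne e]; exact h y (by simp [Formula.fv, hy, e])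
  | ex x φ ih =>
    refine exists_congr fun n => ih fun y hy => ?_
    by_cases e : y = x
    · subst e; simp
    · simp only [Function.update_of_ne e]; exact h y (by simp [Formula.fv, hy, e])

theorem relativize {T : Set Formula} (hT : Extends T PABox) (hc : Consistent T)
    (hDP : HasDP T IsSigmaB) {z p x0 : ℕ} {α : Formula} (hα : IsDelta0 α) (hfv : α.fv ⊆ {z, p})
    (h0p : x0 ≠ p) (h0z : x0 ≠ z) {φ : Formula} (h : IsSB φ)
    (hp : p ∉ φ.vars) (hz : z ∉ φ.vars) :
    ∃ φ' : Formula, IsSB φ' ∧ φ'.fv ⊆ insert p φ.fv ∧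
      Provable T ((Formula.all x0 (hat z α (Term.var x0)).neg).imp (φ.imp φ')) ∧
      ∀ v, (∃ m, α.val (Function.update v z m)) →
        Provable T (φ'.substAll (numeralSubst v)) → RhoSat T φ v := by
  have h0α : ∀ x, x ≠ p → x ≠ z → x ∉ α.fv := fun x a b hx => by
    have := hfv hx
    simp only [Finset.mem_insert, Finset.mem_singleton] at this
    tauto
  have triv : ∀ φ : Formula, Provable T ((Formula.all x0 (hat z α (Term.var x0)).neg).imp
      (φ.imp φ)) := fun φ => provable_of_models fun V hV => by
    simp only [hV.imp]; exact fun _ h => h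
  have upd : ∀ v x i, x ≠ p → (∃ m, α.val (Function.update v z m)) →
      ∃ m, α.val (Function.update (Function.update v x i) z m) := by
    rintro v x i hx ⟨m, h⟩
    refine ⟨m, (Formula.val_congr fun y hy => ?_).1 h⟩
    have := hfv hy
    simp only [Finset.mem_insert, Finset.mem_singleton] at this
    by_cases e : y = z
    · subst e; simp
    · have : y = p := by tauto
      subst this
      simp [Function.update_of_ne e, Function.update_of_ne (Ne.symm hx)]
  have hH : ∀ x, x ≠ p → x ∉ (Formula.all x0 (hat z α (Term.var x0)).neg).fv := by
    intro x hx h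
    simp only [Formula.fv, Finset.mem_erase] at h
    have := hat_fv hfv h.2
    simp only [Term.fv, Finset.mem_singleton] at this
    tauto
  induction h with
  | @delta0 φ h =>
    exact ⟨φ, .delta0 h, Finset.subset_insert _ _, triv φ, fun v _ hv =>
      (rhoSat_delta0 h v).2 (delta0Sound hT hc h v hv)⟩
  | b ψ => exact ⟨_, .b ψ, Finset.subset_insert _ _, triv _, fun v _ hv => hv⟩
  | @and φ ψ _ _ ih1 ih2 =>
    simp only [Formula.vars, Finset.mem_union, not_or] at hp hz
    obtain ⟨φ', a1, a2, a3, a4⟩ := ih1 hp.1 hz.1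
    obtain ⟨ψ', b1, b2, b3, b4⟩ := ih2 hp.2 hz.2
    refine ⟨φ'.and ψ', a1.and b1, ?_, ?_, ?_⟩
    · intro y hy
      simp only [Formula.fv, Finset.mem_union, Finset.mem_insert] at hy ⊢
      rcases hy with hy | hy
      · have := a2 hy; simp only [Finset.mem_insert] at this; tauto
      · have := b2 hy; simp only [Finset.mem_insert] at this; tauto
    · refine provable_of_models fun V hV => ?_
      have a := hV.thm _ a3
      have b := hV.thm _ b3
      simp only [hV.imp, hV.and] at a b ⊢
      exact fun h1 h2 => ⟨a h1 h2.1, b h1 h2.2⟩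
    · intro v hv h
      exact ⟨a4 v hv (Provable.mp (Provable.logic (.andE1 _ _)) h),
        b4 v hv (Provable.mp (Provable.logic (.andE2 _ _)) h)⟩
  | @or φ ψ _ _ ih1 ih2 =>
    simp only [Formula.vars, Finset.mem_union, not_or] at hp hz
    obtain ⟨φ', a1, a2, a3, a4⟩ := ih1 hp.1 hz.1
    obtain ⟨ψ', b1, b2, b3, b4⟩ := ih2 hp.2 hz.2
    refine ⟨φ'.or ψ', a1.or b1, ?_, ?_, ?_⟩
    · intro y hy
      simp only [Formula.fv, Finset.mem_union, Finset.mem_insert] at hy ⊢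
      rcases hy with hy | hy
      · have := a2 hy; simp only [Finset.mem_insert] at this; tauto
      · have := b2 hy; simp only [Finset.mem_insert] at this; tauto
    · refine provable_of_models fun V hV => ?_
      have a := hV.thm _ a3
      have b := hV.thm _ b3
      simp only [hV.imp, hV.or] at a b ⊢
      exact fun h1 h2 => h2.imp (a h1) (b h1)
    · intro v hv h
      rcases hDP _ _ (isSB_iff.1 (a1.substAll (good_numeralSubst v)))
        (isSB_iff.1 (b1.substAll (good_numeralSubst v))) (sentence_numeralSubst _ _)
        (sentence_numeralSubst _ _) h with h | h
      · exact Or.inl (a4 v hv h)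
      · exact Or.inr (b4 v hv h)
  | @ex x φ _ ih =>
    simp only [Formula.vars, Finset.mem_insert, not_or] at hp hz
    have hxp : x ≠ p := Ne.symm hp.1
    have hxz : x ≠ z := Ne.symm hz.1
    have hzx : z ∉ (Term.var x).fv := by simpa [Term.fv] using hz.1
    obtain ⟨φ', a1, a2, a3, a4⟩ := ih hp.2 hz.2
    have i1 : IsSB ((hat z α (Term.var x)).neg.and φ') :=
      (IsSB.delta0 (hat_delta0 hα hzx).neg).and a1
    refine ⟨Formula.ex x ((hat z α (Term.var x)).neg.and φ'), i1.ex, ?_, ?_, ?_⟩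
    · intro y hy
      simp only [Formula.fv, Finset.mem_erase, Finset.mem_union, Finset.mem_insert] at hy ⊢
      obtain ⟨h1, hy | hy⟩ := hy
      · have := hat_fv hfv hy
        simp only [Term.fv, Finset.mem_singleton] at this
        tauto
      · have := a2 hy; simp only [Finset.mem_insert] at this; tauto
    · have key : Provable T (φ.imp ((Formula.all x0 (hat z α (Term.var x0)).neg).imp
          (Formula.ex x ((hat z α (Term.var x)).neg.and φ')))) := by
        refine provable_of_models fun V hV => ?_
        have a := hV.thm _ a3
        simp only [hV.imp] at a ⊢
        intro h1 h2
        refine hV.exI (Term.var x) (Formula.freeFor_good (by simp [Term.fv])) ?_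
        rw [Formula.subst_self, hV.and]
        refine ⟨?_, a h2 h1⟩
        have b := hV.allE (Term.var x) (by
          simp [Formula.freeFor, hat, Formula.bex, Formula.lt, Term.fv, Ne.symm hxz,
            Formula.freeFor_not_mem (h0α x0 h0p h0z)]) h2
        change V ((hat z α (Term.var x0)).subst x0 (Term.var x)).neg at b
        rwa [hat_subst (h0α x0 h0p h0z) h0z] at b
      have k2 := Provable.exImp (x := x) (by
        rw [Formula.fv, Finset.mem_union, not_or]
        exact ⟨hH x hxp, by simp [Formula.fv]⟩) key
      refine provable_of_models fun V hV => ?_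
      have a := hV.thm _ k2
      simp only [hV.imp] at a ⊢
      exact fun h1 h2 => a h2 h1
    · intro v hv h
      obtain ⟨m, hm⟩ := hv
      have c := hatTrue hT hα (h0α x hxp hxz) hxz v hm
      obtain ⟨i, hi⟩ := witness hT hDP x m _ i1 v h (by
        refine provable_of_models fun V hV => ?_
        have c' := hV.thm _ c
        simp only [Formula.substAll, hV.neg, hV.and]
        tauto)
      exact ⟨i, a4 _ (upd v x i hxp ⟨m, hm⟩) (Provable.mp (Provable.logic (.andE2 _ _)) hi)⟩
  | @ball x t φ hx _ ih =>
    simp only [Formula.ball, Formula.lt, Formula.vars, Term.fv, Finset.mem_insert,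
      Finset.mem_union, Finset.mem_singleton, not_or] at hp hz
    obtain ⟨φ', a1, a2, a3, a4⟩ := ih hp.2.2 hz.2.2
    have hxp : x ≠ p := Ne.symm hp.1
    refine ⟨Formula.ball x t φ', .ball hx a1, ?_, ?_, ?_⟩
    · intro y hy
      simp only [Formula.ball, Formula.lt, Formula.fv, Term.fv, Finset.mem_erase, Finset.mem_union,
        Finset.mem_singleton, Finset.mem_insert] at hy ⊢
      obtain ⟨h1, hy | hy⟩ := hy
      · tauto
      · have := a2 hy; simp only [Finset.mem_insert] at this; tauto
    · have key : Provable T (((Formula.all x0 (hat z α (Term.var x0)).neg).and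
          (Formula.ball x t φ)).imp ((Formula.lt (Term.var x) t).imp φ')) := by
        refine provable_of_models fun V hV => ?_
        have a := hV.thm _ a3
        simp only [hV.imp, hV.and] at a ⊢
        rintro ⟨h1, h2⟩ h3
        have b := hV.allE (Term.var x) (Formula.freeFor_good (by simp [Term.fv])) h2
        rw [Formula.subst_self, hV.imp] at b
        exact a h1 (b h3)
      have k2 := Provable.impAll (x := x) (by
        rw [Formula.fv, Finset.mem_union, not_or]
        exact ⟨hH x hxp, by simp [Formula.ball, Formula.fv]⟩) key
      refine provable_of_models fun V hV => ?_
      have a := hV.thm _ k2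
      simp only [hV.imp, hV.and] at a ⊢
      exact fun h1 h2 => a ⟨h1, h2⟩
    · intro v hv h
      simp only [Formula.ball, Formula.lt, RhoSat, Term.val, Function.update_self,
        term_val_update hx, Nat.succ_le_iff]
      intro i hi
      exact a4 _ (upd v x i hxp hv) (ballElim hT hx v h hi)

end ModalArith

namespace ModalArith

theorem overspill {T : Set Formula} (hT : Extends T PABox) {z p x : ℕ} {α β : Formula}
    (hα : α.fv ⊆ {z, p}) (hβ : β.fv ⊆ {z, p}) (hxp : x ≠ p) (hxz : x ≠ z) :
    Provable T ((Formula.ex x ((hat z β (Term.var x)).and (hat z α (Term.var x)).neg)).neg.imp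
      (((hat z α Term.zero).or
        (Formula.ex x ((hat z α (Term.var x).succ).and (hat z β (Term.var x)).neg))).neg.imp
        (Formula.all x (hat z α (Term.var x)).neg))) := by
  have h0 : ∀ γ : Formula, γ.fv ⊆ {z, p} → x ∉ γ.fv := fun γ h hx => by
    have := h hx
    simp only [Finset.mem_insert, Finset.mem_singleton] at this
    tauto
  have hs : ∀ γ : Formula, γ.fv ⊆ {z, p} → ∀ t, (hat z γ (Term.var x)).subst x t = hat z γ t :=
    fun γ h t => hat_subst (h0 γ h) hxz
  set A := Formula.ex x ((hat z β (Term.var x)).and (hat z α (Term.var x)).neg) with hA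
  set B := (hat z α Term.zero).or
        (Formula.ex x ((hat z α (Term.var x).succ).and (hat z β (Term.var x)).neg)) with hB
  have fG : x ∉ (A.neg.and B.neg).fv := by
    simp only [hA, hB, Formula.fv, Finset.mem_union, Finset.mem_erase, not_or]
    refine ⟨by simp, fun h => ?_, by simp⟩
    have := hat_fv hα h
    simp only [Term.fv] at this
    simp at this
    tauto
  have exA : ∀ V, PModel T V → ∀ t : Term, t.fv ⊆ {x} → ¬ V A → V (hat z β t) → V (hat z α t) := by
    intro V hV t ht h1 h2
    by_contra h3
    apply h1
    refine hV.exI t (Formula.freeFor_good ht) ?_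
    change V (((hat z β (Term.var x)).subst x t).and ((hat z α (Term.var x)).subst x t).neg)
    rw [hs β hβ, hs α hα, hV.and, hV.neg]
    exact ⟨h2, h3⟩
  have step : Provable T ((A.neg.and B.neg).imp
      ((hat z α (Term.var x)).neg.and (hat z β (Term.var x)).neg)) := by
    have eq : ∀ t, ((A.neg.and B.neg).imp
      ((hat z α (Term.var x)).neg.and (hat z β (Term.var x)).neg)).subst x t =
      ((A.neg.and B.neg).imp ((hat z α t).neg.and (hat z β t).neg)) := by
      intro t
      change ((A.neg.and B.neg).subst x t).imp
        (((hat z α (Term.var x)).subst x t).neg.and ((hat z β (Term.var x)).subst x t).neg) = _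
      rw [hs β hβ, hs α hα, Formula.subst_not_mem fG]
    refine induct hT x ?_ ?_
    · rw [eq]
      refine provable_of_models fun V hV => ?_
      have e := exA V hV Term.zero (by simp [Term.fv])
      simp only [hB, hV.imp, hV.and, hV.neg, hV.or]
      tauto
    · rw [eq]
      refine provable_of_models fun V hV => ?_
      have e := exA V hV (Term.var x).succ (by simp [Term.fv])
      have e2 : V ((hat z α (Term.var x).succ).and (hat z β (Term.var x)).neg) →
          V (Formula.ex x ((hat z α (Term.var x).succ).and (hat z β (Term.var x)).neg)) := by
        intro h
        refine hV.exI (Term.var x) (Formula.freeFor_good (by simp [Term.fv])) ?_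
        rwa [Formula.subst_self]
      simp only [hV.and, hV.neg] at e2
      simp only [hB, hV.imp, hV.and, hV.neg, hV.or]
      tauto
  have step2 : Provable T ((A.neg.and B.neg).imp (hat z α (Term.var x)).neg) :=
    provable_of_models fun V hV => by
      have := hV.thm _ step
      rw [hV.imp, hV.and _ (hat z β (Term.var x)).neg] at this
      rw [hV.imp]
      exact fun h => (this h).1
  have step3 := Provable.impAll fG step2
  refine provable_of_models fun V hV => ?_
  have := hV.thm _ step3
  simp only [hV.imp, hV.and] at this ⊢
  exact fun a b => this ⟨a, b⟩

theorem subst_eq_numeralSubst {φ : Formula} {p : ℕ} (h : φ.fv ⊆ {p}) {v : ℕ → ℕ} {c : ℕ}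
    (hv : v p = c) : φ.subst p (Term.numeral c) = φ.substAll (numeralSubst v) := by
  apply Formula.substAll_congr
  intro y hy
  have := Finset.mem_singleton.1 (h hy)
  subst this
  simp [numeralSubst, hv]

set_option maxHeartbeats 1000000 in
/-- Part (1). -/
theorem part1 {T : Set Formula} (hre : RE T) (hT : Extends T PABox) (hc : Consistent T)
    (hDP : HasDP T IsSigmaB) : WeaklySigmaBSound T := by
  intro φ hφ hsφ hpφ
  obtain ⟨p, hp⟩ := Infinite.exists_notMem_finset φ.vars
  obtain ⟨κ, k1, k2, k3⟩ := (sg_K1 hre p).named p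
  obtain ⟨μ, m1, m2, m3⟩ := (sg_K2 hre p).named p
  obtain ⟨z, hz⟩ := Infinite.exists_notMem_finset (insert p (φ.vars ∪ (κ.vars ∪ μ.vars)))
  obtain ⟨x, hx⟩ := Infinite.exists_notMem_finset ({p, z} : Finset ℕ)
  simp only [Finset.mem_insert, Finset.mem_union, Finset.mem_singleton, not_or] at hz hx
  obtain ⟨hzp, hzφ, hzκ, hzμ⟩ := hz
  obtain ⟨hxp, hxz⟩ := hx
  obtain ⟨α, a1, a2, a3, -⟩ := sigma1_normal k1 hzκ
  obtain ⟨β, b1, b2, b3, -⟩ := sigma1_normal m1 hzμ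
  have a2 : α.fv ⊆ {z, p} := a2.trans (Finset.insert_subset_insert _ k2)
  have b2 : β.fv ⊆ {z, p} := b2.trans (Finset.insert_subset_insert _ m2)
  have a3 : ∀ v, (∃ m, α.val (Function.update v z m)) ↔ K1 T p (v p) := fun v =>
    (a3 v).symm.trans (k3 v)
  have b3 : ∀ v, (∃ m, β.val (Function.update v z m)) ↔ K2 T p (v p) := fun v =>
    (b3 v).symm.trans (m3 v)
  have h0 : ∀ γ : Formula, γ.fv ⊆ {z, p} → x ∉ γ.fv := fun γ h hx => by
    have := h hx
    simp only [Finset.mem_insert, Finset.mem_singleton] at this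
    tauto
  have hzx : z ∉ (Term.var x).fv := by simpa [Term.fv] using Ne.symm hxz
  have hz0 : z ∉ Term.zero.fv := by simp [Term.fv]
  have hzsx : z ∉ (Term.var x).succ.fv := hzx
  obtain ⟨φ', p1, p2, p3, p4⟩ := relativize hT hc hDP a1 a2 hxp hxz (isSB_iff.2 hφ) hp hzφ
  have ov := overspill hT a2 b2 hxp hxz
  set θA := (hat z β (Term.var x)).and (hat z α (Term.var x)).neg with hθA
  set θB := (hat z α (Term.var x).succ).and (hat z β (Term.var x)).neg with hθB
  have dA : IsDelta0 θA := (hat_delta0 b1 hzx).and (hat_delta0 a1 hzx).neg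
  have dB : IsDelta0 θB := (hat_delta0 a1 hzsx).and (hat_delta0 b1 hzx).neg
  have d0 : IsDelta0 (hat z α Term.zero) := hat_delta0 a1 hz0
  set A := φ'.or (Formula.ex x θA) with hA
  set B := (hat z α Term.zero).or (Formula.ex x θB) with hB
  have sA : IsSB A := p1.or (IsSB.delta0 dA).ex
  have sB : IsSB B := (IsSB.delta0 d0).or (IsSB.delta0 dB).ex
  have fA : A.fv ⊆ {p} := by
    intro y hy
    simp only [hA, hθA, Formula.fv, Finset.mem_union, Finset.mem_erase] at hy
    rw [Finset.mem_singleton]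
    rcases hy with hy | ⟨h1, hy | hy⟩
    · have := p2 hy
      have e : φ.fv = ∅ := hsφ
      rw [e] at this
      simpa using this
    · have := hat_fv b2 hy
      simp only [Term.fv, Finset.mem_singleton] at this
      tauto
    · have := hat_fv a2 hy
      simp only [Term.fv, Finset.mem_singleton] at this
      tauto
  have fB : B.fv ⊆ {p} := by
    intro y hy
    simp only [hB, hθB, Formula.fv, Finset.mem_union, Finset.mem_erase] at hy
    rw [Finset.mem_singleton]
    rcases hy with hy | ⟨h1, hy | hy⟩
    · have := hat_fv a2 hy
      simp [Term.fv] at this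
      tauto
    · have := hat_fv a2 hy
      simp only [Term.fv, Finset.mem_singleton] at this
      tauto
    · have := hat_fv b2 hy
      simp only [Term.fv, Finset.mem_singleton] at this
      tauto
  have pAB : Provable T (A.or B) := by
    refine provable_of_models fun V hV => ?_
    have h1 := hV.thm _ ov
    have h2 := hV.thm _ p3
    have h3 := hV.thm _ hpφ
    simp only [hV.imp, hV.neg] at h1 h2
    rw [hV.or, hA, hV.or]
    tauto
  obtain ⟨c, hcode⟩ : ∃ c, c = (A.or B).code := ⟨_, rfl⟩
  obtain ⟨v, hv⟩ : ∃ v : ℕ → ℕ, v p = c := ⟨fun _ => c, rfl⟩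
  have pABc := pAB.substGood p (Term.numeral c) (by simp [numeral_fv])
  have eA : A.subst p (Term.numeral c) = A.substAll (numeralSubst v) :=
    subst_eq_numeralSubst fA hv
  have eB : B.subst p (Term.numeral c) = B.substAll (numeralSubst v) :=
    subst_eq_numeralSubst fB hv
  have iA : (∃ m, α.val (Function.update v z m)) ↔ Provable T (A.substAll (numeralSubst v)) := by
    rw [a3, ← eA, hv, hcode]; exact K1_iff T p A B
  have iB : (∃ m, β.val (Function.update v z m)) ↔ Provable T (B.substAll (numeralSubst v)) := by
    rw [b3, ← eB, hv, hcode]; exact K2_iff T p A B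
  have gv := good_numeralSubst v
  have upd : ∀ γ : Formula, γ.fv ⊆ {z, p} → ∀ i m, γ.val (Function.update
      (Function.update v x i) z m) ↔ γ.val (Function.update v z m) := by
    intro γ hγ i m
    apply Formula.val_congr
    intro y hy
    have : y ≠ x := by rintro rfl; exact h0 γ hγ hy
    by_cases e : y = z
    · subst e; simp
    · simp [Function.update_of_ne e, Function.update_of_ne this]
  -- the case of B
  have caseB : Provable T (B.substAll (numeralSubst v)) →
      ∃ m, α.val (Function.update v z m) ∧ ∀ k < m, ¬ β.val (Function.update v z k) := by
    intro h
    rcases hDP _ _ (isSB_iff.1 ((IsSB.delta0 d0).substAll gv))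
      (isSB_iff.1 ((IsSB.delta0 dB).ex.substAll gv)) (sentence_numeralSubst _ _)
      (sentence_numeralSubst _ _) h with h | h
    · have := delta0Sound hT hc d0 v h
      rw [hat_val hz0] at this
      obtain ⟨n, h1, h2⟩ := this
      simp only [Term.val, Nat.le_zero] at h1
      subst h1
      exact ⟨0, h2, fun k hk => absurd hk (Nat.not_lt_zero k)⟩
    · obtain ⟨m, hm⟩ := iB.2 (Provable.mp (Provable.logic (.orI2 _ _)) h)
      have t := hatTrue hT b1 (h0 β b2) hxz v hm
      obtain ⟨i, hi⟩ := witness hT hDP x m _ (.delta0 dB) v h (by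
        refine provable_of_models fun V hV => ?_
        have t' := hV.thm _ t
        simp only [hθB, Formula.substAll, hV.neg, hV.and]
        exact fun h => h.2 t')
      have := delta0Sound hT hc dB _ hi
      simp only [hθB, Formula.val] at this
      rw [hat_val hzsx, hat_val hzx] at this
      obtain ⟨⟨n, h1, h2⟩, h3⟩ := this
      simp only [Term.val, Function.update_self, upd α a2, upd β b2] at h1 h2 h3
      exact ⟨n, h2, fun k hk h => h3 ⟨k, by omega, h⟩⟩
  have caseA : Provable T (A.substAll (numeralSubst v)) → RhoSat T φ v := by
    intro h
    rcases hDP _ _ (isSB_iff.1 (p1.substAll gv))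
      (isSB_iff.1 ((IsSB.delta0 dA).ex.substAll gv)) (sentence_numeralSubst _ _)
      (sentence_numeralSubst _ _) h with h' | h'
    · exact p4 v (iA.2 h) h'
    · exfalso
      obtain ⟨m, hm⟩ := iA.2 h
      have t := hatTrue hT a1 (h0 α a2) hxz v hm
      obtain ⟨i, hi⟩ := witness hT hDP x m _ (.delta0 dA) v h' (by
        refine provable_of_models fun V hV => ?_
        have t' := hV.thm _ t
        simp only [hθA, Formula.substAll, hV.neg, hV.and]
        exact fun h => h.2 t')
      have := delta0Sound hT hc dA _ hi
      simp only [hθA, Formula.val] at this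
      rw [hat_val hzx, hat_val hzx] at this
      obtain ⟨⟨n, h1, h2⟩, h3⟩ := this
      simp only [Term.val, Function.update_self, upd α a2, upd β b2] at h1 h2 h3
      obtain ⟨k, hk1, hk2⟩ := caseB (iB.1 ⟨n, h2⟩)
      by_cases hkn : n < k
      · exact hk2 n hkn h2
      · exact h3 ⟨k, by omega, hk1⟩
  have fin : RhoSat T φ v := by
    rcases hDP _ _ (isSB_iff.1 (sA.substAll gv)) (isSB_iff.1 (sB.substAll gv))
      (sentence_numeralSubst _ _) (sentence_numeralSubst _ _) (by
        rw [← eA, ← eB]; exact pABc) with h | h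
    · exact caseA h
    · obtain ⟨m, hm, -⟩ := caseB h
      exact caseA (iA.1 ⟨m, hm⟩)
  refine (rhoSat_congr fun y hy => ?_).1 fin
  have e : φ.fv = ∅ := hsφ
  rw [e] at hy
  simp at hy

theorem statement18 (T : Set Formula) (hre : RE T) (hT : Extends T PABox) :
    (Extends T PAK → ¬ Provable T (Formula.box Formula.falsum) →
      HasDP T IsSigmaB → WeaklySigmaBSound T) ∧
    (WeaklySigmaBSound T → HasEP T IsSigmaB) :=
  ⟨fun _ hb hDP => part1 hre hT (fun h => hb (Provable.nec h)) hDP, part2 hT⟩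

end ModalArith
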